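/- Up to a parity change, any simple cuspidal g-module is isomorphic to a simple quotient of a tensor module Γ(λ,V,b) for some finite-dimensional simple ġ-module V and some λ,b ∈ ℂ. -/

import Mathlib

/-!
Representations of the centerless superconformal current algebra
`g = s̄ ⋉ (ġ ⊗ A)`, where `s̄` is the centerless `N = 1` Ramond algebra and
`A = ℂ[t^{±1}] ⊗ Λ(ξ)`.  A representation is encoded by the operators by which
the basis elements `L i`, `G i`, `x ⊗ tⁱ` (operator `E i x`) and `x ⊗ tⁱξ`
(operator `F i x`) act, subject to the supercommutator relations.
-/

noncomputable section

open Module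

variable (𝕘 : Type) [LieRing 𝕘] [LieAlgebra ℂ 𝕘]

/-- The operators `L, G, E, F` on `M` form a representation of
`g = s̄ ⋉ (ġ ⊗ A)`. -/
structure IsGRep {M : Type} [AddCommGroup M] [Module ℂ M]
    (L G : ℤ → End ℂ M) (E F : ℤ → 𝕘 →ₗ[ℂ] End ℂ M) : Prop where
  comm_LL : ∀ i j : ℤ, L i * L j - L j * L i = ((j : ℂ) - (i : ℂ)) • L (i + j)
  comm_LG : ∀ i j : ℤ, L i * G j - G j * L i = ((j : ℂ) - (i : ℂ) / 2) • G (i + j)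
  comm_GG : ∀ i j : ℤ, G i * G j + G j * G i = (-2 : ℂ) • L (i + j)
  comm_LE : ∀ (i j : ℤ) (x : 𝕘), L i * E j x - E j x * L i = (j : ℂ) • E (i + j) x
  comm_LF : ∀ (i j : ℤ) (x : 𝕘),
      L i * F j x - F j x * L i = ((j : ℂ) + (i : ℂ) / 2) • F (i + j) x
  comm_GE : ∀ (i j : ℤ) (x : 𝕘), G i * E j x - E j x * G i = (j : ℂ) • F (i + j) x
  comm_GF : ∀ (i j : ℤ) (x : 𝕘), G i * F j x + F j x * G i = - E (i + j) x
  comm_EE : ∀ (i j : ℤ) (x y : 𝕘), E i x * E j y - E j y * E i x = E (i + j) ⁅x, y⁆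
  comm_FE : ∀ (i j : ℤ) (x y : 𝕘), F i x * E j y - E j y * F i x = F (i + j) ⁅x, y⁆
  comm_FF : ∀ (i j : ℤ) (x y : 𝕘), F i x * F j y + F j y * F i x = 0

/-- An endomorphism has parity `p` with respect to a `ℤ/2`-grading. -/
def MapsGr {M : Type} [AddCommGroup M] [Module ℂ M]
    (gr : Fin 2 → Submodule ℂ M) (p : Fin 2) (f : End ℂ M) : Prop :=
  ∀ q, (gr q).map f ≤ gr (q + p)

/-- The grading `gr` makes `M` into a super vector space on which the operator
families act with the correct parities. -/
structure IsGSuper {M : Type} [AddCommGroup M] [Module ℂ M]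
    (gr : Fin 2 → Submodule ℂ M)
    (L G : ℤ → End ℂ M) (E F : ℤ → 𝕘 →ₗ[ℂ] End ℂ M) : Prop where
  internal : DirectSum.IsInternal gr
  hL : ∀ i, MapsGr gr 0 (L i)
  hG : ∀ i, MapsGr gr 1 (G i)
  hE : ∀ (i : ℤ) (x : 𝕘), MapsGr gr 0 (E i x)
  hF : ∀ (i : ℤ) (x : 𝕘), MapsGr gr 1 (F i x)

/-- `M` is a weight module: `L₀` acts diagonalizably. -/
def IsWeightMod {M : Type} [AddCommGroup M] [Module ℂ M] (L0 : End ℂ M) : Prop :=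
  ⨆ μ : ℂ, L0.eigenspace μ = ⊤

/-- `M` is cuspidal (uniformly bounded): a weight module whose weight space
dimensions admit a uniform finite bound. -/
def IsCuspidalMod {M : Type} [AddCommGroup M] [Module ℂ M] (L0 : End ℂ M) : Prop :=
  IsWeightMod L0 ∧ ∃ N : ℕ, ∀ μ : ℂ, Module.rank ℂ (L0.eigenspace μ) ≤ N

/-- The set of all operators in the image of a representation of `g`. -/
def gOps {M : Type} [AddCommGroup M] [Module ℂ M]
    (L G : ℤ → End ℂ M) (E F : ℤ → 𝕘 →ₗ[ℂ] End ℂ M) : Set (End ℂ M) :=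
  Set.range L ∪ Set.range G
    ∪ {f | ∃ (i : ℤ) (x : 𝕘), f = E i x} ∪ {f | ∃ (i : ℤ) (x : 𝕘), f = F i x}

/-- A subspace is invariant under a set of operators. -/
def InvariantUnder {M : Type} [AddCommGroup M] [Module ℂ M]
    (S : Set (End ℂ M)) (N : Submodule ℂ M) : Prop :=
  ∀ f ∈ S, N.map f ≤ N

/-- A subspace is graded (homogeneous) with respect to the grading `gr`. -/
def GradedSub {M : Type} [AddCommGroup M] [Module ℂ M]
    (gr : Fin 2 → Submodule ℂ M) (N : Submodule ℂ M) : Prop :=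
  N ≤ (N ⊓ gr 0) ⊔ (N ⊓ gr 1)

/-- Simplicity: `M ≠ 0` and the only graded subspaces invariant under all the
operators are `0` and `M`. -/
def IsSimpleRep {M : Type} [AddCommGroup M] [Module ℂ M]
    (S : Set (End ℂ M)) (gr : Fin 2 → Submodule ℂ M) : Prop :=
  (∃ v : M, v ≠ 0) ∧
    ∀ N : Submodule ℂ M, InvariantUnder S N → GradedSub gr N → N = ⊥ ∨ N = ⊤

/-! ### Tensor modules `Γ(λ, V, b)`

The underlying space of `Γ(λ, V, b) = A ⊗ V` is realised as finitely supported
functions on `ℤ × Fin 2`, the pair `(m, r)` corresponding to `tᵐ ξ^r ⊗ v`. -/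

/-- Underlying space of `A ⊗ V`. -/
abbrev TMod (V : Type) [AddCommGroup V] [Module ℂ V] : Type := (ℤ × Fin 2) →₀ V

variable {𝕘' : Type} [LieRing 𝕘'] [LieAlgebra ℂ 𝕘']

/-- Action of `L i` on `Γ(λ, V, b)`:
`L_i ∘ (tᵐξ^r ⊗ v) = (λ + m + i b + (i/2) δ_{r,1}) t^{i+m} ξ^r ⊗ v`. -/
def tmL (V : Type) [AddCommGroup V] [Module ℂ V] (lam b : ℂ) (i : ℤ) :
    End ℂ (TMod V) :=
  Finsupp.lsum ℂ fun p =>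
    (lam + (p.1 : ℂ) + (i : ℂ) * b + (if p.2 = 1 then (i : ℂ) / 2 else 0)) •
      Finsupp.lsingle (p.1 + i, p.2)

/-- Action of `G i` on `Γ(λ, V, b)`:
`G_i ∘ (tᵐ ⊗ v) = (λ + m + 2 i b) t^{i+m}ξ ⊗ v`, `G_i ∘ (tᵐξ ⊗ v) = −t^{i+m} ⊗ v`. -/
def tmG (V : Type) [AddCommGroup V] [Module ℂ V] (lam b : ℂ) (i : ℤ) :
    End ℂ (TMod V) :=
  Finsupp.lsum ℂ fun p =>
    if p.2 = 0 then
      (lam + (p.1 : ℂ) + 2 * (i : ℂ) * b) • Finsupp.lsingle (p.1 + i, (1 : Fin 2))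
    else - Finsupp.lsingle (p.1 + i, (0 : Fin 2))

/-- Action of `x ⊗ tⁱ` on `Γ(λ, V, b)`: `(x ⊗ tⁱ) ∘ (f ⊗ v) = tⁱ f ⊗ (x · v)`. -/
def tmE (V : Type) [AddCommGroup V] [Module ℂ V]
    [LieRingModule 𝕘' V] [LieModule ℂ 𝕘' V] (i : ℤ) (x : 𝕘') :
    End ℂ (TMod V) :=
  Finsupp.lsum ℂ fun p =>
    Finsupp.lsingle (p.1 + i, p.2) ∘ₗ (LieModule.toEnd ℂ 𝕘' V x)

/-- Action of `x ⊗ tⁱξ` on `Γ(λ, V, b)`: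
`(x ⊗ tⁱξ) ∘ (f ⊗ v) = tⁱ ξ f ⊗ (x · v)`. -/
def tmF (V : Type) [AddCommGroup V] [Module ℂ V]
    [LieRingModule 𝕘' V] [LieModule ℂ 𝕘' V] (i : ℤ) (x : 𝕘') :
    End ℂ (TMod V) :=
  Finsupp.lsum ℂ fun p =>
    if p.2 = 0 then Finsupp.lsingle (p.1 + i, (1 : Fin 2)) ∘ₗ (LieModule.toEnd ℂ 𝕘' V x)
    else 0

/-- The super grading on `Γ(λ, V, b)`, with `V` purely even: the parity of
`tᵐξ^r ⊗ v` is `r`. -/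
def tmGr (V : Type) [AddCommGroup V] [Module ℂ V] (q : Fin 2) :
    Submodule ℂ (TMod V) :=
  Finsupp.supported V ℂ {p : ℤ × Fin 2 | p.2 = q}

/-- A simple module over the Lie algebra `ġ`. -/
def IsSimpleGMod (𝕘 : Type) [LieRing 𝕘] [LieAlgebra ℂ 𝕘]
    (V : Type) [AddCommGroup V] [Module ℂ V] [LieRingModule 𝕘 V] : Prop :=
  (∃ v : V, v ≠ 0) ∧
    ∀ N : Submodule ℂ V, (∀ (x : 𝕘), ∀ v ∈ N, ⁅x, v⁆ ∈ N) → N = ⊥ ∨ N = ⊤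

/-- Bundled data of a finite-dimensional simple `ġ`-module. -/
structure SimpleFDModuleData (𝕘 : Type) [LieRing 𝕘] [LieAlgebra ℂ 𝕘] where
  V : Type
  [grp : AddCommGroup V]
  [mod : Module ℂ V]
  [lrm : LieRingModule 𝕘 V]
  [lm : LieModule ℂ 𝕘 V]
  findim : FiniteDimensional ℂ V
  simple : IsSimpleGMod 𝕘 V

attribute [instance] SimpleFDModuleData.grp SimpleFDModuleData.mod
  SimpleFDModuleData.lrm SimpleFDModuleData.lm

section Seq
open Polynomial
variable {M : Type} [AddCommGroup M] [Module ℂ M]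

/-- The forward shift on bi-infinite sequences. -/
def shiftEnd : End ℂ (ℤ → M) := LinearMap.funLeft ℂ M (fun j => j + 1)

/-- Multiplication of a bi-infinite sequence by its index. -/
def indexEnd : End ℂ (ℤ → M) where
  toFun θ := fun j => (j : ℂ) • θ j
  map_add' _ _ := by funext j; simp only [Pi.add_apply, smul_add]
  map_smul' c θ := by
    funext j
    simp only [Pi.smul_apply, RingHom.id_apply]
    rw [smul_comm]

/-- The Euler operator `X d/dX` on polynomials. -/
def euler (p : ℂ[X]) : ℂ[X] := X * derivative p

lemma euler_mul (p q : ℂ[X]) : euler (p * q) = euler p * q + p * euler q := by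
  simp only [euler, derivative_mul]; ring

lemma euler_add (p q : ℂ[X]) : euler (p + q) = euler p + euler q := by
  simp only [euler, derivative_add]; ring

lemma euler_sub (p q : ℂ[X]) : euler (p - q) = euler p - euler q := by
  simp only [euler, derivative_sub]; ring

lemma shiftEnd_pow_apply (e : ℕ) (θ : ℤ → M) (j : ℤ) : (shiftEnd ^ e) θ j = θ (j + e) := by
  induction e generalizing j with
  | zero => simp
  | succ e ih =>
    rw [pow_succ', Module.End.mul_apply]
    change (shiftEnd ^ e) θ (j + 1) = _
    rw [ih]; congr 1; push_cast; ring

lemma shiftEnd_injective : Function.Injective (shiftEnd : End ℂ (ℤ → M)) := by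
  intro a b h
  ext j
  have := congrFun h (j - 1)
  simpa [shiftEnd, LinearMap.funLeft] using this

lemma aeval_shift_mul_index (p : ℂ[X]) :
    aeval (shiftEnd : End ℂ (ℤ → M)) p * indexEnd
      = indexEnd * aeval shiftEnd p + aeval shiftEnd (euler p) := by
  induction p using Polynomial.induction_on' with
  | add p q hp hq =>
    simp only [map_add, euler_add, add_mul, mul_add, hp, hq]; abel
  | monomial e a =>
    ext θ j
    have h2 : euler (monomial e a) = monomial e (a * e) := by
      rw [euler, derivative_monomial]
      rcases e with _ | e
      · simp
      · rw [X_mul_monomial]; simp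
    simp only [h2, aeval_monomial, Module.End.mul_apply, LinearMap.add_apply, Pi.add_apply,
      Module.algebraMap_end_apply, Pi.smul_apply, shiftEnd_pow_apply, indexEnd, LinearMap.coe_mk,
      AddHom.coe_mk]
    push_cast
    module

lemma aeval_shift_index_apply (p : ℂ[X]) (θ : ℤ → M) :
    aeval shiftEnd p (indexEnd θ)
      = indexEnd (aeval shiftEnd p θ) + aeval shiftEnd (euler p) θ := by
  have := LinearMap.congr_fun (aeval_shift_mul_index (M := M) p) θ
  simpa using this

/-- The sequence `(J² f₂(S) + J f₁(S) + f₀(S)) θ`, where `S` is the shift and `J` the index. -/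
def normalForm (θ : ℤ → M) (f₂ f₁ f₀ : ℂ[X]) : ℤ → M :=
  indexEnd (indexEnd (aeval shiftEnd f₂ θ)) + indexEnd (aeval shiftEnd f₁ θ)
    + aeval shiftEnd f₀ θ

lemma aeval_normalForm (θ : ℤ → M) (g f₂ f₁ f₀ : ℂ[X]) :
    aeval shiftEnd g (normalForm θ f₂ f₁ f₀)
      = normalForm θ (g * f₂) (g * f₁ + 2 * euler g * f₂)
        (g * f₀ + euler g * f₁ + euler (euler g) * f₂) := by
  have h2 : (2 : ℂ[X]) = 1 + 1 := by norm_num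
  simp only [normalForm, map_add, aeval_shift_index_apply, map_mul, Module.End.mul_apply,
    LinearMap.add_apply, h2, map_one, Module.End.one_apply, add_mul]
  abel

lemma normalForm_sub (θ : ℤ → M) (f₂ f₁ f₀ g₂ g₁ g₀ : ℂ[X]) :
    normalForm θ f₂ f₁ f₀ - normalForm θ g₂ g₁ g₀
      = normalForm θ (f₂ - g₂) (f₁ - g₁) (f₀ - g₀) := by
  simp only [normalForm, map_sub, LinearMap.sub_apply]; abel

lemma aeval_mul_eq_zero {θ : ℤ → M} {g : ℂ[X]} (hg : aeval shiftEnd g θ = 0) (f : ℂ[X]) :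
    aeval shiftEnd (f * g) θ = 0 := by
  simp [map_mul, hg]

lemma aeval_eq_zero_of_dvd {θ : ℤ → M} {g f : ℂ[X]} (hg : aeval shiftEnd g θ = 0)
    (h : g ∣ f) : aeval shiftEnd f θ = 0 := by
  obtain ⟨c, rfl⟩ := h
  rw [mul_comm]; exact aeval_mul_eq_zero hg c

/-- The recurrence operator `J(J+c)` twisted by weights `h`, `b`, after shifting by `p`. -/
def twistedForm (θ : ℤ → M) (h b u v : ℂ) (s : ℂ[X]) : ℤ → M :=
  normalForm θ s (C (u + v) * s + C (h + b) * euler s)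
    (C (u * v) * s + C (u * b + h * v) * euler s + C (h * b) * euler (euler s))

/-- The Wronskian with respect to the Euler operator. -/
def wr (s t : ℂ[X]) : ℂ[X] := s * euler t - t * euler s

lemma euler_wr (s t : ℂ[X]) : euler (wr s t) = s * euler (euler t) - t * euler (euler s) := by
  simp only [wr, euler_sub, euler_mul]; ring

lemma twistedForm_wr {θ : ℤ → M} {h b u v : ℂ} {s t : ℂ[X]}
    (hs : twistedForm θ h b u v s = 0) (ht : twistedForm θ h b u v t = 0) :
    normalForm θ 0 (C (2 - h - b) * wr s t)
      (C (u * (1 - b) + v * (1 - h)) * wr s t + C (1 - h * b) * euler (wr s t)) = 0 := by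
  have h1 := congrArg (aeval shiftEnd t) hs
  have h2 := congrArg (aeval shiftEnd s) ht
  rw [map_zero, twistedForm, aeval_normalForm] at h1 h2
  have h3 := normalForm_sub θ _ _ _ _ _ _ ▸ (congrArg₂ (· - ·) h1 h2)
  rw [sub_zero] at h3
  rw [euler_wr]
  rw [← h3]
  simp only [wr, map_sub, map_add, map_mul, map_one, C_ofNat]
  congr 1 <;> ring

lemma aeval_wr_wr {θ : ℤ → M} {α β γ : ℂ} {w z : ℂ[X]}
    (hw : normalForm θ 0 (C α * w) (C β * w + C γ * euler w) = 0)
    (hz : normalForm θ 0 (C α * z) (C β * z + C γ * euler z) = 0) :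
    (α - γ) • aeval shiftEnd (wr w z) θ = 0 := by
  have h1 := congrArg (aeval shiftEnd z) hw
  have h2 := congrArg (aeval shiftEnd w) hz
  rw [map_zero, aeval_normalForm] at h1 h2
  have h3 := normalForm_sub θ _ _ _ _ _ _ ▸ (congrArg₂ (· - ·) h1 h2)
  rw [sub_zero] at h3
  have h4 : normalForm θ 0 0 (C (α - γ) * wr w z) = 0 := by
    rw [← h3]
    simp only [wr, map_sub]
    congr 1 <;> ring
  have h5 : aeval shiftEnd (C (α - γ) * wr w z) θ = 0 := by
    simpa only [normalForm, map_zero, LinearMap.zero_apply, zero_add] using h4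
  rw [← h5, map_mul, aeval_C, Module.End.mul_apply, Module.algebraMap_end_apply]


lemma coeff_euler (p : ℂ[X]) (n : ℕ) : (euler p).coeff n = n * p.coeff n := by
  rcases n with _ | n
  · simp [euler]
  · rw [euler, coeff_X_mul, coeff_derivative]; push_cast; ring

lemma natDegree_euler_le (p : ℂ[X]) : (euler p).natDegree ≤ p.natDegree := by
  rw [natDegree_le_iff_coeff_eq_zero]
  intro n hn
  rw [coeff_euler, coeff_eq_zero_of_natDegree_lt hn, mul_zero]

lemma natDegree_wr {s t : ℂ[X]} (hs : s ≠ 0) (ht : t ≠ 0) (h : s.natDegree < t.natDegree) :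
    (wr s t).natDegree = s.natDegree + t.natDegree ∧ wr s t ≠ 0 := by
  have hc : (wr s t).coeff (s.natDegree + t.natDegree) ≠ 0 := by
    have h1 : (s * euler t).coeff (s.natDegree + t.natDegree)
        = s.leadingCoeff * (t.natDegree * t.leadingCoeff) := by
      rw [coeff_mul_add_eq_of_natDegree_le le_rfl (natDegree_euler_le t), coeff_euler]; rfl
    have h2 : (t * euler s).coeff (s.natDegree + t.natDegree)
        = t.leadingCoeff * (s.natDegree * s.leadingCoeff) := by
      rw [add_comm s.natDegree, coeff_mul_add_eq_of_natDegree_le le_rfl (natDegree_euler_le s),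
        coeff_euler]; rfl
    rw [wr, coeff_sub, h1, h2]
    have h3 : ((t.natDegree : ℂ) - s.natDegree) ≠ 0 := by
      rw [sub_ne_zero]; exact_mod_cast h.ne'
    have : s.leadingCoeff * (t.natDegree * t.leadingCoeff)
        - t.leadingCoeff * (s.natDegree * s.leadingCoeff)
        = s.leadingCoeff * t.leadingCoeff * ((t.natDegree : ℂ) - s.natDegree) := by ring
    rw [this]
    exact mul_ne_zero (mul_ne_zero (leadingCoeff_ne_zero.2 hs) (leadingCoeff_ne_zero.2 ht)) h3
  refine ⟨le_antisymm ?_ (le_natDegree_of_ne_zero hc), fun h0 => hc (by rw [h0]; simp)⟩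
  refine (natDegree_sub_le _ _).trans (max_le ?_ ?_)
  · exact natDegree_mul_le.trans (add_le_add le_rfl (natDegree_euler_le t))
  · rw [add_comm]
    exact natDegree_mul_le.trans (add_le_add le_rfl (natDegree_euler_le s))

lemma normalForm_monomial (θ : ℤ → M) (e : ℕ) (a₂ a₁ a₀ : ℂ) (j : ℤ) :
    normalForm θ (monomial e a₂) (monomial e a₁) (monomial e a₀) j
      = ((j : ℂ) ^ 2 * a₂ + j * a₁ + a₀) • θ (j + e) := by
  simp only [normalForm, aeval_monomial, Module.End.mul_apply, Pi.add_apply,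
    Module.algebraMap_end_apply, Pi.smul_apply, shiftEnd_pow_apply, indexEnd, LinearMap.coe_mk,
    AddHom.coe_mk]
  module

lemma euler_monomial (e : ℕ) (a : ℂ) : euler (monomial e a) = monomial e (e * a) := by
  ext n
  rw [coeff_euler, coeff_monomial, coeff_monomial]
  split_ifs with h <;> simp [h]

lemma twistedForm_monomial (θ : ℤ → M) (h b u v : ℂ) (e : ℕ) (a : ℂ) (j : ℤ) :
    twistedForm θ h b u v (monomial e a) j
      = (a * ((j + u + e * h) * (j + v + e * b))) • θ (j + e) := by
  rw [twistedForm]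
  simp only [euler_monomial, C_mul_monomial, ← map_add, normalForm_monomial]
  congr 1; ring

lemma normalForm_add (θ : ℤ → M) (f₂ f₁ f₀ g₂ g₁ g₀ : ℂ[X]) :
    normalForm θ (f₂ + g₂) (f₁ + g₁) (f₀ + g₀)
      = normalForm θ f₂ f₁ f₀ + normalForm θ g₂ g₁ g₀ := by
  simp only [normalForm, map_add, LinearMap.add_apply]; abel

lemma twistedForm_add (θ : ℤ → M) (h b u v : ℂ) (s t : ℂ[X]) :
    twistedForm θ h b u v (s + t) = twistedForm θ h b u v s + twistedForm θ h b u v t := by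
  rw [twistedForm, twistedForm, twistedForm, ← normalForm_add]
  simp only [euler_add, mul_add]
  congr 1 <;> ring

lemma twistedForm_sum {ι : Type*} (θ : ℤ → M) (h b u v : ℂ) (I : Finset ι) (s : ι → ℂ[X]) :
    twistedForm θ h b u v (∑ i ∈ I, s i) = ∑ i ∈ I, twistedForm θ h b u v (s i) := by
  classical
  induction I using Finset.induction_on with
  | empty => simp [twistedForm, euler, normalForm]
  | insert i I hi ih => rw [Finset.sum_insert hi, Finset.sum_insert hi, twistedForm_add, ih]

/-- The shift commutes with applying a linear map to the values. -/
lemma aeval_shift_compLeft {M' : Type} [AddCommGroup M'] [Module ℂ M']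
    (A : M →ₗ[ℂ] M') (g : ℂ[X]) (θ : ℤ → M) :
    aeval shiftEnd g (fun j => A (θ j)) = fun j => A (aeval shiftEnd g θ j) := by
  induction g using Polynomial.induction_on' with
  | add p q hp hq =>
    funext j
    simp only [map_add, LinearMap.add_apply, hp, hq, Pi.add_apply]
  | monomial e a =>
    funext j
    simp only [aeval_monomial, Module.End.mul_apply, Module.algebraMap_end_apply, Pi.smul_apply,
      shiftEnd_pow_apply, map_smul]

lemma aeval_shift_translate (g : ℂ[X]) (θ : ℤ → M) (t : ℤ) :
    aeval shiftEnd g (fun j => θ (j + t)) = fun j => aeval shiftEnd g θ (j + t) := by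
  induction g using Polynomial.induction_on' with
  | add p q hp hq =>
    funext j
    simp only [map_add, LinearMap.add_apply, hp, hq, Pi.add_apply]
  | monomial e a =>
    funext j
    simp only [aeval_monomial, Module.End.mul_apply, Module.algebraMap_end_apply, Pi.smul_apply,
      shiftEnd_pow_apply]
    congr 2; ring

/-- A quadratic recurrence with leading symbol `(X - 1)²` allows to differentiate annihilators. -/
lemma aeval_euler_euler {θ : ℤ → M} {A : End ℂ M} {f₁ f₀ : ℂ[X]}
    (hA : ∀ j, A (θ (j + 1)) = normalForm θ (-(X - 1) ^ 2) f₁ f₀ j) {g : ℂ[X]}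
    (hg : aeval shiftEnd g θ = 0) (hg' : aeval shiftEnd (euler g) θ = 0) :
    aeval shiftEnd (euler (euler g) * (X - 1) ^ 2) θ = 0 := by
  have h1 : aeval shiftEnd g (fun j => A (θ (j + 1))) = 0 := by
    rw [aeval_shift_translate g (fun j => A (θ j)) 1, aeval_shift_compLeft]
    funext j; simp [hg]
  rw [funext hA, aeval_normalForm] at h1
  have e1 : aeval shiftEnd (g * -(X - 1) ^ 2) θ = 0 := aeval_eq_zero_of_dvd hg (dvd_mul_right _ _)
  have e2 : aeval shiftEnd (g * f₁ + 2 * euler g * -(X - 1) ^ 2) θ = 0 := by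
    rw [map_add, LinearMap.add_apply, aeval_eq_zero_of_dvd hg (dvd_mul_right _ _), zero_add]
    exact aeval_eq_zero_of_dvd hg' ⟨2 * -(X - 1) ^ 2, by ring⟩
  have e3 : aeval shiftEnd (g * f₀ + euler g * f₁) θ = 0 := by
    rw [map_add, LinearMap.add_apply, aeval_eq_zero_of_dvd hg (dvd_mul_right _ _), zero_add,
      aeval_eq_zero_of_dvd hg' (dvd_mul_right _ _)]
  have : aeval shiftEnd (euler (euler g) * (X - 1) ^ 2) θ
      = - aeval shiftEnd (euler (euler g) * -(X - 1) ^ 2) θ := by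
    rw [← LinearMap.neg_apply, ← map_neg]; congr 2; ring
  rw [normalForm, e1, e2, map_add, LinearMap.add_apply, e3] at h1
  simp only [map_zero, zero_add] at h1
  rw [this, h1, neg_zero]

/-- Lower the multiplicity of one factor of an annihilating polynomial. -/
lemma aeval_lower {θ : ℤ → M} {A : End ℂ M} {f₁ f₀ : ℂ[X]}
    (hA : ∀ j, A (θ (j + 1)) = normalForm θ (-(X - 1) ^ 2) f₁ f₀ j) {q : ℂ} {m : ℕ} {g : ℂ[X]}
    (hg : aeval shiftEnd ((X - C q) ^ (m + 1) * g) θ = 0) :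
    aeval shiftEnd ((X - C q) ^ m * ((X - 1) ^ 2 * g ^ 3)) θ = 0 := by
  have eP (k : ℕ) : euler ((X - C q) ^ (k + 1)) = ((k : ℂ[X]) + 1) * (X - C q) ^ k * X := by
    simp [euler, derivative_pow]; ring
  have e3 : euler (g ^ 3) = 3 * g ^ 2 * euler g := by
    rw [euler, derivative_pow, euler]; simp [C_ofNat]; ring
  have e1 : euler ((X - C q) ^ (m + 2) * g ^ 3) = (X - C q) ^ (m + 1) * g *
      (g * (((m : ℂ[X]) + 2) * X * g + 3 * (X - C q) * euler g)) := by
    rw [euler_mul, eP, e3]; push_cast; ring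
  have h0 := aeval_eq_zero_of_dvd hg (f := (X - C q) ^ (m + 2) * g ^ 3)
    ⟨(X - C q) * g ^ 2, by ring⟩
  have h1 : aeval shiftEnd (euler ((X - C q) ^ (m + 2) * g ^ 3)) θ = 0 :=
    aeval_eq_zero_of_dvd hg (e1 ▸ dvd_mul_right _ _)
  have h2 := aeval_euler_euler hA h0 h1
  rw [e1, euler_mul, euler_mul, eP] at h2
  set r := g * (((m : ℂ[X]) + 2) * X * g + 3 * (X - C q) * euler g) with hr
  have h3 : aeval shiftEnd (((m + 2) * (m + 1) : ℂ[X]) * X ^ 2 *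
      ((X - C q) ^ m * ((X - 1) ^ 2 * g ^ 3))) θ = 0 := by
    have h4 := aeval_eq_zero_of_dvd hg (dvd_mul_right _
      ((X - 1) ^ 2 * (3 * ((m : ℂ[X]) + 1) * X * g * euler g
        + euler g * (((m : ℂ[X]) + 2) * X * g + 3 * (X - C q) * euler g) + euler r)))
    have h7 := congrArg₂ (· - ·) h2 h4
    simp only [sub_zero, ← LinearMap.sub_apply, ← map_sub] at h7
    rw [← h7]
    congr 2
    rw [hr]; ring
  have h5 : ((m + 2) * (m + 1) : ℂ[X]) = C ((m + 2) * (m + 1) : ℂ) := by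
    simp [C_ofNat]
  rw [h5, mul_assoc, map_mul, aeval_C, Module.End.mul_apply, Module.algebraMap_end_apply,
    smul_eq_zero, map_mul, map_pow, aeval_X, Module.End.mul_apply, pow_two,
    Module.End.mul_apply] at h3
  have hm : ((m + 2) * (m + 1) : ℂ) ≠ 0 := by
    exact_mod_cast (by positivity : (m + 2) * (m + 1) ≠ 0)
  have h6 := h3.resolve_left hm
  exact (map_eq_zero_iff _ shiftEnd_injective).1 ((map_eq_zero_iff _ shiftEnd_injective).1 h6)

lemma exists_aeval_X_sub_one_pow_of_prod {θ : ℤ → M} {A : End ℂ M} {f₁ f₀ : ℂ[X]}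
    (hA : ∀ j, A (θ (j + 1)) = normalForm θ (-(X - 1) ^ 2) f₁ f₀ j) (S : Finset ℂ) (a K : ℕ)
    (h : aeval shiftEnd ((X - 1 : ℂ[X]) ^ a * ∏ q ∈ S, (X - C q) ^ K) θ = 0) :
    ∃ m, aeval shiftEnd ((X - 1 : ℂ[X]) ^ m) θ = 0 := by
  induction S using Finset.induction_on generalizing a K with
  | empty => exact ⟨a, by simpa using h⟩
  | insert q S hq ih =>
    have key (m : ℕ) : ∀ a K, aeval shiftEnd ((X - C q) ^ m *
        ((X - 1) ^ a * ∏ q ∈ S, (X - C q) ^ K)) θ = 0 →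
        ∃ m, aeval shiftEnd ((X - 1 : ℂ[X]) ^ m) θ = 0 := by
      induction m with
      | zero => intro a K h; exact ih a K (by simpa using h)
      | succ m ihm =>
        intro a K h
        refine ihm (3 * a + 2) (3 * K) ?_
        have h1 := aeval_lower hA h
        have : ∏ q ∈ S, (X - C q) ^ (3 * K) = (∏ q ∈ S, (X - C q) ^ K) ^ 3 := by
          rw [← Finset.prod_pow]; congr 1; ext1 q; ring
        have h2 : (X - C q) ^ m * ((X - 1 : ℂ[X]) ^ (3 * a + 2) * ∏ q ∈ S, (X - C q) ^ (3 * K))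
            = (X - C q) ^ m *
              ((X - 1) ^ 2 * ((X - 1 : ℂ[X]) ^ a * ∏ q ∈ S, (X - C q) ^ K) ^ 3) := by
          rw [this]; ring
        rw [h2]; exact h1
    refine key K a K ?_
    rw [Finset.prod_insert hq, mul_left_comm] at h
    exact h

lemma exists_aeval_X_sub_one_pow {θ : ℤ → M} {A : End ℂ M} {f₁ f₀ : ℂ[X]}
    (hA : ∀ j, A (θ (j + 1)) = normalForm θ (-(X - 1) ^ 2) f₁ f₀ j) {W : ℂ[X]} (hW : W ≠ 0)
    (h : aeval shiftEnd W θ = 0) : ∃ m, aeval shiftEnd ((X - 1 : ℂ[X]) ^ m) θ = 0 := by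
  refine exists_aeval_X_sub_one_pow_of_prod hA W.roots.toFinset 0 W.roots.card
    (aeval_eq_zero_of_dvd h ?_)
  have h1 : W = C W.leadingCoeff * (W.roots.map fun q => X - C q).prod :=
    (IsAlgClosed.splits W).eq_prod_roots
  rw [pow_zero, one_mul]
  have h2 : W ∣ (W.roots.map fun q => X - C q).prod := by
    refine ⟨C W.leadingCoeff⁻¹, ?_⟩
    nth_rw 2 [h1]
    rw [mul_comm, ← mul_assoc, ← C_mul, inv_mul_cancel₀ (leadingCoeff_ne_zero.2 hW), C_1, one_mul]
  refine h2.trans ?_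
  rw [Finset.prod_multiset_map_count]
  exact Finset.prod_dvd_prod_of_dvd _ _ fun q _ => pow_dvd_pow _ (Multiset.count_le_card _ _)

end Seq

section Tame
open Polynomial
variable {M : Type} [AddCommGroup M] [Module ℂ M]

/-- The operators `P j` transform under `L` like a field of conformal type `h`. -/
def IsPrimary (L P : ℤ → End ℂ M) (h : ℂ) : Prop :=
  ∀ i j : ℤ, L i * P j - P j * L i = ((j : ℂ) + i * h) • P (i + j)

/-- The vectors `φ k` span a quotient of a density module with parameters `lam` and `b`. -/
def IsDensity (L : ℤ → End ℂ M) (lam b : ℂ) (φ : ℤ → M) : Prop :=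
  ∀ i k : ℤ, L i (φ k) = (lam + k + i * b) • φ (k + i)

/-- The sequence of the products of total degree `n` of a field and a density family. -/
def cross (P : ℤ → End ℂ M) (φ : ℤ → M) (n j : ℤ) : M := P j (φ (n - j))

/-- All products of a field and a density family are polynomial in the index of the field. -/
def Tame (P : ℤ → End ℂ M) (φ : ℤ → M) : Prop :=
  ∀ n, ∃ m, aeval shiftEnd ((X - 1 : ℂ[X]) ^ m) (cross P φ n) = 0

lemma apply_cross {L P : ℤ → End ℂ M} {h lam b : ℂ} {φ : ℤ → M} (hP : IsPrimary L P h)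
    (hφ : IsDensity L lam b φ) (i n j : ℤ) :
    L i (cross P φ n j) = (lam + n - j + i * b) • cross P φ (n + i) j
      + ((j : ℂ) + i * h) • cross P φ (n + i) (j + i) := by
  have h1 := LinearMap.congr_fun (hP i j) (φ (n - j))
  simp only [LinearMap.sub_apply, Module.End.mul_apply, LinearMap.smul_apply] at h1
  rw [sub_eq_iff_eq_add, hφ i (n - j), map_smul] at h1
  simp only [cross]
  rw [h1, add_comm, add_comm i j]
  have e1 : n - j + i = n + i - j := by ring
  have e2 : n - j = n + i - (j + i) := by ring
  rw [e1, ← e2]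
  push_cast
  congr 2; ring

lemma apply_apply_cross {L P : ℤ → End ℂ M} {h lam b : ℂ} {φ : ℤ → M} (hP : IsPrimary L P h)
    (hφ : IsDensity L lam b φ) (i n j : ℤ) :
    L (-i) (L i (cross P φ n j))
      = ((lam + n - j + i * b) * (j - i * h)) • cross P φ n (j - i)
        + ((j + i * h) * (lam + n - j - i * b)) • cross P φ n (j + i)
        + ((lam + n - j) ^ 2 + j ^ 2 + i * (lam + n) + i ^ 2 * (b * (1 - b) + h * (1 - h))) •
          cross P φ n j := by
  rw [apply_cross hP hφ, map_add, map_smul, map_smul, apply_cross hP hφ, apply_cross hP hφ]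
  have e1 : n + i + -i = n := by ring
  have e2 : j + i + -i = j := by ring
  rw [e1, e2, ← sub_eq_add_neg]
  push_cast
  module

lemma IsDensity.mem_eigenspace {L : ℤ → End ℂ M} {lam b : ℂ} {φ : ℤ → M}
    (hφ : IsDensity L lam b φ) (k : ℤ) : φ k ∈ (L 0).eigenspace (lam + k) := by
  rw [Module.End.mem_eigenspace_iff, hφ]; simp

lemma IsPrimary.map_eigenspace {L P : ℤ → End ℂ M} {h : ℂ} (hP : IsPrimary L P h) (i : ℤ) {μ : ℂ}
    {w : M} (hw : w ∈ (L 0).eigenspace μ) : P i w ∈ (L 0).eigenspace (μ + i) := by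
  rw [Module.End.mem_eigenspace_iff] at hw ⊢
  have h1 := LinearMap.congr_fun (hP 0 i) w
  simp only [LinearMap.sub_apply, Module.End.mul_apply, LinearMap.smul_apply, hw, map_smul] at h1
  rw [sub_eq_iff_eq_add] at h1
  rw [h1, zero_add]; push_cast; module

lemma cross_mem_eigenspace {L P : ℤ → End ℂ M} {h lam b : ℂ} {φ : ℤ → M} (hP : IsPrimary L P h)
    (hφ : IsDensity L lam b φ) (n j : ℤ) : cross P φ n j ∈ (L 0).eigenspace (lam + n) := by
  have := hP.map_eigenspace j (hφ.mem_eigenspace (n - j))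
  rw [cross]; convert this using 2; push_cast; ring

/-- Operators on a finite-dimensional space satisfy linear relations with vanishing moments. -/
lemma exists_relation (W : Submodule ℂ M) [FiniteDimensional ℂ W] (A : ℕ → End ℂ M)
    (hA : ∀ i, ∀ w ∈ W, A i w ∈ W) (N : ℕ) :
    ∃ (K : ℕ) (α : ℕ → ℂ), (∀ i ≤ N, α i = 0) ∧ (∀ i, K < i → α i = 0) ∧ (∃ i, α i ≠ 0) ∧
      ∑ i ∈ Finset.range (K + 1), α i = 0 ∧ ∑ i ∈ Finset.range (K + 1), α i * i = 0 ∧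
      ∑ i ∈ Finset.range (K + 1), α i * i ^ 2 = 0 ∧
      ∀ w ∈ W, ∑ i ∈ Finset.range (K + 1), α i • A i w = 0 := by
  classical
  set D := Module.finrank ℂ (End ℂ W × ℂ × ℂ × ℂ) with hD
  let f : Fin (D + 1) → End ℂ W × ℂ × ℂ × ℂ := fun t =>
    ((A (N + 1 + t)).restrict (hA _), 1, ((N + 1 + t : ℕ) : ℂ), ((N + 1 + t : ℕ) : ℂ) ^ 2)
  have hf : ¬ LinearIndependent ℂ f := fun h => by
    have := h.fintype_card_le_finrank
    simp only [Fintype.card_fin] at this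
    omega
  obtain ⟨g, hg, t0, ht0⟩ := Fintype.not_linearIndependent_iff.1 hf
  let α : ℕ → ℂ := fun i => if hi : N + 1 ≤ i ∧ i - (N + 1) < D + 1
      then g ⟨i - (N + 1), hi.2⟩ else 0
  have hα (t : Fin (D + 1)) : α (N + 1 + t) = g t := by
    have : N + 1 ≤ N + 1 + (t : ℕ) ∧ N + 1 + (t : ℕ) - (N + 1) < D + 1 := by omega
    simp only [α, dif_pos this]; congr 1; ext; simp
  have hα0 (i : ℕ) (hi : i ≤ N) : α i = 0 := by
    simp only [α]; rw [dif_neg]; omega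
  have hsum {V : Type} [AddCommGroup V] [Module ℂ V] (F : ℕ → V) :
      ∑ i ∈ Finset.range (N + 1 + D + 1), α i • F i = ∑ t, g t • F (N + 1 + t) := by
    rw [add_assoc, Finset.sum_range_add, Finset.sum_eq_zero, zero_add,
      ← Fin.sum_univ_eq_sum_range (fun x => α (N + 1 + x) • F (N + 1 + x))]
    · simp only [hα]
    · intro i hi
      rw [hα0 i (by have := Finset.mem_range.1 hi; omega), zero_smul]
  refine ⟨N + 1 + D, α, hα0, fun i hi => ?_, ⟨N + 1 + t0, by rwa [hα]⟩, ?_, ?_, ?_, ?_⟩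
  · simp only [α]; rw [dif_neg]; omega
  · have := congrArg (fun z => z.2.1) hg
    simp only [f, Prod.snd_sum, Prod.fst_sum, Prod.smul_mk, Prod.snd_zero, Prod.fst_zero] at this
    have h2 := hsum (fun _ => (1 : ℂ))
    simp only [smul_eq_mul, mul_one] at h2 this
    rw [h2]; exact this
  · have := congrArg (fun z => z.2.2.1) hg
    simp only [f, Prod.snd_sum, Prod.fst_sum, Prod.smul_mk, Prod.snd_zero, Prod.fst_zero] at this
    have h2 := hsum (fun i => (i : ℂ))
    simp only [smul_eq_mul] at h2 this
    rw [h2]; exact this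
  · have := congrArg (fun z => z.2.2.2) hg
    simp only [f, Prod.snd_sum, Prod.smul_mk, Prod.snd_zero] at this
    have h2 := hsum (fun i => (i : ℂ) ^ 2)
    simp only [smul_eq_mul] at h2 this
    rw [h2]; exact this
  · intro w hw
    have := congrArg (fun z => ((z.1 ⟨w, hw⟩ : W) : M)) hg
    simp only [f, Prod.fst_sum, Prod.smul_mk, Prod.fst_zero, LinearMap.sum_apply,
      LinearMap.smul_apply, LinearMap.zero_apply, Submodule.coe_sum, Submodule.coe_smul,
      LinearMap.coe_restrict_apply, Submodule.coe_zero] at this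
    rw [hsum (fun i => A i w)]; exact this

/-- The symmetric polynomial attached to a relation. -/
def relPoly (p K : ℕ) (α : ℕ → ℂ) : ℂ[X] :=
  ∑ i ∈ Finset.range (K + 1), (monomial (p + i) (α i) + monomial (p - i) (α i))

lemma relPoly_natDegree {p K N : ℕ} {α : ℕ → ℂ} (hN : ∀ i ≤ N, α i = 0) (hK : ∀ i, K < i → α i = 0)
    (h0 : ∃ i, α i ≠ 0) :
    relPoly p K α ≠ 0 ∧ p + N < (relPoly p K α).natDegree ∧
      (relPoly p K α).natDegree ≤ p + K := by
  obtain ⟨i, hi⟩ := h0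
  have hiN : N < i := by by_contra h; exact hi (hN i (by omega))
  have hiK : i ≤ K := by by_contra h; exact hi (hK i (by omega))
  have hc : (relPoly p K α).coeff (p + i) ≠ 0 := by
    have : (relPoly p K α).coeff (p + i) = α i := by
      rw [relPoly, finsetSum_coeff, Finset.sum_eq_single i]
      · rw [coeff_add, coeff_monomial, coeff_monomial, if_pos rfl, if_neg (by omega), add_zero]
      · intro t _ hti
        rw [coeff_add, coeff_monomial, coeff_monomial, if_neg (by omega), if_neg (by omega),
          add_zero]
      · intro h; exact absurd (Finset.mem_range.2 (by omega)) h
    rwa [this]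
  refine ⟨fun h => hc (by rw [h]; simp), ?_, ?_⟩
  · have := le_natDegree_of_ne_zero hc; omega
  · refine natDegree_sum_le_of_forall_le _ _ fun t ht => ?_
    have := Finset.mem_range.1 ht
    refine (natDegree_add_le _ _).trans (max_le ?_ ?_)
    · exact (natDegree_monomial_le _).trans (by omega)
    · exact (natDegree_monomial_le _).trans (by omega)

lemma twistedForm_relPoly {L P : ℤ → End ℂ M} {h lam b : ℂ} {φ : ℤ → M} (hP : IsPrimary L P h)
    (hφ : IsDensity L lam b φ) (n : ℤ) {p K : ℕ} (hp : K ≤ p) {α : ℕ → ℂ}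
    (h0 : ∑ i ∈ Finset.range (K + 1), α i = 0) (h1 : ∑ i ∈ Finset.range (K + 1), α i * i = 0)
    (h2 : ∑ i ∈ Finset.range (K + 1), α i * i ^ 2 = 0)
    (h3 : ∀ w ∈ (L 0).eigenspace (lam + n),
      ∑ i ∈ Finset.range (K + 1), α i • (L (-(i : ℤ)) * L i) w = 0) :
    twistedForm (cross P φ n) h b (p * (1 - h)) (p * (1 - b) - (lam + n)) (relPoly p K α) = 0 := by
  funext j
  rw [relPoly, twistedForm_sum, Finset.sum_apply, Pi.zero_apply]
  have h4 := h3 _ (cross_mem_eigenspace hP hφ n (j + p))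
  have h5 : ∀ i ∈ Finset.range (K + 1), α i • (L (-(i : ℤ)) * L i) (cross P φ n (j + p))
      = -(twistedForm (cross P φ n) h b (p * (1 - h)) (p * (1 - b) - (lam + n))
          (monomial (p + i) (α i) + monomial (p - i) (α i)) j)
        + (α i * ((lam + n - (j + p)) ^ 2 + (j + p) ^ 2) + α i * i * (lam + n)
          + α i * i ^ 2 * (b * (1 - b) + h * (1 - h))) • cross P φ n (j + p) := by
    intro i hi
    have hi' : i ≤ p := by have := Finset.mem_range.1 hi; omega
    rw [Module.End.mul_apply, apply_apply_cross hP hφ, twistedForm_add, Pi.add_apply,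
      twistedForm_monomial, twistedForm_monomial]
    have e1 : j + ((p + i : ℕ) : ℤ) = j + p + i := by push_cast; ring
    have e2 : j + ((p - i : ℕ) : ℤ) = j + p - i := by push_cast [Nat.cast_sub hi']; ring
    rw [e1, e2]
    push_cast [Nat.cast_sub hi']
    module
  rw [Finset.sum_congr rfl h5, Finset.sum_add_distrib, ← Finset.sum_smul, Finset.sum_add_distrib,
    Finset.sum_add_distrib, ← Finset.sum_mul, ← Finset.sum_mul, ← Finset.sum_mul, h0, h1, h2,
    Finset.sum_neg_distrib] at h4
  simpa using h4

theorem tame_of_ne_one {L P : ℤ → End ℂ M} {h lam b : ℂ} {φ : ℤ → M}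
    (hL : IsPrimary L L (-1)) (hP : IsPrimary L P h)
    (hφ : IsDensity L lam b φ) (hfin : ∀ μ, FiniteDimensional ℂ ((L 0).eigenspace μ))
    (hh : h ≠ 1) (hb : b ≠ 1) : Tame P φ := by
  intro n
  have hA (i : ℕ) : ∀ w ∈ (L 0).eigenspace (lam + n),
      (L (-(i : ℤ)) * L i) w ∈ (L 0).eigenspace (lam + n) := by
    intro w hw
    have := hL.map_eigenspace (-(i : ℤ)) (hL.map_eigenspace i hw)
    rw [Module.End.mul_apply]
    convert this using 2; push_cast; ring
  obtain ⟨K₁, α₁, a1, a2, a3, a4, a5, a6, a7⟩ := exists_relation _ _ hA 0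
  obtain ⟨K₂, α₂, b1, b2, b3, b4, b5, b6, b7⟩ := exists_relation _ _ hA K₁
  obtain ⟨K₃, α₃, c1, c2, c3, c4, c5, c6, c7⟩ := exists_relation _ _ hA K₂
  have hK₁ : K₁ ≤ K₁ + K₂ + K₃ := by omega
  have hK₂ : K₂ ≤ K₁ + K₂ + K₃ := by omega
  have hK₃ : K₃ ≤ K₁ + K₂ + K₃ := by omega
  set p := K₁ + K₂ + K₃
  have A := twistedForm_relPoly hP hφ n hK₁ a4 a5 a6 a7
  have B := twistedForm_relPoly hP hφ n hK₂ b4 b5 b6 b7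
  have C := twistedForm_relPoly hP hφ n hK₃ c4 c5 c6 c7
  obtain ⟨dA0, dA1, dA2⟩ := relPoly_natDegree (p := p) a1 a2 a3
  obtain ⟨dB0, dB1, dB2⟩ := relPoly_natDegree (p := p) b1 b2 b3
  obtain ⟨dC0, dC1, dC2⟩ := relPoly_natDegree (p := p) c1 c2 c3
  obtain ⟨e1, e2⟩ := natDegree_wr dA0 dB0 (by omega)
  obtain ⟨f1, f2⟩ := natDegree_wr dA0 dC0 (by omega)
  obtain ⟨-, g2⟩ := natDegree_wr e2 f2 (by omega)
  have hW := aeval_wr_wr (twistedForm_wr A B) (twistedForm_wr A C)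
  have hne : (2 - h - b) - (1 - h * b) ≠ 0 := by
    have : (2 - h - b) - (1 - h * b) = (1 - h) * (1 - b) := by ring
    rw [this]; exact mul_ne_zero (sub_ne_zero.2 hh.symm) (sub_ne_zero.2 hb.symm)
  have hW' := (smul_eq_zero.1 hW).resolve_left hne
  have key : ∀ j, (L (-1) * L 1) (cross P φ n (j + 1)) = normalForm (cross P φ n) (-(X - 1) ^ 2)
      (Polynomial.C (lam + n - 2 - b - h) * X ^ 2 + Polynomial.C (4 - 2 * (lam + n)) * X
        + Polynomial.C (lam + n - 2 + b + h))
      (Polynomial.C ((1 + h) * (lam + n - 1 - b)) * X ^ 2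
        + Polynomial.C ((lam + n - 1) ^ 2 + 1 + (lam + n) + (b * (1 - b) + h * (1 - h))) * X
        + Polynomial.C ((1 - h) * (lam + n - 1 + b))) j := by
    intro j
    have h2 : (-(X - 1) ^ 2 : ℂ[X]) = monomial 2 (-1) + monomial 1 2 + monomial 0 (-1) := by
      simp only [← C_mul_X_pow_eq_monomial, map_neg, C_1, C_ofNat]; ring
    have h3 (a b c : ℂ) : Polynomial.C a * X ^ 2 + Polynomial.C b * X + Polynomial.C c
        = monomial 2 a + monomial 1 b + monomial 0 c := by
      simp only [← C_mul_X_pow_eq_monomial]; ring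
    rw [h2, h3, h3, normalForm_add, normalForm_add, Pi.add_apply, Pi.add_apply,
      normalForm_monomial, normalForm_monomial, normalForm_monomial,
      Module.End.mul_apply, apply_apply_cross hP hφ]
    have s1 : j + 1 - 1 = j + ((0 : ℕ) : ℤ) := by simp
    have s2 : j + 1 + 1 = j + ((2 : ℕ) : ℤ) := by push_cast; ring
    rw [s1, s2]
    push_cast
    module
  exact exists_aeval_X_sub_one_pow key g2 hW'

end Tame

section Nice
open Polynomial
variable {M : Type} [AddCommGroup M] [Module ℂ M]

/-- Sequences annihilated by a power of the difference operator. -/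
def IsPolySeq (θ : ℤ → M) : Prop := ∃ m, aeval shiftEnd ((X - 1 : ℂ[X]) ^ m) θ = 0

lemma IsPolySeq.add {θ η : ℤ → M} (h : IsPolySeq θ) (h' : IsPolySeq η) : IsPolySeq (θ + η) := by
  obtain ⟨m, hm⟩ := h
  obtain ⟨m', hm'⟩ := h'
  refine ⟨m + m', ?_⟩
  rw [map_add, aeval_eq_zero_of_dvd hm (pow_dvd_pow _ (Nat.le_add_right _ _)),
    aeval_eq_zero_of_dvd hm' (pow_dvd_pow _ (Nat.le_add_left _ _)), add_zero]

lemma IsPolySeq.map {M' : Type} [AddCommGroup M'] [Module ℂ M'] {θ : ℤ → M} (h : IsPolySeq θ)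
    (A : M →ₗ[ℂ] M') : IsPolySeq (fun j => A (θ j)) := by
  obtain ⟨m, hm⟩ := h
  exact ⟨m, by rw [aeval_shift_compLeft, hm]; funext j; simp⟩

lemma IsPolySeq.translate {θ : ℤ → M} (h : IsPolySeq θ) (t : ℤ) :
    IsPolySeq (fun j => θ (j + t)) := by
  obtain ⟨m, hm⟩ := h
  exact ⟨m, by rw [aeval_shift_translate, hm]; funext j; simp⟩

lemma euler_X_sub_one_pow (m : ℕ) :
    euler ((X - 1 : ℂ[X]) ^ (m + 1)) = (X - 1) ^ m * (((m : ℂ[X]) + 1) * X) := by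
  rw [euler, derivative_pow]; simp; ring

lemma IsPolySeq.index {θ : ℤ → M} (h : IsPolySeq θ) : IsPolySeq (fun j => (j : ℂ) • θ j) := by
  obtain ⟨m, hm⟩ := h
  refine ⟨m + 1, ?_⟩
  change aeval shiftEnd _ (indexEnd θ) = 0
  rw [aeval_shift_index_apply, aeval_eq_zero_of_dvd hm (pow_dvd_pow _ (Nat.le_succ _)), map_zero,
    zero_add, euler_X_sub_one_pow]
  exact aeval_eq_zero_of_dvd hm (dvd_mul_right _ _)

lemma isPolySeq_zero : IsPolySeq (fun _ => 0 : ℤ → M) := ⟨0, map_zero _⟩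

lemma IsPolySeq.smul {θ : ℤ → M} (h : IsPolySeq θ) (c : ℂ) : IsPolySeq (fun j => c • θ j) :=
  h.map (c • LinearMap.id)

lemma IsPolySeq.affine {θ : ℤ → M} (h : IsPolySeq θ) (a c : ℂ) :
    IsPolySeq (fun j => (a * j + c) • θ j) := by
  have h1 := (h.index.smul a).add (h.smul c)
  convert h1 using 1
  funext j
  simp only [Pi.add_apply]; module

lemma isPolySeq_const (v : M) : IsPolySeq (fun _ => v) := by
  refine ⟨1, ?_⟩
  rw [pow_one]
  funext j
  simp [shiftEnd, LinearMap.funLeft]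

lemma IsPolySeq.sum {ι : Type*} (I : Finset ι) {θ : ι → ℤ → M} (h : ∀ i ∈ I, IsPolySeq (θ i)) :
    IsPolySeq (fun j => ∑ i ∈ I, θ i j) := by
  classical
  induction I using Finset.induction_on with
  | empty => simpa using isPolySeq_zero
  | insert i I hi ih =>
    simp only [Finset.sum_insert hi]
    exact (h i (Finset.mem_insert_self _ _)).add
      (ih fun t ht => h t (Finset.mem_insert_of_mem ht))

lemma aeval_shift_apply (f : ℂ[X]) (θ : ℤ → M) (j : ℤ) :
    aeval shiftEnd f θ j = ∑ l ∈ Finset.range (f.natDegree + 1), f.coeff l • θ (j + l) := by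
  rw [aeval_eq_sum_range, LinearMap.sum_apply, Finset.sum_apply]
  simp only [LinearMap.smul_apply, Pi.smul_apply, shiftEnd_pow_apply]

/-- If the difference of a sequence is constant then the sequence is an arithmetic progression. -/
lemma eq_add_smul_of_step {χ : ℤ → M} {v : M} (h : ∀ j, χ (j + 1) - χ j = v) (i j : ℤ) :
    χ (j + i) - χ j = (i : ℂ) • v := by
  induction i using Int.induction_on with
  | zero => simp
  | succ i ih =>
    rw [← add_assoc]
    have := h (j + i)
    have e : χ (j + i + 1) - χ j = (χ (j + i + 1) - χ (j + i)) + (χ (j + i) - χ j) := by abel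
    rw [e, this, ih]; push_cast; module
  | pred i ih =>
    have := h (j + (-i - 1))
    have e1 : j + (-(i : ℤ) - 1) + 1 = j + -i := by ring
    rw [e1] at this
    have e : χ (j + (-i - 1)) - χ j = (χ (j + -i) - χ j)
        - (χ (j + -i) - χ (j + (-i - 1))) := by abel
    rw [e, this, ih]; push_cast; module

lemma aeval_X_sub_one_apply (θ : ℤ → M) (j : ℤ) :
    aeval shiftEnd (X - 1 : ℂ[X]) θ j = θ (j + 1) - θ j := by
  simp [shiftEnd, LinearMap.funLeft]

/-- The top coefficients of the products with a field again transform like a density. -/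
lemma apply_top {L P : ℤ → End ℂ M} {h lam b : ℂ} {φ : ℤ → M} (hP : IsPrimary L P h)
    (hφ : IsDensity L lam b φ) {e : ℕ} {i n : ℤ}
    (he : aeval shiftEnd ((X - 1 : ℂ[X]) ^ (e + 1)) (cross P φ (n + i)) = 0) (j : ℤ) :
    L i (aeval shiftEnd ((X - 1 : ℂ[X]) ^ e) (cross P φ n) j)
      = (lam + n + i * (b + h + e)) •
        aeval shiftEnd ((X - 1 : ℂ[X]) ^ e) (cross P φ (n + i)) 0 := by
  set θ := cross P φ (n + i) with hθ
  set ψ := aeval shiftEnd ((X - 1 : ℂ[X]) ^ e) θ with hψ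
  have hstep : ∀ j, ψ (j + 1) - ψ j = 0 := by
    intro j
    rw [← aeval_X_sub_one_apply, hψ, ← Module.End.mul_apply, ← map_mul, ← pow_succ', he]; rfl
  have hconst : ∀ j, ψ j = ψ 0 := by
    intro j
    have := eq_add_smul_of_step hstep j 0
    rwa [smul_zero, zero_add, sub_eq_zero] at this
  have h0 : (fun j => L i (cross P φ n j)) = (lam + n + i * b) • θ
      + (indexEnd ((fun j => θ (j + i)) - θ) + ((i : ℂ) * h) • fun j => θ (j + i)) := by
    funext j
    rw [apply_cross hP hφ]
    simp only [Pi.add_apply, Pi.smul_apply, indexEnd, LinearMap.coe_mk, AddHom.coe_mk,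
      Pi.sub_apply]
    module
  have h1 := congrFun (congrArg (aeval shiftEnd ((X - 1 : ℂ[X]) ^ e)) h0) j
  rw [aeval_shift_compLeft] at h1
  refine h1.trans ?_
  rw [map_add, map_add, map_smul, map_smul, aeval_shift_index_apply,
    map_sub (aeval shiftEnd ((X - 1 : ℂ[X]) ^ e)),
    map_sub (aeval shiftEnd (euler ((X - 1 : ℂ[X]) ^ e))), aeval_shift_translate, ← hψ]
  have h2 : aeval shiftEnd (euler ((X - 1 : ℂ[X]) ^ e)) ((fun j => θ (j + i))) j
      - aeval shiftEnd (euler ((X - 1 : ℂ[X]) ^ e)) θ j = ((i : ℂ) * e) • ψ 0 := by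
    rw [aeval_shift_translate]
    rcases e with _ | e
    · simp [euler]
    · have h3 : ∀ j, aeval shiftEnd (euler ((X - 1 : ℂ[X]) ^ (e + 1))) θ j
          = ((e : ℂ) + 1) • aeval shiftEnd ((X - 1 : ℂ[X]) ^ e) θ (j + 1) := by
        intro j
        have : euler ((X - 1 : ℂ[X]) ^ (e + 1)) = C ((e : ℂ) + 1) * (X * (X - 1) ^ e) := by
          rw [euler_X_sub_one_pow]; simp; ring
        rw [this, map_mul, aeval_C, Module.End.mul_apply, Module.algebraMap_end_apply, map_mul,
          aeval_X]
        simp [shiftEnd, LinearMap.funLeft]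
      beta_reduce
      rw [h3, h3, ← smul_sub]
      have h4 : ∀ j, aeval shiftEnd ((X - 1 : ℂ[X]) ^ e) θ (j + 1)
          - aeval shiftEnd ((X - 1 : ℂ[X]) ^ e) θ j = ψ 0 := by
        intro j
        rw [← hconst j, ← aeval_X_sub_one_apply, ← Module.End.mul_apply, ← map_mul, ← pow_succ']
      have h5 := eq_add_smul_of_step h4 i (j + 1)
      have e1 : j + i + 1 = j + 1 + i := by ring
      rw [e1, h5]; push_cast; module
  have h6 : indexEnd ((fun j => ψ (j + i)) - ψ) = 0 := by
    funext j
    simp only [indexEnd, LinearMap.coe_mk, AddHom.coe_mk, Pi.sub_apply, hconst (j + i), hconst j,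
      sub_self, smul_zero, Pi.zero_apply]
  simp only [h6, zero_add, Pi.add_apply, Pi.smul_apply, Pi.sub_apply, hconst (j + i), hconst j]
  rw [aeval_shift_translate] at h2 ⊢
  rw [h2]
  module

/-- A nonzero tame product has a top coefficient of uniform degree. -/
lemma exists_uniform_degree {L P : ℤ → End ℂ M} {h lam b : ℂ} {φ : ℤ → M} (hP : IsPrimary L P h)
    (hφ : IsDensity L lam b φ) (ht : Tame P φ) (h0 : ∃ n j, cross P φ n j ≠ 0) :
    ∃ d : ℕ, (∀ n, aeval shiftEnd ((X - 1 : ℂ[X]) ^ (d + 1)) (cross P φ n) = 0) ∧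
      ∃ n, aeval shiftEnd ((X - 1 : ℂ[X]) ^ d) (cross P φ n) ≠ 0 := by
  classical
  obtain ⟨D, hD⟩ : ∃ D, aeval shiftEnd ((X - 1 : ℂ[X]) ^ D) (cross P φ 0) = 0 ∧
      aeval shiftEnd ((X - 1 : ℂ[X]) ^ D) (cross P φ 1) = 0 ∧
      ∀ n : ℤ, lam + n = 0 → aeval shiftEnd ((X - 1 : ℂ[X]) ^ D) (cross P φ n) = 0 := by
    obtain ⟨a, ha⟩ := ht 0
    obtain ⟨b, hb⟩ := ht 1
    by_cases hn : ∃ n : ℤ, lam + n = 0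
    · obtain ⟨n, hn⟩ := hn
      obtain ⟨c, hc⟩ := ht n
      refine ⟨a + b + c, aeval_eq_zero_of_dvd ha (pow_dvd_pow _ (by omega)),
        aeval_eq_zero_of_dvd hb (pow_dvd_pow _ (by omega)), fun n' hn' => ?_⟩
      have : n' = n := by
        have : (n' : ℂ) = n := by linear_combination hn' - hn
        exact_mod_cast this
      rw [this]; exact aeval_eq_zero_of_dvd hc (pow_dvd_pow _ (by omega))
    · push Not at hn
      exact ⟨a + b, aeval_eq_zero_of_dvd ha (pow_dvd_pow _ (by omega)),
        aeval_eq_zero_of_dvd hb (pow_dvd_pow _ (by omega)), fun n' hn' => absurd hn' (hn n')⟩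
  obtain ⟨D0, D1, Ds⟩ := hD
  have hall : ∀ n, aeval shiftEnd ((X - 1 : ℂ[X]) ^ D) (cross P φ n) = 0 := by
    intro m
    by_contra hm
    have hex := ht m
    set e := Nat.find hex with he
    have hspec := Nat.find_spec hex
    rw [← he] at hspec
    have hDe : D < e := by
      by_contra hlt
      exact hm (aeval_eq_zero_of_dvd hspec (pow_dvd_pow _ (by omega)))
    obtain ⟨f, hf⟩ : ∃ f, e = f + 1 := ⟨e - 1, by omega⟩
    rw [hf] at hspec
    have hmin : aeval shiftEnd ((X - 1 : ℂ[X]) ^ f) (cross P φ m) ≠ 0 :=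
      Nat.find_min hex (by omega)
    obtain ⟨j, hj⟩ := Function.ne_iff.1 hmin
    have hconst : aeval shiftEnd ((X - 1 : ℂ[X]) ^ f) (cross P φ m) 0 ≠ 0 := by
      intro h00
      apply hj
      have hstep : ∀ j, aeval shiftEnd ((X - 1 : ℂ[X]) ^ f) (cross P φ m) (j + 1)
          - aeval shiftEnd ((X - 1 : ℂ[X]) ^ f) (cross P φ m) j = 0 := by
        intro j
        rw [← aeval_X_sub_one_apply, ← Module.End.mul_apply, ← map_mul, ← pow_succ', hspec]; rfl
      have := eq_add_smul_of_step hstep j 0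
      rw [smul_zero, zero_add, h00, sub_zero] at this
      exact this
    have key (n : ℤ) (hn : aeval shiftEnd ((X - 1 : ℂ[X]) ^ D) (cross P φ n) = 0) :
        lam + n + ((m - n : ℤ) : ℂ) * (b + h + f) = 0 := by
      have e1 : n + (m - n) = m := by ring
      have h1 := apply_top hP hφ (e := f) (i := m - n) (n := n) (by rw [e1]; exact hspec) 0
      rw [aeval_eq_zero_of_dvd hn (pow_dvd_pow _ (by omega)), e1, Pi.zero_apply, map_zero] at h1
      exact (smul_eq_zero.1 h1.symm).resolve_right hconst
    have k0 := key 0 D0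
    have k1 := key 1 D1
    push_cast at k0 k1
    have kB : b + h + f = 1 := by linear_combination k0 - k1
    rw [kB] at k0
    exact hm (Ds m (by linear_combination k0))
  have hex : ∃ D, ∀ n, aeval shiftEnd ((X - 1 : ℂ[X]) ^ D) (cross P φ n) = 0 := ⟨D, hall⟩
  have hspec := Nat.find_spec hex
  set e := Nat.find hex with he
  rcases hn : e with _ | f
  · rw [hn] at hspec
    obtain ⟨n, j, hnj⟩ := h0
    exfalso; apply hnj
    have := congrFun (hspec n) j
    simpa using this
  · rw [hn] at hspec
    refine ⟨f, hspec, ?_⟩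
    have := Nat.find_min hex (m := f) (by omega)
    push Not at this
    exact this

lemma isDensity_top {L P : ℤ → End ℂ M} {h lam b : ℂ} {φ : ℤ → M} (hP : IsPrimary L P h)
    (hφ : IsDensity L lam b φ) {d : ℕ}
    (hd : ∀ n, aeval shiftEnd ((X - 1 : ℂ[X]) ^ (d + 1)) (cross P φ n) = 0)
    (hd' : ∃ n, aeval shiftEnd ((X - 1 : ℂ[X]) ^ d) (cross P φ n) ≠ 0) :
    IsDensity L lam (b + h + d) (fun n => aeval shiftEnd ((X - 1 : ℂ[X]) ^ d) (cross P φ n) 0) ∧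
      ∃ n, aeval shiftEnd ((X - 1 : ℂ[X]) ^ d) (cross P φ n) 0 ≠ 0 := by
  refine ⟨fun i n => apply_top hP hφ (hd (n + i)) 0, ?_⟩
  obtain ⟨n, hn⟩ := hd'
  refine ⟨n, fun h00 => hn ?_⟩
  funext j
  have hstep : ∀ j, aeval shiftEnd ((X - 1 : ℂ[X]) ^ d) (cross P φ n) (j + 1)
      - aeval shiftEnd ((X - 1 : ℂ[X]) ^ d) (cross P φ n) j = 0 := by
    intro j
    rw [← aeval_X_sub_one_apply, ← Module.End.mul_apply, ← map_mul, ← pow_succ', hd]; rfl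
  have := eq_add_smul_of_step hstep j 0
  rwa [smul_zero, zero_add, h00, sub_zero] at this

/-- Tameness passes to linear combinations of products, given commutation relations. -/
lemma tame_combination {P' P : ℤ → End ℂ M} {φ : ℤ → M} (f : ℂ[X])
    (hP' : Tame P' φ)
    (hc : ∀ l : ℤ, ∃ (ε a c : ℂ) (Q : ℤ → End ℂ M), Tame Q φ ∧
      ∀ i : ℤ, P' i * P l = ε • (P l * P' i) + (a * i + c) • Q (i + l)) :
    Tame P' (fun n => aeval shiftEnd f (cross P φ n) 0) := by
  intro n
  change IsPolySeq _
  have : cross P' (fun n => aeval shiftEnd f (cross P φ n) 0) n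
      = fun i => ∑ l ∈ Finset.range (f.natDegree + 1),
        f.coeff l • (P' i * P l) (φ (n - i - l)) := by
    funext i
    simp only [cross, aeval_shift_apply, map_sum, map_smul, zero_add, Module.End.mul_apply]
  rw [this]
  refine IsPolySeq.sum _ fun l _ => IsPolySeq.smul ?_ _
  obtain ⟨ε, a, c, Q, hQ, hr⟩ := hc l
  have h1 : IsPolySeq (fun i => (ε • P l) (cross P' φ (n - l) i)) := IsPolySeq.map (hP' _) _
  have h2 : IsPolySeq (fun i : ℤ => (a * i + c) • cross Q φ n (i + l)) :=
    IsPolySeq.affine (IsPolySeq.translate (hQ n) l) a c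
  convert h1.add h2 using 1
  funext i
  have e1 : n - l - i = n - i - l := by ring
  have e2 : n - (i + l) = n - i - l := by ring
  simp only [hr, Pi.add_apply, cross, LinearMap.add_apply, LinearMap.smul_apply,
    Module.End.mul_apply, e1, e2]

end Nice

section NiceExistence
open Polynomial
variable {𝔤 M : Type} [LieRing 𝔤] [LieAlgebra ℂ 𝔤] [AddCommGroup M] [Module ℂ M]
  {L G : ℤ → End ℂ M} {E F : ℤ → 𝔤 →ₗ[ℂ] End ℂ M}

/-- A density family on which the currents act through the total degree only. -/
structure IsNice (L G : ℤ → End ℂ M) (E F : ℤ → 𝔤 →ₗ[ℂ] End ℂ M) (lam b : ℂ)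
    (φ : ℤ → M) : Prop where
  density : IsDensity L lam b φ
  apply_E : ∀ (j k : ℤ) (x : 𝔤), E j x (φ k) = E 0 x (φ (k + j))
  apply_F : ∀ (j k : ℤ) (x : 𝔤), F j x (φ k) = 0
  apply_G : ∀ j k : ℤ, G j (φ k) = G 0 (φ (k + j))

/-- A density family which is tame with respect to all currents. -/
structure IsTameDensity (L G : ℤ → End ℂ M) (E F : ℤ → 𝔤 →ₗ[ℂ] End ℂ M) (lam b : ℂ)
    (φ : ℤ → M) : Prop where
  density : IsDensity L lam b φ
  tame_G : Tame G φ
  tame_E : ∀ x, Tame (fun i => E i x) φ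
  tame_F : ∀ x, Tame (fun i => F i x) φ

namespace IsGRep

lemma primary_L (h : IsGRep 𝔤 L G E F) : IsPrimary L L (-1) := fun i j => by
  rw [h.comm_LL]; congr 1; ring

lemma primary_G (h : IsGRep 𝔤 L G E F) : IsPrimary L G (-1 / 2) := fun i j => by
  rw [h.comm_LG]; congr 1; ring

lemma primary_E (h : IsGRep 𝔤 L G E F) (x : 𝔤) : IsPrimary L (fun i => E i x) 0 := fun i j => by
  rw [h.comm_LE]; congr 1; ring

lemma primary_F (h : IsGRep 𝔤 L G E F) (x : 𝔤) : IsPrimary L (fun i => F i x) (1 / 2) :=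
  fun i j => by rw [h.comm_LF]; congr 1; ring

end IsGRep

lemma IsDensity.tame_L {lam b : ℂ} {φ : ℤ → M} (h : IsDensity L lam b φ) : Tame L φ := by
  intro n
  have : cross L φ n = fun i : ℤ => ((b - 1) * i + (lam + n)) • φ n := by
    funext i
    rw [cross, h, sub_add_cancel]; congr 1; push_cast; ring
  rw [this]
  exact (isPolySeq_const _).affine _ _

lemma isTameDensity_of_ne_one (hrep : IsGRep 𝔤 L G E F)
    (hfin : ∀ μ, FiniteDimensional ℂ ((L 0).eigenspace μ)) {lam b : ℂ} {φ : ℤ → M}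
    (h : IsDensity L lam b φ) (hb : b ≠ 1) : IsTameDensity L G E F lam b φ :=
  ⟨h, tame_of_ne_one hrep.primary_L hrep.primary_G h hfin (by norm_num) hb,
    fun x => tame_of_ne_one hrep.primary_L (hrep.primary_E x) h hfin (by norm_num) hb,
    fun x => tame_of_ne_one hrep.primary_L (hrep.primary_F x) h hfin (by norm_num) hb⟩

lemma IsTameDensity.top_G (hrep : IsGRep 𝔤 L G E F) {lam b b' : ℂ} {φ : ℤ → M}
    (h : IsTameDensity L G E F lam b φ) (f : ℂ[X])
    (hd : IsDensity L lam b' (fun n => aeval shiftEnd f (cross G φ n) 0)) :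
    IsTameDensity L G E F lam b' (fun n => aeval shiftEnd f (cross G φ n) 0) where
  density := hd
  tame_G := tame_combination f h.tame_G fun l => ⟨-1, 0, -2, L, h.density.tame_L, fun i => by
    have := hrep.comm_GG i l
    rw [eq_sub_of_add_eq this]; module⟩
  tame_E x := tame_combination f (h.tame_E x) fun l => ⟨1, -1, 0, _, h.tame_F x, fun i => by
    have := hrep.comm_GE l i x
    rw [add_comm i l]
    rw [sub_eq_iff_eq_add] at this
    rw [this]; module⟩
  tame_F x := tame_combination f (h.tame_F x) fun l => ⟨-1, 0, -1, _, h.tame_E x, fun i => by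
    have := hrep.comm_GF l i x
    rw [add_comm i l]
    rw [← eq_sub_iff_add_eq'] at this
    rw [this]; module⟩

lemma IsTameDensity.top_E (hrep : IsGRep 𝔤 L G E F) {lam b b' : ℂ} {φ : ℤ → M}
    (h : IsTameDensity L G E F lam b φ) (y : 𝔤) (f : ℂ[X])
    (hd : IsDensity L lam b' (fun n => aeval shiftEnd f (cross (fun i => E i y) φ n) 0)) :
    IsTameDensity L G E F lam b'
      (fun n => aeval shiftEnd f (cross (fun i => E i y) φ n) 0) where
  density := hd
  tame_G := tame_combination f h.tame_G fun l => ⟨1, 0, l, _, h.tame_F y, fun i => by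
    have := hrep.comm_GE i l y
    rw [sub_eq_iff_eq_add] at this
    rw [this]; module⟩
  tame_E x := tame_combination f (h.tame_E x) fun l => ⟨1, 0, 1, _, h.tame_E ⁅x, y⁆, fun i => by
    have := hrep.comm_EE i l x y
    rw [sub_eq_iff_eq_add] at this
    rw [this]; module⟩
  tame_F x := tame_combination f (h.tame_F x) fun l => ⟨1, 0, 1, _, h.tame_F ⁅x, y⁆, fun i => by
    have := hrep.comm_FE i l x y
    rw [sub_eq_iff_eq_add] at this
    rw [this]; module⟩

lemma IsTameDensity.top_F (hrep : IsGRep 𝔤 L G E F) {lam b b' : ℂ} {φ : ℤ → M}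
    (h : IsTameDensity L G E F lam b φ) (y : 𝔤) (f : ℂ[X])
    (hd : IsDensity L lam b' (fun n => aeval shiftEnd f (cross (fun i => F i y) φ n) 0)) :
    IsTameDensity L G E F lam b'
      (fun n => aeval shiftEnd f (cross (fun i => F i y) φ n) 0) where
  density := hd
  tame_G := tame_combination f h.tame_G fun l => ⟨-1, 0, -1, _, h.tame_E y, fun i => by
    have := hrep.comm_GF i l y
    rw [eq_sub_of_add_eq this]; module⟩
  tame_E x := tame_combination f (h.tame_E x) fun l => ⟨1, 0, -1, _, h.tame_F ⁅y, x⁆, fun i => by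
    have := hrep.comm_FE l i y x
    rw [add_comm i l]
    rw [sub_eq_iff_eq_add] at this
    rw [this]; module⟩
  tame_F x := tame_combination f (h.tame_F x) fun l => ⟨-1, 0, 0, _, h.tame_F x, fun i => by
    have := hrep.comm_FF i l x y
    rw [eq_sub_of_add_eq this]; module⟩

lemma IsDensity.ne_zero_or {lam b : ℂ} {φ : ℤ → M} (h : IsDensity L lam b φ) (h0 : φ ≠ 0)
    (hb : b ≠ 1) : φ 0 ≠ 0 ∨ φ 1 ≠ 0 := by
  by_contra hc
  push Not at hc
  apply h0
  funext m
  by_contra hm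
  have h1 := h m 0
  have h2 := h (m - 1) 1
  rw [hc.1, map_zero, zero_add] at h1
  rw [hc.2, map_zero, add_sub_cancel] at h2
  have k1 := (smul_eq_zero.1 h1.symm).resolve_right hm
  have k2 := (smul_eq_zero.1 h2.symm).resolve_right hm
  push_cast at k1 k2
  exact hb (by linear_combination k1 - k2)

/-- Only finitely many parameters `b` are realized. -/
lemma finite_density_params (hL : IsPrimary L L (-1))
    (hfin : ∀ μ, FiniteDimensional ℂ ((L 0).eigenspace μ)) (lam : ℂ) :
    {b : ℂ | ∃ φ : ℤ → M, φ ≠ 0 ∧ IsDensity L lam b φ}.Finite := by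
  have key (k : ℤ) : {b : ℂ | ∃ φ : ℤ → M, φ k ≠ 0 ∧ IsDensity L lam b φ}.Finite := by
    have hA : ∀ w ∈ (L 0).eigenspace (lam + k),
        (L (-1) * L 1) w ∈ (L 0).eigenspace (lam + k) := by
      intro w hw
      have := hL.map_eigenspace (-1) (hL.map_eigenspace 1 hw)
      rw [Module.End.mul_apply]
      convert this using 2; push_cast; ring
    have := hfin (lam + k)
    set A : End ℂ ((L 0).eigenspace (lam + k)) := (L (-1) * L 1).restrict hA with hAdef
    have hfA := Module.End.finite_hasEigenvalue A
    have h2 : ((fun b : ℂ => (lam + k + b) * (lam + k + 1 - b)) ⁻¹'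
        {μ | Module.End.HasEigenvalue A μ}).Finite := by
      refine Set.Finite.preimage' hfA fun μ _ => ?_
      rcases Set.eq_empty_or_nonempty ((fun b : ℂ => (lam + k + b) * (lam + k + 1 - b)) ⁻¹' {μ})
        with he | ⟨b₀, hb₀⟩
      · rw [he]; exact Set.finite_empty
      · refine Set.Finite.subset (Set.toFinite {b₀, 1 - b₀}) fun b hb => ?_
        simp only [Set.mem_preimage, Set.mem_singleton_iff] at hb hb₀
        have : (b - b₀) * (b - (1 - b₀)) = 0 := by linear_combination hb₀ - hb
        rcases mul_eq_zero.1 this with h | h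
        · left; linear_combination h
        · right; rw [Set.mem_singleton_iff]; linear_combination h
    refine h2.subset ?_
    rintro b ⟨φ, hk, hφ⟩
    refine Module.End.hasEigenvalue_of_hasEigenvector (x := ⟨φ k, hφ.mem_eigenspace k⟩) ⟨?_, ?_⟩
    · rw [Module.End.mem_eigenspace_iff]
      ext
      rw [hAdef, LinearMap.coe_restrict_apply, Module.End.mul_apply, hφ, map_smul, hφ, smul_smul]
      have : k + 1 + -1 = k := by ring
      rw [this]
      push_cast
      congr 1; ring
    · intro h
      exact hk (congrArg Subtype.val h)
  refine Set.Finite.subset (((key 0).union (key 1)).union (Set.finite_singleton 1)) ?_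
  rintro b ⟨φ, h0, hφ⟩
  by_cases hb : b = 1
  · right; exact hb
  · left
    rcases hφ.ne_zero_or h0 hb with h | h
    · left; exact ⟨φ, h, hφ⟩
    · right; exact ⟨φ, h, hφ⟩

lemma cross_eq_of_step {P : ℤ → End ℂ M} {φ : ℤ → M}
    (h : ∀ n, aeval shiftEnd (X - 1 : ℂ[X]) (cross P φ n) = 0) (j k : ℤ) :
    P j (φ k) = P 0 (φ (k + j)) := by
  have hstep : ∀ i, cross P φ (k + j) (i + 1) - cross P φ (k + j) i = 0 := fun i => by
    rw [← aeval_X_sub_one_apply, h]; rfl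
  have := eq_add_smul_of_step hstep j 0
  rw [smul_zero, sub_eq_zero, zero_add] at this
  simpa [cross] using this

lemma exists_isNice_of_isTameDensity (hrep : IsGRep 𝔤 L G E F)
    (hfin : ∀ μ, FiniteDimensional ℂ ((L 0).eigenspace μ)) {lam b : ℂ} {φ : ℤ → M}
    (h : IsTameDensity L G E F lam b φ) (h0 : φ ≠ 0) :
    ∃ (b : ℂ) (φ : ℤ → M), φ ≠ 0 ∧ IsNice L G E F lam b φ := by
  have hT : {b : ℂ | ∃ φ : ℤ → M, φ ≠ 0 ∧ IsTameDensity L G E F lam b φ}.Finite :=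
    (finite_density_params hrep.primary_L hfin lam).subset
      fun b ⟨φ, h0, hφ⟩ => ⟨φ, h0, hφ.density⟩
  obtain ⟨c, ⟨χ, hχ0, hχ⟩, hmax⟩ := Set.exists_max_image _ Complex.re hT ⟨b, φ, h0, h⟩
  have step {P : ℤ → End ℂ M} {h : ℂ} (hP : IsPrimary L P h) (ht : Tame P χ)
      (htop : ∀ (f : ℂ[X]) (b' : ℂ),
        IsDensity L lam b' (fun n => aeval shiftEnd f (cross P χ n) 0) →
        IsTameDensity L G E F lam b' (fun n => aeval shiftEnd f (cross P χ n) 0)) :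
      (∀ n j, cross P χ n j = 0) ∨ ∃ d : ℕ, h.re + d ≤ 0 ∧
        ∀ n, aeval shiftEnd ((X - 1 : ℂ[X]) ^ (d + 1)) (cross P χ n) = 0 := by
    by_cases hne : ∃ n j, cross P χ n j ≠ 0
    · right
      obtain ⟨d, hd1, hd2⟩ := exists_uniform_degree hP hχ.density ht hne
      obtain ⟨hd3, n, hn⟩ := isDensity_top hP hχ.density hd1 hd2
      have := hmax _ ⟨_, fun hz => hn (congrFun hz n), htop _ _ hd3⟩
      simp only [Complex.add_re, Complex.natCast_re] at this
      exact ⟨d, by linarith, hd1⟩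
    · left; push Not at hne; exact hne
  refine ⟨c, χ, hχ0, hχ.density, fun j k x => ?_, fun j k x => ?_, fun j k => ?_⟩
  · rcases step (hrep.primary_E x) (hχ.tame_E x) (fun f b' hd => hχ.top_E hrep x f hd)
      with hz | ⟨d, hd, hd'⟩
    · have h1 := hz (k + j) j
      have h2 := hz (k + j) 0
      simp only [cross, add_sub_cancel_right, sub_zero] at h1 h2
      rw [h1, h2]
    · have : d = 0 := by
        simp only [Complex.zero_re, zero_add] at hd
        exact Nat.le_zero.1 (by exact_mod_cast hd)
      subst this
      refine cross_eq_of_step (P := fun i => E i x) (fun n => ?_) j k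
      have := hd' n
      rwa [zero_add, pow_one] at this
  · rcases step (hrep.primary_F x) (hχ.tame_F x) (fun f b' hd => hχ.top_F hrep x f hd)
      with hz | ⟨d, hd, hd'⟩
    · have h1 := hz (k + j) j
      simpa only [cross, add_sub_cancel_right] using h1
    · exfalso
      have : (0 : ℝ) ≤ d := Nat.cast_nonneg d
      norm_num at hd
      linarith
  · rcases step hrep.primary_G hχ.tame_G (fun f b' hd => hχ.top_G hrep f hd) with hz | ⟨d, hd, hd'⟩
    · have h1 := hz (k + j) j
      have h2 := hz (k + j) 0
      simp only [cross, add_sub_cancel_right, sub_zero] at h1 h2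
      rw [h1, h2]
    · have : d = 0 := by
        norm_num at hd
        have h1 : (d : ℝ) < 1 := by linarith
        have h2 : d < 1 := by exact_mod_cast h1
        omega
      subst this
      refine cross_eq_of_step (fun n => ?_) j k
      have := hd' n
      rwa [zero_add, pow_one] at this

lemma isDensity_single {v : M} (hv : ∀ i, L i v = 0) : IsDensity L 0 1 (Pi.single 0 v) := by
  intro i k
  by_cases hk : k = 0
  · subst hk
    rw [Pi.single_eq_same, hv]
    by_cases hi : i = 0
    · subst hi; simp
    · rw [Pi.single_eq_of_ne (by simpa using hi), smul_zero]
  · rw [Pi.single_eq_of_ne hk, map_zero]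
    by_cases hi : k + i = 0
    · have : (0 : ℂ) + k + i * 1 = 0 := by
        rw [zero_add, mul_one]; exact_mod_cast hi
      rw [this, zero_smul]
    · rw [Pi.single_eq_of_ne hi, smul_zero]

lemma isDensity_of_trivial {P : ℤ → End ℂ M} {h : ℂ} (hP : IsPrimary L P h) {v : M}
    (hv : ∀ i, L i v = 0) : IsDensity L 0 h (fun j => P j v) := by
  intro i j
  have := LinearMap.congr_fun (hP i j) v
  simp only [LinearMap.sub_apply, Module.End.mul_apply, LinearMap.smul_apply, hv, map_zero,
    sub_zero] at this
  rw [this, add_comm i j, zero_add]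

theorem exists_isNice (hrep : IsGRep 𝔤 L G E F)
    (hfin : ∀ μ, FiniteDimensional ℂ ((L 0).eigenspace μ)) {lam b : ℂ} {φ : ℤ → M}
    (h : IsDensity L lam b φ) (h0 : φ ≠ 0) :
    ∃ (lam b : ℂ) (φ : ℤ → M), φ ≠ 0 ∧ IsNice L G E F lam b φ := by
  have base {lam b : ℂ} {φ : ℤ → M} (h : IsDensity L lam b φ) (h0 : φ ≠ 0) (hb : b ≠ 1) :
      ∃ (lam b : ℂ) (φ : ℤ → M), φ ≠ 0 ∧ IsNice L G E F lam b φ :=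
    ⟨lam, exists_isNice_of_isTameDensity hrep hfin (isTameDensity_of_ne_one hrep hfin h hb) h0⟩
  by_cases hb : b = 1
  swap
  · exact base h h0 hb
  subst hb
  by_cases hk : ∃ k : ℤ, lam + k ≠ 0 ∧ φ k ≠ 0
  · obtain ⟨k, hk, hk'⟩ := hk
    refine base (lam := lam) (b := 0) (φ := fun k => (lam + k) • φ k) (fun i k => ?_)
      (fun hz => smul_ne_zero hk hk' (congrFun hz k)) zero_ne_one
    simp only [map_smul, h i k]
    push_cast; module
  push Not at hk
  obtain ⟨k, hk0⟩ := Function.ne_iff.1 h0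
  have hlk : lam + k = 0 := by
    by_contra hne; exact hk0 (hk k hne)
  have hv : ∀ i, L i (φ k) = 0 := by
    intro i
    rw [h i k, hlk]
    by_cases hi : i = 0
    · subst hi; simp
    · rw [hk (k + i), smul_zero]
      push_cast
      rw [← add_assoc, hlk, zero_add]
      exact_mod_cast hi
  by_cases hG : (fun j => G j (φ k)) = 0
  swap
  · exact base (isDensity_of_trivial hrep.primary_G hv) hG (by norm_num)
  by_cases hE : ∀ x, (fun j => E j x (φ k)) = 0
  swap
  · push Not at hE
    obtain ⟨x, hx⟩ := hE
    exact base (isDensity_of_trivial (hrep.primary_E x) hv) hx (by norm_num)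
  by_cases hF : ∀ x, (fun j => F j x (φ k)) = 0
  swap
  · push Not at hF
    obtain ⟨x, hx⟩ := hF
    exact base (isDensity_of_trivial (hrep.primary_F x) hv) hx (by norm_num)
  have hs (A : End ℂ M) (hA : A (φ k) = 0) (l : ℤ) : A ((Pi.single 0 (φ k) : ℤ → M) l) = 0 := by
    by_cases hl : l = 0
    · subst hl; rw [Pi.single_eq_same, hA]
    · rw [Pi.single_eq_of_ne hl, map_zero]
  refine ⟨0, 1, Pi.single 0 (φ k), fun hz => hk0 ?_, isDensity_single hv, fun j l x => ?_,
    fun j l x => hs _ (congrFun (hF x) j) l, fun j l => ?_⟩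
  · have := congrFun hz 0
    rwa [Pi.single_eq_same] at this
  · rw [hs _ (congrFun (hE x) j), hs _ (congrFun (hE x) 0)]
  · rw [hs _ (congrFun hG j), hs _ (congrFun hG 0)]

end NiceExistence

section TensorQuotient
variable {𝔤 M : Type} [LieRing 𝔤] [LieAlgebra ℂ 𝔤] [AddCommGroup M] [Module ℂ M]
  {L G : ℤ → End ℂ M} {E F : ℤ → 𝔤 →ₗ[ℂ] End ℂ M}

/-- The projection to a homogeneous component. -/
lemma exists_graded_projections {gr : Fin 2 → Submodule ℂ M} (h : DirectSum.IsInternal gr) :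
    ∃ pr : Fin 2 → End ℂ M, (∀ q x, pr q x ∈ gr q) ∧ (∀ q, ∀ x ∈ gr q, pr q x = x) ∧
      (∀ q, ∀ x ∈ gr (q + 1), pr q x = 0) ∧ ∀ q x, pr q x + pr (q + 1) x = x := by
  have hc : IsCompl (gr 0) (gr 1) := h.isCompl (by decide) (by ext q; fin_cases q <;> simp)
  have h10 : (1 : Fin 2) + 1 = 0 := rfl
  have h01 : (0 : Fin 2) + 1 = 1 := rfl
  refine ⟨![(gr 0).subtype ∘ₗ (gr 0).projectionOnto (gr 1) hc,
    (gr 1).subtype ∘ₗ (gr 1).projectionOnto (gr 0) hc.symm], fun q x => ?_, fun q x hx => ?_,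
    fun q x hx => ?_, fun q x => ?_⟩
  · fin_cases q
    · exact Submodule.coe_mem _
    · exact Submodule.coe_mem _
  · fin_cases q
    · exact congrArg Subtype.val (Submodule.projectionOnto_apply_left hc ⟨x, hx⟩)
    · exact congrArg Subtype.val (Submodule.projectionOnto_apply_left hc.symm ⟨x, hx⟩)
  · fin_cases q
    · exact congrArg Subtype.val (Submodule.projectionOnto_apply_right hc ⟨x, hx⟩)
    · exact congrArg Subtype.val (Submodule.projectionOnto_apply_right hc.symm ⟨x, hx⟩)
  · have key : ((gr 0).projectionOnto (gr 1) hc x : M)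
        + ((gr 1).projectionOnto (gr 0) hc.symm x : M) = x :=
      Submodule.projection_add_projection_eq_self hc x
    fin_cases q
    · exact key
    · exact (add_comm _ _).trans key

lemma commute_projection {gr : Fin 2 → Submodule ℂ M} {pr : Fin 2 → End ℂ M}
    (h1 : ∀ q x, pr q x ∈ gr q) (h2 : ∀ q, ∀ x ∈ gr q, pr q x = x)
    (h3 : ∀ q, ∀ x ∈ gr (q + 1), pr q x = 0) (h4 : ∀ q x, pr q x + pr (q + 1) x = x)
    {p : Fin 2} {f : End ℂ M} (hf : MapsGr gr p f) (q : Fin 2) (x : M) :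
    f (pr q x) = pr (q + p) (f x) := by
  conv_rhs => rw [← h4 q x, map_add, map_add]
  have a1 : f (pr q x) ∈ gr (q + p) := hf q ⟨_, h1 q x, rfl⟩
  have a2 : f (pr (q + 1) x) ∈ gr (q + 1 + p) := hf (q + 1) ⟨_, h1 (q + 1) x, rfl⟩
  rw [add_right_comm] at a2
  rw [h2 _ _ a1, h3 _ _ a2, add_zero]

/-- A nonzero nice family may be chosen homogeneous. -/
lemma IsNice.exists_homogeneous {gr : Fin 2 → Submodule ℂ M} (hs : IsGSuper 𝔤 gr L G E F)
    {lam b : ℂ} {φ : ℤ → M} (h : IsNice L G E F lam b φ) (h0 : φ ≠ 0) :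
    ∃ (p : Fin 2) (φ : ℤ → M), φ ≠ 0 ∧ IsNice L G E F lam b φ ∧ ∀ k, φ k ∈ gr p := by
  obtain ⟨pr, h1, h2, h3, h4⟩ := exists_graded_projections hs.internal
  have comm {p : Fin 2} {f : End ℂ M} (hf : MapsGr gr p f) (q : Fin 2) (x : M) :=
    commute_projection h1 h2 h3 h4 hf q x
  have key (q : Fin 2) : IsNice L G E F lam b (fun k => pr q (φ k)) := by
    refine ⟨fun i k => ?_, fun j k x => ?_, fun j k x => ?_, fun j k => ?_⟩
    · rw [comm (hs.hL i), h.density, map_smul, add_zero]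
    · rw [comm (hs.hE j x), comm (hs.hE 0 x), h.apply_E]
    · rw [comm (hs.hF j x), h.apply_F, map_zero]
    · rw [comm (hs.hG j), comm (hs.hG 0), h.apply_G]
  by_cases hz : (fun k => pr 0 (φ k)) = 0
  · refine ⟨1, _, fun hz' => h0 ?_, key 1, fun k => h1 _ _⟩
    funext k
    rw [← h4 0 (φ k)]
    change pr 0 (φ k) + pr 1 (φ k) = 0
    rw [congrFun hz k, congrFun hz' k]; simp
  · exact ⟨0, _, hz, key 0, fun k => h1 _ _⟩

/-- The space of homogeneous nice families. -/
def niceSpace (L G : ℤ → End ℂ M) (E F : ℤ → 𝔤 →ₗ[ℂ] End ℂ M) (lam b : ℂ)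
    (N : Submodule ℂ M) : Submodule ℂ (ℤ → M) where
  carrier := {φ | IsNice L G E F lam b φ ∧ ∀ k, φ k ∈ N}
  add_mem' := by
    rintro φ χ ⟨h, h'⟩ ⟨g, g'⟩
    refine ⟨⟨fun i k => ?_, fun j k x => ?_, fun j k x => ?_, fun j k => ?_⟩,
      fun k => N.add_mem (h' k) (g' k)⟩
    · rw [Pi.add_apply, map_add, h.density, g.density, ← smul_add, Pi.add_apply]
    · rw [Pi.add_apply, map_add, h.apply_E, g.apply_E, Pi.add_apply, map_add]
    · rw [Pi.add_apply, map_add, h.apply_F, g.apply_F, add_zero]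
    · rw [Pi.add_apply, map_add, h.apply_G, g.apply_G, Pi.add_apply, map_add]
  zero_mem' := ⟨⟨fun i k => by simp, fun j k x => by simp, fun j k x => by simp,
    fun j k => by simp⟩, fun k => N.zero_mem⟩
  smul_mem' := by
    rintro c φ ⟨h, h'⟩
    refine ⟨⟨fun i k => ?_, fun j k x => ?_, fun j k x => ?_, fun j k => ?_⟩,
      fun k => N.smul_mem c (h' k)⟩
    · rw [Pi.smul_apply, map_smul, h.density, smul_comm, Pi.smul_apply]
    · rw [Pi.smul_apply, map_smul, h.apply_E, Pi.smul_apply, map_smul]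
    · rw [Pi.smul_apply, map_smul, h.apply_F, smul_zero]
    · rw [Pi.smul_apply, map_smul, h.apply_G, Pi.smul_apply, map_smul]

lemma IsDensity.eq_zero {lam b : ℂ} {φ : ℤ → M} (h : IsDensity L lam b φ) (h0 : φ 0 = 0)
    (h1 : φ 1 = 0) (hs : ∀ k : ℤ, lam + k = 0 → φ k = 0) : φ = 0 := by
  funext m
  by_contra hm
  have a1 := h m 0
  have a2 := h (m - 1) 1
  rw [h0, map_zero, zero_add] at a1
  rw [h1, map_zero, add_sub_cancel] at a2
  have k1 := (smul_eq_zero.1 a1.symm).resolve_right hm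
  have k2 := (smul_eq_zero.1 a2.symm).resolve_right hm
  push_cast at k1 k2
  have hb : b = 1 := by linear_combination k1 - k2
  rw [hb] at k1
  exact hm (hs m (by linear_combination k1))

lemma finiteDimensional_niceSpace (hfin : ∀ μ, FiniteDimensional ℂ ((L 0).eigenspace μ))
    (lam b : ℂ) (N : Submodule ℂ M) : FiniteDimensional ℂ (niceSpace L G E F lam b N) := by
  classical
  obtain ⟨s, hs⟩ : ∃ s : ℤ, ∀ k : ℤ, lam + k = 0 → k = s := by
    by_cases hn : ∃ n : ℤ, lam + n = 0
    · obtain ⟨n, hn⟩ := hn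
      refine ⟨n, fun k hk => ?_⟩
      have : (k : ℂ) = n := by linear_combination hk - hn
      exact_mod_cast this
    · exact ⟨0, fun k hk => absurd ⟨k, hk⟩ hn⟩
  let ev (k : ℤ) : niceSpace L G E F lam b N →ₗ[ℂ] (L 0).eigenspace (lam + k) :=
    ((LinearMap.proj k : (ℤ → M) →ₗ[ℂ] M) ∘ₗ (niceSpace L G E F lam b N).subtype).codRestrict _
      fun φ => φ.2.1.density.mem_eigenspace k
  have := hfin (lam + (0 : ℤ))
  have := hfin (lam + (1 : ℤ))
  have := hfin (lam + s)
  refine FiniteDimensional.of_injective ((ev 0).prod ((ev 1).prod (ev s))) ?_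
  rw [← LinearMap.ker_eq_bot, LinearMap.ker_eq_bot']
  rintro ⟨φ, hφ⟩ h
  have e0 := congrArg Prod.fst h
  have e1 := congrArg (fun z => z.2.1) h
  have es := congrArg (fun z => z.2.2) h
  have g (k : ℤ) (hk : ev k ⟨φ, hφ⟩ = 0) : φ k = 0 := congrArg Subtype.val hk
  ext1
  exact hφ.1.density.eq_zero (g 0 e0) (g 1 e1) fun k hk => by rw [hs k hk]; exact g s es

/-- The zero mode action of `𝔤` on sequences. -/
def zeroMode (E : ℤ → 𝔤 →ₗ[ℂ] End ℂ M) (x : 𝔤) : End ℂ (ℤ → M) := (E 0 x).compLeft ℤ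

lemma zeroMode_apply (E : ℤ → 𝔤 →ₗ[ℂ] End ℂ M) (x : 𝔤) (φ : ℤ → M) (k : ℤ) :
    zeroMode E x φ k = E 0 x (φ k) := rfl

lemma zeroMode_mem_niceSpace (hrep : IsGRep 𝔤 L G E F) {lam b : ℂ} {N : Submodule ℂ M}
    (hN : ∀ x, ∀ v ∈ N, E 0 x v ∈ N) (x : 𝔤) {φ : ℤ → M}
    (h : φ ∈ niceSpace L G E F lam b N) : zeroMode E x φ ∈ niceSpace L G E F lam b N := by
  obtain ⟨h, h'⟩ := h
  refine ⟨⟨fun i k => ?_, fun j k y => ?_, fun j k y => ?_, fun j k => ?_⟩, fun k => hN x _ (h' k)⟩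
  all_goals simp only [zeroMode_apply]
  · have := LinearMap.congr_fun (hrep.comm_LE i 0 x) (φ k)
    simp only [LinearMap.sub_apply, Module.End.mul_apply, Int.cast_zero,
      zero_smul, LinearMap.zero_apply, sub_eq_zero] at this
    rw [this, h.density, map_smul]
  · have h1 := LinearMap.congr_fun (hrep.comm_EE j 0 y x) (φ k)
    have h2 := LinearMap.congr_fun (hrep.comm_EE 0 0 y x) (φ (k + j))
    simp only [LinearMap.sub_apply, Module.End.mul_apply, sub_eq_iff_eq_add, add_zero] at h1 h2
    rw [h1, h2, h.apply_E j k ⁅y, x⁆, h.apply_E j k y]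
  · have h1 := LinearMap.congr_fun (hrep.comm_FE j 0 y x) (φ k)
    simp only [LinearMap.sub_apply, Module.End.mul_apply, sub_eq_iff_eq_add, add_zero] at h1
    rw [h1, h.apply_F, h.apply_F, map_zero, add_zero]
  · have h1 := LinearMap.congr_fun (hrep.comm_GE j 0 x) (φ k)
    have h2 := LinearMap.congr_fun (hrep.comm_GE 0 0 x) (φ (k + j))
    simp only [LinearMap.sub_apply, Module.End.mul_apply, Int.cast_zero,
      zero_smul, LinearMap.zero_apply, sub_eq_zero] at h1 h2
    rw [h1, h2, h.apply_G]

/-- A nonzero finite-dimensional stable space of sequences contains a minimal one. -/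
lemma exists_minimal_stable {ι V : Type} [AddCommGroup V] [Module ℂ V] (A : ι → End ℂ V)
    (N : Submodule ℂ V) [FiniteDimensional ℂ N] (hN : N ≠ ⊥) (hA : ∀ x, ∀ v ∈ N, A x v ∈ N) :
    ∃ W ≤ N, W ≠ ⊥ ∧ (∀ x, ∀ v ∈ W, A x v ∈ W) ∧
      ∀ W' ≤ W, (∀ x, ∀ v ∈ W', A x v ∈ W') → W' = ⊥ ∨ W' = W := by
  classical
  have hex : ∃ n, ∃ W ≤ N, W ≠ ⊥ ∧ (∀ x, ∀ v ∈ W, A x v ∈ W) ∧ finrank ℂ W = n :=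
    ⟨_, N, le_rfl, hN, hA, rfl⟩
  obtain ⟨W, hWN, hW0, hWA, hWn⟩ := Nat.find_spec hex
  refine ⟨W, hWN, hW0, hWA, fun W' hW' hA' => ?_⟩
  by_cases h0 : W' = ⊥
  · exact Or.inl h0
  · right
    have : FiniteDimensional ℂ W := Submodule.finiteDimensional_of_le hWN
    refine Submodule.eq_of_le_of_finrank_le hW' ?_
    rw [hWn]
    exact Nat.find_min' hex ⟨W', hW'.trans hWN, h0, hA', rfl⟩

/-- The simple module formed by a minimal stable space of sequences. -/
def zeroModeModule (hrep : IsGRep 𝔤 L G E F) (W : Submodule ℂ (ℤ → M)) [FiniteDimensional ℂ W]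
    (hW : W ≠ ⊥) (hA : ∀ x, ∀ v ∈ W, zeroMode E x v ∈ W)
    (hmin : ∀ W' ≤ W, (∀ x, ∀ v ∈ W', zeroMode E x v ∈ W') → W' = ⊥ ∨ W' = W) :
    SimpleFDModuleData 𝔤 :=
  letI lrm : LieRingModule 𝔤 W :=
    { bracket := fun x v => ⟨zeroMode E x v, hA x v v.2⟩
      add_lie := fun x y v => by
        ext k
        simp [zeroMode_apply]
      lie_add := fun x v w => by
        ext k
        simp [zeroMode_apply]
      leibniz_lie := fun x y v => by
        ext k
        have := LinearMap.congr_fun (hrep.comm_EE 0 0 x y) ((v : ℤ → M) k)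
        simp only [LinearMap.sub_apply, Module.End.mul_apply, add_zero] at this
        simp [zeroMode_apply, ← this] }
  { V := W
    lm :=
      { smul_lie := fun c x v => by
          ext k
          change E 0 (c • x) ((v : ℤ → M) k) = c • E 0 x ((v : ℤ → M) k)
          simp
        lie_smul := fun c x v => by
          ext k
          change E 0 x (c • (v : ℤ → M) k) = c • E 0 x ((v : ℤ → M) k)
          simp }
    findim := inferInstance
    simple := by
      constructor
      · obtain ⟨v, hv, hv0⟩ := Submodule.exists_mem_ne_zero_of_ne_bot hW
        exact ⟨⟨v, hv⟩, fun h => hv0 (congrArg Subtype.val h)⟩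
      · intro N hN
        have h1 : N.map W.subtype ≤ W := by
          rintro _ ⟨v, -, rfl⟩
          exact v.2
        rcases hmin (N.map W.subtype) h1 (by
          rintro x _ ⟨v, hv, rfl⟩
          exact ⟨⁅x, v⁆, hN x v hv, rfl⟩) with h | h
        · left
          rw [eq_bot_iff]
          intro v hv
          have : (v : ℤ → M) ∈ N.map W.subtype := ⟨v, hv, rfl⟩
          rw [h] at this
          exact Subtype.ext this
        · right
          rw [eq_top_iff]
          rintro v -
          have : (v : ℤ → M) ∈ N.map W.subtype := by rw [h]; exact v.2
          obtain ⟨w, hw, hwv⟩ := this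
          rwa [← Subtype.ext hwv] }

end TensorQuotient

section TensorMap
variable {𝔤 M V : Type} [LieRing 𝔤] [LieAlgebra ℂ 𝔤] [AddCommGroup M] [Module ℂ M]
  [AddCommGroup V] [Module ℂ V]
  {L G : ℤ → End ℂ M} {E F : ℤ → 𝔤 →ₗ[ℂ] End ℂ M}

/-- The map from the tensor module attached to a linear family of nice sequences. -/
def tensorMap (G0 : End ℂ M) (ι : V →ₗ[ℂ] ℤ → M) : TMod V →ₗ[ℂ] M :=
  Finsupp.lsum ℂ fun p =>
    if p.2 = 1 then LinearMap.proj p.1 ∘ₗ ι else -(G0 ∘ₗ LinearMap.proj p.1 ∘ₗ ι)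

lemma tensorMap_single_one (G0 : End ℂ M) (ι : V →ₗ[ℂ] ℤ → M) (m : ℤ) (v : V) :
    tensorMap G0 ι (Finsupp.single (m, 1) v) = ι v m := by
  simp [tensorMap]

lemma tensorMap_single_zero (G0 : End ℂ M) (ι : V →ₗ[ℂ] ℤ → M) (m : ℤ) (v : V) :
    tensorMap G0 ι (Finsupp.single (m, 0) v) = -G0 (ι v m) := by
  simp [tensorMap]

lemma tMod_hom_ext {f g : TMod V →ₗ[ℂ] M}
    (h1 : ∀ m v, f (Finsupp.single (m, 1) v) = g (Finsupp.single (m, 1) v))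
    (h0 : ∀ m v, f (Finsupp.single (m, 0) v) = g (Finsupp.single (m, 0) v)) : f = g := by
  refine Finsupp.lhom_ext fun p v => ?_
  obtain ⟨m, r⟩ := p
  fin_cases r
  · exact h0 m v
  · exact h1 m v

variable {lam b : ℂ} {ι : V →ₗ[ℂ] ℤ → M}

lemma tensorMap_comp_tmL (hrep : IsGRep 𝔤 L G E F) (hι : ∀ v, IsNice L G E F lam b (ι v))
    (i : ℤ) : tensorMap (G 0) ι ∘ₗ tmL V lam (b - 1 / 2) i = L i ∘ₗ tensorMap (G 0) ι := by
  refine tMod_hom_ext (fun m v => ?_) (fun m v => ?_)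
  · simp only [LinearMap.comp_apply, tmL, Finsupp.lsum_single, LinearMap.smul_apply,
      Finsupp.lsingle_apply, map_smul, tensorMap_single_one, (hι v).density i m, if_true]
    congr 1; ring
  · have h := LinearMap.congr_fun (hrep.comm_LG i 0) (ι v m)
    simp only [LinearMap.sub_apply, Module.End.mul_apply, LinearMap.smul_apply, add_zero,
      sub_eq_iff_eq_add, (hι v).density i m, map_smul, (hι v).apply_G i m] at h
    simp only [LinearMap.comp_apply, tmL, Finsupp.lsum_single, LinearMap.smul_apply,
      Finsupp.lsingle_apply, map_smul, tensorMap_single_zero, map_neg, h]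
    rw [if_neg (by decide)]
    push_cast
    module

lemma tensorMap_comp_tmG (hrep : IsGRep 𝔤 L G E F) (hι : ∀ v, IsNice L G E F lam b (ι v))
    (i : ℤ) : tensorMap (G 0) ι ∘ₗ tmG V lam (b - 1 / 2) i = G i ∘ₗ tensorMap (G 0) ι := by
  refine tMod_hom_ext (fun m v => ?_) (fun m v => ?_)
  · simp [LinearMap.comp_apply, tmG, tensorMap_single_zero, tensorMap_single_one,
      (hι v).apply_G i m]
  · have h := LinearMap.congr_fun (hrep.comm_GG i 0) (ι v m)
    have h' := LinearMap.congr_fun (hrep.comm_GG 0 0) (ι v (m + i))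
    simp only [LinearMap.add_apply, Module.End.mul_apply, LinearMap.smul_apply, add_zero,
      (hι v).density i m, (hι v).density 0 (m + i), (hι v).apply_G i m] at h h'
    simp only [LinearMap.comp_apply, tmG, Finsupp.lsum_single, LinearMap.smul_apply, if_true,
      Finsupp.lsingle_apply, map_smul, tensorMap_single_zero, tensorMap_single_one, map_neg]
    have e1 : G i (G 0 (ι v m)) = (-2 : ℂ) • (lam + m + i * b) • ι v (m + i)
        - G 0 (G 0 (ι v (m + i))) := by rw [← h]; abel
    have e2 : G 0 (G 0 (ι v (m + i))) = (-(lam + m + i)) • ι v (m + i) := by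
      have : (2 : ℂ) • G 0 (G 0 (ι v (m + i))) = (2 : ℂ) • (-(lam + m + i)) • ι v (m + i) := by
        rw [two_smul, h']; push_cast; module
      exact smul_right_injective M (two_ne_zero' ℂ) this
    rw [e1, e2]
    module

lemma tensorMap_single_mem {gr : Fin 2 → Submodule ℂ M} (hs : IsGSuper 𝔤 gr L G E F) {p : Fin 2}
    (hι : ∀ v k, ι v k ∈ gr p) (m : ℤ) (r : Fin 2) (v : V) :
    tensorMap (G 0) ι (Finsupp.single (m, r) v) ∈ gr (r + (p + 1)) := by
  fin_cases r
  · change tensorMap (G 0) ι (Finsupp.single (m, 0) v) ∈ gr (0 + (p + 1))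
    rw [tensorMap_single_zero, zero_add]
    exact (gr (p + 1)).neg_mem (hs.hG 0 p ⟨_, hι v m, rfl⟩)
  · change tensorMap (G 0) ι (Finsupp.single (m, 1) v) ∈ gr (1 + (p + 1))
    rw [tensorMap_single_one]
    convert hι v m using 2
    fin_cases p <;> rfl

lemma tensorMap_graded {gr : Fin 2 → Submodule ℂ M} (hs : IsGSuper 𝔤 gr L G E F) {p : Fin 2}
    (hι : ∀ v k, ι v k ∈ gr p) (q : Fin 2) :
    (tmGr V q).map (tensorMap (G 0) ι) ≤ gr (q + (p + 1)) := by
  rintro _ ⟨y, hy, rfl⟩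
  rw [← Finsupp.sum_single y, Finsupp.sum, map_sum]
  refine Submodule.sum_mem _ fun z hz => ?_
  obtain ⟨m, r⟩ := z
  obtain rfl : r = q := hy hz
  exact tensorMap_single_mem hs hι m r _

variable [LieRingModule 𝔤 V] [LieModule ℂ 𝔤 V]

lemma tensorMap_comp_tmE (hrep : IsGRep 𝔤 L G E F) (hι : ∀ v, IsNice L G E F lam b (ι v))
    (hE : ∀ (x : 𝔤) v k, ι ⁅x, v⁆ k = E 0 x (ι v k)) (i : ℤ) (x : 𝔤) :
    tensorMap (G 0) ι ∘ₗ tmE V i x = E i x ∘ₗ tensorMap (G 0) ι := by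
  refine tMod_hom_ext (fun m v => ?_) (fun m v => ?_)
  · simp [LinearMap.comp_apply, tmE, tensorMap_single_one, hE, (hι v).apply_E i m]
  · have h := LinearMap.congr_fun (hrep.comm_GE 0 i x) (ι v m)
    simp only [LinearMap.sub_apply, Module.End.mul_apply, LinearMap.smul_apply, zero_add,
      (hι v).apply_F i m, smul_zero, sub_eq_zero, (hι v).apply_E i m] at h
    simp [LinearMap.comp_apply, tmE, tensorMap_single_zero, hE, h]

lemma tensorMap_comp_tmF (hrep : IsGRep 𝔤 L G E F) (hι : ∀ v, IsNice L G E F lam b (ι v))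
    (hE : ∀ (x : 𝔤) v k, ι ⁅x, v⁆ k = E 0 x (ι v k)) (i : ℤ) (x : 𝔤) :
    tensorMap (G 0) ι ∘ₗ tmF V i x = F i x ∘ₗ tensorMap (G 0) ι := by
  refine tMod_hom_ext (fun m v => ?_) (fun m v => ?_)
  · simp [LinearMap.comp_apply, tmF, tensorMap_single_one, (hι v).apply_F i m]
  · have h := LinearMap.congr_fun (hrep.comm_GF 0 i x) (ι v m)
    simp only [LinearMap.add_apply, Module.End.mul_apply, LinearMap.neg_apply, zero_add,
      (hι v).apply_F i m, map_zero, (hι v).apply_E i m] at h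
    simp [LinearMap.comp_apply, tmF, tensorMap_single_zero, tensorMap_single_one, hE, h]

/-- A simple module with a nonzero nice sequence is a quotient of a tensor module. -/
theorem exists_tensorMap (hrep : IsGRep 𝔤 L G E F) {gr : Fin 2 → Submodule ℂ M}
    (hs : IsGSuper 𝔤 gr L G E F) (hsimple : IsSimpleRep (gOps 𝔤 L G E F) gr)
    (hfin : ∀ μ, FiniteDimensional ℂ ((L 0).eigenspace μ)) {φ : ℤ → M} (hφ : φ ≠ 0)
    (h : IsNice L G E F lam b φ) :
    ∃ (D : SimpleFDModuleData 𝔤) (lam b : ℂ) (π : TMod D.V →ₗ[ℂ] M),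
      Function.Surjective π ∧
      (∀ i : ℤ, π ∘ₗ tmL D.V lam b i = (L i : M →ₗ[ℂ] M) ∘ₗ π) ∧
      (∀ i : ℤ, π ∘ₗ tmG D.V lam b i = (G i : M →ₗ[ℂ] M) ∘ₗ π) ∧
      (∀ (i : ℤ) (x : 𝔤), π ∘ₗ tmE D.V i x = (E i x : M →ₗ[ℂ] M) ∘ₗ π) ∧
      (∀ (i : ℤ) (x : 𝔤), π ∘ₗ tmF D.V i x = (F i x : M →ₗ[ℂ] M) ∘ₗ π) ∧
      ((∀ q, (tmGr D.V q).map π ≤ gr q) ∨ (∀ q, (tmGr D.V q).map π ≤ gr (q + 1))) := by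
  obtain ⟨p, φ, hφ, h, hp⟩ := h.exists_homogeneous hs hφ
  have hstab (x : 𝔤) (v : ℤ → M) (hv : v ∈ niceSpace L G E F lam b (gr p)) :
      zeroMode E x v ∈ niceSpace L G E F lam b (gr p) :=
    zeroMode_mem_niceSpace hrep (fun x v hv => by
      have := hs.hE 0 x p ⟨v, hv, rfl⟩
      rwa [add_zero] at this) x hv
  have := finiteDimensional_niceSpace (L := L) (G := G) (E := E) (F := F) hfin lam b (gr p)
  obtain ⟨W, hW, hW0, hWA, hmin⟩ := exists_minimal_stable (zeroMode E)
    (niceSpace L G E F lam b (gr p)) (fun h0 => hφ (by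
      have : φ ∈ niceSpace L G E F lam b (gr p) := ⟨h, hp⟩
      rwa [h0] at this)) hstab
  have : FiniteDimensional ℂ W := Submodule.finiteDimensional_of_le hW
  let D := zeroModeModule hrep W hW0 hWA hmin
  let ι : D.V →ₗ[ℂ] ℤ → M := W.subtype
  have hι (v : D.V) : IsNice L G E F lam b (ι v) := (hW v.2).1
  have hιp (v : D.V) (k : ℤ) : ι v k ∈ gr p := (hW v.2).2 k
  have hιE (x : 𝔤) (v : D.V) (k : ℤ) : ι ⁅x, v⁆ k = E 0 x (ι v k) := rfl
  have hL := tensorMap_comp_tmL hrep hι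
  have hG := tensorMap_comp_tmG hrep hι
  have hE := tensorMap_comp_tmE hrep hι hιE
  have hF := tensorMap_comp_tmF hrep hι hιE
  have hgr := tensorMap_graded (ι := ι) hs hιp
  have hrange : (tensorMap (G 0) ι).range = ⊤ := by
    refine (hsimple.2 (tensorMap (G 0) ι).range ?_ ?_).resolve_left fun h0 => ?_
    · rintro f hf _ ⟨_, ⟨y, rfl⟩, rfl⟩
      rcases hf with ((⟨i, rfl⟩ | ⟨i, rfl⟩) | ⟨i, x, rfl⟩) | ⟨i, x, rfl⟩
      · exact ⟨_, LinearMap.congr_fun (hL i) y⟩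
      · exact ⟨_, LinearMap.congr_fun (hG i) y⟩
      · exact ⟨_, LinearMap.congr_fun (hE i x) y⟩
      · exact ⟨_, LinearMap.congr_fun (hF i x) y⟩
    · rintro _ ⟨y, rfl⟩
      rw [← Finsupp.sum_single y, Finsupp.sum, map_sum]
      refine Submodule.sum_mem _ fun z _ => ?_
      have h1 := tensorMap_single_mem (ι := ι) hs hιp z.1 z.2 (y z)
      generalize z.2 + (p + 1) = q at h1
      fin_cases q
      · exact Submodule.mem_sup_left ⟨⟨_, rfl⟩, h1⟩
      · exact Submodule.mem_sup_right ⟨⟨_, rfl⟩, h1⟩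
    · obtain ⟨v, hv, hv0⟩ := Submodule.exists_mem_ne_zero_of_ne_bot hW0
      refine hv0 (funext fun k => ?_)
      have hz : tensorMap (G 0) ι = 0 := LinearMap.range_eq_bot.1 h0
      let w : D.V := (⟨v, hv⟩ : W)
      have h1 : ι w k = 0 := by rw [← tensorMap_single_one (G 0) ι k w, hz, LinearMap.zero_apply]
      exact h1
  refine ⟨D, lam, b - 1 / 2, tensorMap (G 0) ι, LinearMap.range_eq_top.1 hrange, hL, hG, hE, hF, ?_⟩
  fin_cases p
  · exact Or.inr hgr
  · exact Or.inl fun q => by simpa using hgr q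

end TensorMap

section Germs
open Filter Topology

/-- The operator `u ↦ n (u(n+1) - u(n))` on scalar sequences. -/
def nabla : End ℂ (ℤ → ℂ) := indexEnd * (shiftEnd - 1)

lemma nabla_apply (u : ℤ → ℂ) (n : ℤ) : nabla u n = n * (u (n + 1) - u n) := rfl

lemma shiftEnd_apply (u : ℤ → ℂ) (n : ℤ) : shiftEnd u n = u (n + 1) := rfl

/-- The sequence `c` has, for large `n`, an expansion in powers of `1 / n` with leading
term `c₀`. -/
def IsCoeff (c : ℤ → ℂ) (c₀ : ℂ) : Prop :=
  ∃ F : ℂ → ℂ, AnalyticAt ℂ F 0 ∧ F 0 = c₀ ∧ ∀ᶠ n : ℤ in atTop, c n = F (n : ℂ)⁻¹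

lemma tendsto_int_inv : Tendsto (fun n : ℤ => ((n : ℂ))⁻¹) atTop (𝓝 0) := by
  refine tendsto_inv₀_cobounded.comp ?_
  rw [← tendsto_norm_atTop_iff_cobounded]
  have : Tendsto (fun n : ℤ => ((n : ℝ))) atTop atTop := tendsto_intCast_atTop_atTop
  exact (tendsto_abs_atTop_atTop.comp this).congr fun n => by simp

lemma eventually_add_ne_zero (a : ℂ) : ∀ᶠ n : ℤ in atTop, (n : ℂ) + a ≠ 0 := by
  have : Tendsto (fun n : ℤ => ((n : ℝ))) atTop atTop := tendsto_intCast_atTop_atTop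
  filter_upwards [this.eventually_gt_atTop (-a.re)] with n hn h
  have := congrArg Complex.re h
  simp at this
  linarith

namespace IsCoeff
variable {c d : ℤ → ℂ} {c₀ d₀ : ℂ}

lemma congr (h : IsCoeff c c₀) (hd : ∀ᶠ n : ℤ in atTop, d n = c n) : IsCoeff d c₀ := by
  obtain ⟨F, h1, h2, h3⟩ := h
  exact ⟨F, h1, h2, by filter_upwards [h3, hd] with n a b; rw [b, a]⟩

lemma const (a : ℂ) : IsCoeff (fun _ => a) a :=
  ⟨fun _ => a, analyticAt_const, rfl, by simp⟩

lemma add (h : IsCoeff c c₀) (h' : IsCoeff d d₀) : IsCoeff (c + d) (c₀ + d₀) := by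
  obtain ⟨F, h1, rfl, h3⟩ := h
  obtain ⟨F', h1', rfl, h3'⟩ := h'
  exact ⟨F + F', h1.add h1', rfl, by
    filter_upwards [h3, h3'] with n a b; rw [Pi.add_apply, a, b, Pi.add_apply]⟩

lemma mul (h : IsCoeff c c₀) (h' : IsCoeff d d₀) : IsCoeff (c * d) (c₀ * d₀) := by
  obtain ⟨F, h1, rfl, h3⟩ := h
  obtain ⟨F', h1', rfl, h3'⟩ := h'
  exact ⟨F * F', h1.mul h1', rfl, by
    filter_upwards [h3, h3'] with n a b; rw [Pi.mul_apply, a, b, Pi.mul_apply]⟩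

lemma smul (a : ℂ) (h : IsCoeff c c₀) : IsCoeff (a • c) (a * c₀) :=
  (const a).mul h

lemma neg (h : IsCoeff c c₀) : IsCoeff (-c) (-c₀) := by
  simpa using h.smul (-1)

lemma sub (h : IsCoeff c c₀) (h' : IsCoeff d d₀) : IsCoeff (c - d) (c₀ - d₀) := by
  simpa [sub_eq_add_neg] using h.add h'.neg

lemma inv (h : IsCoeff c c₀) (h0 : c₀ ≠ 0) : IsCoeff (fun n => (c n)⁻¹) c₀⁻¹ := by
  obtain ⟨F, h1, rfl, h3⟩ := h
  exact ⟨fun z => (F z)⁻¹, h1.inv h0, rfl, by filter_upwards [h3] with n a; rw [a]⟩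

lemma index_inv : IsCoeff (fun n => (n : ℂ)⁻¹) 0 :=
  ⟨id, analyticAt_id, rfl, by simp⟩

/-- `n ↦ (n + a) / n`. -/
lemma add_div (a : ℂ) : IsCoeff (fun n => ((n : ℂ) + a) * (n : ℂ)⁻¹) 1 := by
  refine (show IsCoeff _ _ by
    simpa using (const 1).add (index_inv.smul a)).congr ?_
  filter_upwards [eventually_add_ne_zero 0] with n hn
  rw [add_zero] at hn
  simp; field_simp

/-- `n ↦ 1 / (n + a)`. -/
lemma inv_add (a : ℂ) : IsCoeff (fun n => ((n : ℂ) + a)⁻¹) 0 := by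
  refine (show IsCoeff _ _ by
    simpa using ((add_div a).inv one_ne_zero).mul index_inv).congr ?_
  filter_upwards [eventually_add_ne_zero 0, eventually_add_ne_zero a] with n hn hn'
  rw [add_zero] at hn
  simp; field_simp

lemma shift (h : IsCoeff c c₀) (t : ℤ) : IsCoeff (fun n => c (n + t)) c₀ := by
  obtain ⟨F, h1, rfl, h3⟩ := h
  have e0 : (0 : ℂ) / (1 + t * 0) = 0 := by simp
  refine ⟨fun z => F (z / (1 + t * z)), ?_, by simp, ?_⟩
  · refine AnalyticAt.fun_comp (by rwa [e0]) ?_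
    exact analyticAt_id.div (by fun_prop) (by simp)
  · have h4 := (tendsto_atTop_add_const_right atTop t tendsto_id).eventually h3
    filter_upwards [h4, eventually_add_ne_zero 0, eventually_add_ne_zero t] with n a hn hn'
    rw [add_zero] at hn
    rw [id] at a
    rw [a]
    congr 1
    push_cast
    field_simp

lemma nabla (h : IsCoeff c c₀) : IsCoeff (_root_.nabla c) 0 := by
  obtain ⟨F, h1, rfl, h3⟩ := h
  obtain ⟨p, hp⟩ := h1
  have hH : AnalyticAt ℂ (dslope F 0) 0 := ⟨_, hp.has_fpower_series_dslope_fslope⟩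
  have hF (z : ℂ) : F z = F 0 + z * dslope F 0 z := by
    have := sub_smul_dslope F 0 z
    simp only [sub_zero, smul_eq_mul] at this
    rw [this]; ring
  have e0 : (0 : ℂ) / (1 + 0) = 0 := by simp
  refine ⟨fun z => dslope F 0 (z / (1 + z)) / (1 + z) - dslope F 0 z, ?_, by simp, ?_⟩
  · refine AnalyticAt.sub (AnalyticAt.div ?_ (by fun_prop) (by simp)) hH
    refine AnalyticAt.fun_comp (by rwa [e0]) ?_
    exact analyticAt_id.div (by fun_prop) (by simp)
  · have h4 := (tendsto_atTop_add_const_right atTop 1 tendsto_id).eventually h3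
    filter_upwards [h3, h4, eventually_add_ne_zero 0, eventually_add_ne_zero 1] with n a a' hn hn'
    rw [add_zero] at hn
    rw [id] at a'
    rw [nabla_apply, a, a', hF (n : ℂ)⁻¹, hF ((n + 1 : ℤ) : ℂ)⁻¹]
    have : ((n + 1 : ℤ) : ℂ)⁻¹ = (n : ℂ)⁻¹ / (1 + (n : ℂ)⁻¹) := by push_cast; field_simp
    rw [this]
    field_simp
    ring

end IsCoeff

lemma analyticAt_det {ι : Type*} [Fintype ι] [DecidableEq ι] {A : ℂ → Matrix ι ι ℂ}
    (h : ∀ i j, AnalyticAt ℂ (fun z => A z i j) 0) : AnalyticAt ℂ (fun z => (A z).det) 0 := by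
  simp only [Matrix.det_apply']
  exact Finset.analyticAt_fun_sum _ fun σ _ =>
    analyticAt_const.mul (Finset.analyticAt_fun_prod _ fun i _ => h _ _)

/-- A matrix of coefficient sequences converging to the identity has an inverse of the same
type. -/
lemma exists_coeff_inverse {ι : Type*} [Fintype ι] [DecidableEq ι] {B : ι → ι → ℤ → ℂ}
    (hB : ∀ i j, IsCoeff (B i j) (if i = j then 1 else 0)) :
    ∃ C : ι → ι → ℤ → ℂ, (∀ i j, ∃ c₀, IsCoeff (C i j) c₀) ∧
      ∀ᶠ n in atTop, ∀ i j, ∑ l, C i l n * B l j n = if i = j then 1 else 0 := by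
  choose F h1 h2 h3 using hB
  let A (z : ℂ) : Matrix ι ι ℂ := Matrix.of fun i j => F i j z
  have hA (i j) : AnalyticAt ℂ (fun z => A z i j) 0 := h1 i j
  have hA0 : A 0 = 1 := by ext i j; simp [A, h2, Matrix.one_apply]
  have hdet := analyticAt_det hA
  have hdet0 : (A 0).det ≠ 0 := by simp [hA0]
  have hadj (i j) : AnalyticAt ℂ (fun z => (A z).adjugate i j) 0 := by
    simp only [Matrix.adjugate_apply]
    refine analyticAt_det fun k l => ?_
    by_cases hk : k = j
    · simp only [hk, Matrix.updateRow_self]; exact analyticAt_const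
    · simp only [Matrix.updateRow_ne hk]; exact hA k l
  refine ⟨fun i j n => ((A (n : ℂ)⁻¹).det)⁻¹ * (A (n : ℂ)⁻¹).adjugate i j, fun i j =>
    ⟨_, fun z => ((A z).det)⁻¹ * (A z).adjugate i j, (hdet.inv hdet0).mul (hadj i j), rfl,
      by simp⟩, ?_⟩
  have hev := tendsto_int_inv.eventually (hdet.continuousAt.eventually_ne hdet0)
  have h3' : ∀ᶠ n : ℤ in atTop, ∀ i j, B i j n = F i j (n : ℂ)⁻¹ := by
    simp only [eventually_all]; exact h3
  filter_upwards [hev, h3'] with n hn hB i j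
  have := congrFun (congrFun (Matrix.adjugate_mul (A (n : ℂ)⁻¹)) i) j
  rw [Matrix.mul_apply] at this
  simp only [hB, mul_assoc, ← Finset.mul_sum]
  have e : ∑ l, (A (n : ℂ)⁻¹).adjugate i l * F l j (n : ℂ)⁻¹
      = ((A (n : ℂ)⁻¹).det • (1 : Matrix ι ι ℂ)) i j := this
  rw [e]
  simp [Matrix.one_apply, hn]

end Germs

section Lattice
open Filter Topology
variable {ι : Type} [Fintype ι]

/-- Sequences which for large `n` are combinations of the `g i` with coefficient sequences. -/
def lat (g : ι → ℤ → ℂ) : Submodule ℂ (ℤ → ℂ) where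
  carrier := {u | ∃ (c : ι → ℤ → ℂ) (c₀ : ι → ℂ), (∀ i, IsCoeff (c i) (c₀ i)) ∧
    u =ᶠ[atTop] ∑ i, c i * g i}
  add_mem' := by
    rintro u v ⟨c, c₀, hc, hu⟩ ⟨d, d₀, hd, hv⟩
    refine ⟨c + d, c₀ + d₀, fun i => (hc i).add (hd i), (hu.add hv).trans ?_⟩
    simp only [Pi.add_apply, add_mul, Finset.sum_add_distrib]; rfl
  zero_mem' := ⟨0, 0, fun _ => IsCoeff.const 0, by simp⟩
  smul_mem' := by
    rintro a u ⟨c, c₀, hc, hu⟩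
    refine ⟨a • c, fun i => a * c₀ i, fun i => (hc i).smul a, (hu.const_smul a).trans ?_⟩
    simp only [Pi.smul_apply, smul_mul_assoc, ← Finset.smul_sum]; rfl

/-- Sequences which for large `n` are combinations of the `g i` with coefficient sequences
tending to zero. -/
def latZero (g : ι → ℤ → ℂ) : Submodule ℂ (ℤ → ℂ) where
  carrier := {u | ∃ c : ι → ℤ → ℂ, (∀ i, IsCoeff (c i) 0) ∧ u =ᶠ[atTop] ∑ i, c i * g i}
  add_mem' := by
    rintro u v ⟨c, hc, hu⟩ ⟨d, hd, hv⟩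
    refine ⟨c + d, fun i => by simpa using (hc i).add (hd i), (hu.add hv).trans ?_⟩
    simp only [Pi.add_apply, add_mul, Finset.sum_add_distrib]; rfl
  zero_mem' := ⟨0, fun _ => IsCoeff.const 0, by simp⟩
  smul_mem' := by
    rintro a u ⟨c, hc, hu⟩
    refine ⟨a • c, fun i => by simpa using (hc i).smul a, (hu.const_smul a).trans ?_⟩
    simp only [Pi.smul_apply, smul_mul_assoc, ← Finset.smul_sum]; rfl

variable {g : ι → ℤ → ℂ}

lemma latZero_le_lat : latZero g ≤ lat g := fun _ ⟨c, hc, hu⟩ => ⟨c, 0, hc, hu⟩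

lemma mem_latZero_of_eventuallyEq {u v : ℤ → ℂ} (h : u =ᶠ[atTop] v) (hv : v ∈ latZero g) :
    u ∈ latZero g := by
  obtain ⟨c, hc, hv⟩ := hv
  exact ⟨c, hc, h.trans hv⟩

lemma mem_lat_of_eventuallyEq {u v : ℤ → ℂ} (h : u =ᶠ[atTop] v) (hv : v ∈ lat g) : u ∈ lat g := by
  obtain ⟨c, c₀, hc, hv⟩ := hv
  exact ⟨c, c₀, hc, h.trans hv⟩

lemma self_mem_lat (i : ι) : g i ∈ lat g := by
  classical
  refine ⟨Pi.single i 1, Pi.single i 1, fun j => ?_, ?_⟩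
  · by_cases h : j = i
    · subst h
      rw [Pi.single_eq_same, Pi.single_eq_same]
      exact IsCoeff.const 1
    · rw [Pi.single_eq_of_ne h, Pi.single_eq_of_ne h]
      exact IsCoeff.const 0
  · rw [Finset.sum_eq_single i (fun j _ h => by simp [h]) (by simp)]; simp

lemma coeff_mul_mem_lat {c : ℤ → ℂ} {c₀ : ℂ} (hc : IsCoeff c c₀) {u : ℤ → ℂ} (hu : u ∈ lat g) :
    c * u ∈ lat g := by
  obtain ⟨d, d₀, hd, hu⟩ := hu
  refine ⟨fun i => c * d i, fun i => c₀ * d₀ i, fun i => hc.mul (hd i),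
    (EventuallyEq.rfl.mul hu).trans ?_⟩
  simp only [Finset.mul_sum, mul_assoc]; rfl

lemma coeff_mul_mem_latZero {c : ℤ → ℂ} (hc : IsCoeff c 0) {u : ℤ → ℂ} (hu : u ∈ lat g) :
    c * u ∈ latZero g := by
  obtain ⟨d, d₀, hd, hu⟩ := hu
  refine ⟨fun i => c * d i, fun i => by simpa using hc.mul (hd i),
    (EventuallyEq.rfl.mul hu).trans ?_⟩
  simp only [Finset.mul_sum, mul_assoc]; rfl

lemma sum_coeff_mem_latZero {c : ι → ℤ → ℂ} (hc : ∀ i, IsCoeff (c i) 0) {u : ι → ℤ → ℂ}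
    (hu : ∀ i, u i ∈ lat g) : ∑ i, c i * u i ∈ latZero g :=
  Submodule.sum_mem _ fun i _ => coeff_mul_mem_latZero (hc i) (hu i)

lemma nabla_congr {u v : ℤ → ℂ} (h : u =ᶠ[atTop] v) : nabla u =ᶠ[atTop] nabla v := by
  have h' := (tendsto_atTop_add_const_right atTop (1 : ℤ) tendsto_id).eventually h
  filter_upwards [h, h'] with n a b
  rw [nabla_apply, nabla_apply, a]
  exact congrArg (fun z => (n : ℂ) * (z - v n)) b

lemma shiftEnd_eventually (u : ℤ → ℂ) :
    shiftEnd u =ᶠ[atTop] u + (fun n : ℤ => (n : ℂ)⁻¹) * nabla u := by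
  filter_upwards [eventually_add_ne_zero 0] with n hn
  rw [add_zero] at hn
  simp only [Pi.add_apply, Pi.mul_apply, nabla_apply, shiftEnd_apply]
  field_simp; ring

lemma nabla_mul (c u : ℤ → ℂ) :
    nabla (c * u) = (fun n => c (n + 1)) * nabla u + nabla c * u := by
  funext n
  simp only [nabla_apply, Pi.mul_apply, Pi.add_apply]; ring

lemma nabla_mem_lat (h : ∀ i, nabla (g i) ∈ lat g) {u : ℤ → ℂ} (hu : u ∈ lat g) :
    nabla u ∈ lat g := by
  obtain ⟨c, c₀, hc, hu⟩ := hu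
  refine mem_lat_of_eventuallyEq (nabla_congr hu) ?_
  rw [map_sum]
  refine Submodule.sum_mem _ fun i _ => ?_
  rw [nabla_mul]
  exact add_mem (coeff_mul_mem_lat ((hc i).shift 1) (h i))
    (coeff_mul_mem_lat (hc i).nabla (self_mem_lat i))

lemma nabla_mem_latZero (h : ∀ i, nabla (g i) ∈ lat g) {u : ℤ → ℂ} (hu : u ∈ latZero g) :
    nabla u ∈ latZero g := by
  obtain ⟨c, hc, hu⟩ := hu
  refine mem_latZero_of_eventuallyEq (nabla_congr hu) ?_
  rw [map_sum]
  refine Submodule.sum_mem _ fun i _ => ?_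
  rw [nabla_mul]
  exact add_mem (coeff_mul_mem_latZero ((hc i).shift 1) (h i))
    (coeff_mul_mem_latZero (hc i).nabla (self_mem_lat i))

lemma shiftEnd_sub_mem_latZero {u : ℤ → ℂ} (h : nabla u ∈ lat g) :
    shiftEnd u - u ∈ latZero g := by
  refine mem_latZero_of_eventuallyEq ?_ (coeff_mul_mem_latZero IsCoeff.index_inv h)
  filter_upwards [shiftEnd_eventually u] with n hn
  rw [Pi.sub_apply, hn, Pi.add_apply]; ring

lemma shiftEnd_mem_lat {u : ℤ → ℂ} (hu : u ∈ lat g) (h : nabla u ∈ lat g) :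
    shiftEnd u ∈ lat g := by
  simpa using add_mem (latZero_le_lat (shiftEnd_sub_mem_latZero h)) hu

/-- If a family of sequences is congruent to a second one modulo small combinations of it,
it can be recovered from the second one. -/
lemma exists_coeff_solution {v : ι → ℤ → ℂ} (h : ∀ i, v i - g i ∈ latZero g) :
    ∃ C : ι → ι → ℤ → ℂ, (∀ i j, ∃ c₀, IsCoeff (C i j) c₀) ∧
      ∀ i, g i =ᶠ[atTop] ∑ l, C i l * v l := by
  classical
  choose B hB1 hB2 using h
  obtain ⟨C, hC1, hC2⟩ := exists_coeff_inverse
    (B := fun i j => (fun _ => if i = j then 1 else 0) + B i j)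
    (fun i j => by simpa using (IsCoeff.const _).add (hB1 i j))
  refine ⟨C, hC1, fun i => ?_⟩
  have hB2' : ∀ᶠ n in atTop, ∀ i, (v i - g i) n = (∑ j, B i j * g j) n :=
    eventually_all.2 hB2
  filter_upwards [hC2, hB2'] with n h1 h2
  have hv (l : ι) : v l n = ∑ j, ((if l = j then 1 else 0) + B l j n) * g j n := by
    have := h2 l
    simp only [Pi.sub_apply, Finset.sum_apply, Pi.mul_apply, sub_eq_iff_eq_add] at this
    simp [add_mul, Finset.sum_add_distrib, this, add_comm]
  simp only [Finset.sum_apply, Pi.mul_apply, hv, Finset.mul_sum, ← mul_assoc]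
  rw [Finset.sum_comm]
  simp only [← Finset.sum_mul]
  have h1' (j : ι) := h1 i j
  simp only [Pi.add_apply] at h1'
  simp [h1']

lemma mem_lat_of_shiftEnd_mem_lat (h : ∀ i, nabla (g i) ∈ lat g) {u : ℤ → ℂ}
    (hu : shiftEnd u ∈ lat g) : u ∈ lat g := by
  obtain ⟨C, hC, hg⟩ := exists_coeff_solution (v := fun i => shiftEnd (g i))
    fun i => shiftEnd_sub_mem_latZero (h i)
  have hg' (i : ι) : (fun n => g i (n - 1)) ∈ lat g := by
    have e : (fun n => g i (n - 1)) =ᶠ[atTop] ∑ l, (fun n => C i l (n + (-1))) * g l := by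
      have := (tendsto_atTop_add_const_right atTop (-1 : ℤ) tendsto_id).eventually (hg i)
      filter_upwards [this] with n hn
      simp only [id, Finset.sum_apply, Pi.mul_apply, shiftEnd_apply, neg_add_cancel_right] at hn
      simp only [Finset.sum_apply, Pi.mul_apply]
      exact hn
    refine mem_lat_of_eventuallyEq e (Submodule.sum_mem _ fun l _ => ?_)
    obtain ⟨c₀, hc⟩ := hC i l
    exact coeff_mul_mem_lat (hc.shift _) (self_mem_lat l)
  obtain ⟨c, c₀, hc, hu⟩ := hu
  have e : u =ᶠ[atTop] ∑ i, (fun n => c i (n + (-1))) * fun n => g i (n - 1) := by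
    have := (tendsto_atTop_add_const_right atTop (-1 : ℤ) tendsto_id).eventually hu
    filter_upwards [this] with n hn
    simp only [id, Finset.sum_apply, Pi.mul_apply, shiftEnd_apply, neg_add_cancel_right] at hn
    simp only [Finset.sum_apply, Pi.mul_apply]
    exact hn
  exact mem_lat_of_eventuallyEq e
    (Submodule.sum_mem _ fun i _ => coeff_mul_mem_lat ((hc i).shift _) (hg' i))

lemma eventually_zero_of_mem_latZero (h : ∀ i, g i ∈ latZero g) (i : ι) : g i =ᶠ[atTop] 0 := by
  obtain ⟨C, -, hg⟩ := exists_coeff_solution (v := fun _ => 0)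
    fun i => by rw [zero_sub]; exact neg_mem (h i)
  simpa using hg i

/-- A limiting functional on a lattice stable under `nabla`. -/
theorem exists_lattice_functional (h : ∀ i, nabla (g i) ∈ lat g) (h0 : ∃ i, ¬ g i =ᶠ[atTop] 0) :
    ∃ (Λ : (ℤ → ℂ) →ₗ[ℂ] ℂ) (β : ℂ), (∃ i, Λ (g i) ≠ 0) ∧ (∀ u ∈ latZero g, Λ u = 0) ∧
      ∀ u ∈ lat g, Λ (nabla u) = β * Λ u := by
  let P : Submodule ℂ (lat g) := (latZero g).comap (lat g).subtype
  let nb : End ℂ (lat g) := nabla.restrict fun u hu => nabla_mem_lat h hu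
  have hP : P ≤ P.comap nb := fun u hu => nabla_mem_latZero h hu
  let nq : End ℂ (lat g ⧸ P) := P.mapQ P nb hP
  have hspan (u : lat g) : ∃ a : ι → ℂ, (u : ℤ → ℂ) - ∑ i, a i • g i ∈ latZero g := by
    obtain ⟨u, c, c₀, hc, hu⟩ := u
    refine ⟨c₀, mem_latZero_of_eventuallyEq (v := ∑ i, (c i - fun _ => c₀ i) * g i) ?_ ?_⟩
    · filter_upwards [hu] with n hn
      simp [hn, sub_mul, Finset.sum_sub_distrib]
    · exact sum_coeff_mem_latZero
        (fun i => by simpa using (hc i).sub (IsCoeff.const (c₀ i))) self_mem_lat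
  let gq (i : ι) : lat g ⧸ P := P.mkQ ⟨g i, self_mem_lat i⟩
  have hgq : Submodule.span ℂ (Set.range gq) = ⊤ := by
    rw [eq_top_iff]
    rintro x -
    obtain ⟨u, rfl⟩ := P.mkQ_surjective x
    obtain ⟨a, ha⟩ := hspan u
    have : P.mkQ u = ∑ i, a i • gq i := by
      simp only [gq, ← map_smul, ← map_sum]
      rw [← sub_eq_zero, ← map_sub, ← LinearMap.mem_ker, Submodule.ker_mkQ]
      change ((u - ∑ i, a i • (⟨g i, self_mem_lat i⟩ : lat g) : lat g) : ℤ → ℂ) ∈ latZero g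
      simpa using ha
    rw [this]
    exact Submodule.sum_mem _ fun i _ => Submodule.smul_mem _ _ (Submodule.subset_span ⟨i, rfl⟩)
  have hfd : FiniteDimensional ℂ (lat g ⧸ P) :=
    ⟨by rw [← hgq]; exact Submodule.fg_span (Set.finite_range gq)⟩
  have hnt : Nontrivial (lat g ⧸ P) := by
    by_contra hn
    rw [not_nontrivial_iff_subsingleton] at hn
    obtain ⟨i, hi⟩ := h0
    refine hi (eventually_zero_of_mem_latZero (fun j => ?_) i)
    have : gq j = 0 := Subsingleton.elim _ _
    exact (Submodule.Quotient.mk_eq_zero P).1 this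
  obtain ⟨β, hβ⟩ := Module.End.exists_eigenvalue (nq.dualMap : End ℂ (Dual ℂ (lat g ⧸ P)))
  obtain ⟨Λq, hΛ⟩ := hβ.exists_hasEigenvector
  obtain ⟨Λ, hΛ'⟩ := LinearMap.exists_extend (Λq ∘ₗ P.mkQ)
  have hΛu (u : ℤ → ℂ) (hu : u ∈ lat g) : Λ u = Λq (P.mkQ ⟨u, hu⟩) :=
    LinearMap.congr_fun hΛ' ⟨u, hu⟩
  refine ⟨Λ, β, ?_, fun u hu => ?_, fun u hu => ?_⟩
  · by_contra! hc
    refine hΛ.2 (LinearMap.ext_on_range hgq fun i => ?_)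
    rw [LinearMap.zero_apply, ← hc i, hΛu _ (self_mem_lat i)]
  · have : P.mkQ ⟨u, latZero_le_lat hu⟩ = 0 := (Submodule.Quotient.mk_eq_zero P).2 hu
    rw [hΛu u (latZero_le_lat hu), this, map_zero]
  · rw [hΛu u hu, hΛu _ (nabla_mem_lat h hu)]
    exact LinearMap.congr_fun hΛ.apply_eq_smul (P.mkQ ⟨u, hu⟩)

end Lattice

section Casimir
variable {M : Type} [AddCommGroup M] [Module ℂ M] {L : ℤ → End ℂ M}

/-- The Casimir operator of the subalgebra spanned by `L (-1)`, `L 0`, `L 1`. -/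
def casimir (L : ℤ → End ℂ M) : End ℂ M := L (-1) * L 1 - L 0 * L 0 - L 0

/-- A cubic operator commuting with `L 1`. -/
def cubic (L : ℤ → End ℂ M) : End ℂ M :=
  L (-2) * (L 1 * L 1) - L 0 * (L 0 + 1) * (L 0 + 2) - (3 : ℂ) • (L 0 * casimir L)

lemma IsPrimary.apply_swap (hL : IsPrimary L L (-1)) (i j : ℤ) (w : M) :
    L i (L j w) = L j (L i w) + ((j : ℂ) - i) • L (i + j) w := by
  have := LinearMap.congr_fun (hL i j) w
  simp only [LinearMap.sub_apply, Module.End.mul_apply, LinearMap.smul_apply] at this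
  rw [sub_eq_iff_eq_add'] at this
  rw [this]; congr 2; ring

/-- The mirror image of a representation of the Witt algebra. -/
lemma IsPrimary.mirror (hL : IsPrimary L L (-1)) :
    IsPrimary (fun i => -L (-i)) (fun i => -L (-i)) (-1) := by
  intro i j
  have := hL (-i) (-j)
  rw [neg_mul_neg, neg_mul_neg, this, smul_neg, ← neg_smul, neg_add i j]
  push_cast
  congr 1; ring

lemma eigenspace_mirror (L : ℤ → End ℂ M) (μ : ℂ) :
    ((fun i => -L (-i)) 0 : End ℂ M).eigenspace μ = (L 0).eigenspace (-μ) := by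
  ext w
  simp only [Module.End.mem_eigenspace_iff, neg_zero, LinearMap.neg_apply, neg_smul]
  exact neg_eq_iff_eq_neg

lemma IsPrimary.mem_add (hL : IsPrimary L L (-1)) (i : ℤ) {a : ℂ} {w : M}
    (hw : w ∈ (L 0).eigenspace a) {c : ℂ} (h : a + i = c) : L i w ∈ (L 0).eigenspace c :=
  h ▸ hL.map_eigenspace i hw

variable {a : ℂ} {w : M}

lemma casimir_apply (hw : w ∈ (L 0).eigenspace a) :
    casimir L w = L (-1) (L 1 w) - (a ^ 2 + a) • w := by
  rw [Module.End.mem_eigenspace_iff] at hw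
  simp only [casimir, LinearMap.sub_apply, Module.End.mul_apply, hw, map_smul]
  module

lemma lower_raise (hw : w ∈ (L 0).eigenspace a) :
    L (-1) (L 1 w) = casimir L w + (a ^ 2 + a) • w := by
  rw [casimir_apply hw]; module

lemma raise_lower (hL : IsPrimary L L (-1)) (hw : w ∈ (L 0).eigenspace a) :
    L 1 (L (-1) w) = casimir L w + (a ^ 2 - a) • w := by
  rw [casimir_apply hw, hL.apply_swap]
  rw [Module.End.mem_eigenspace_iff] at hw
  rw [add_neg_cancel, hw]; push_cast; module

lemma casimir_mem (hL : IsPrimary L L (-1)) (hw : w ∈ (L 0).eigenspace a) :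
    casimir L w ∈ (L 0).eigenspace a := by
  rw [casimir_apply hw]
  exact sub_mem (hL.mem_add _ (hL.mem_add 1 hw rfl) (by push_cast; ring))
    (Submodule.smul_mem _ _ hw)

lemma casimir_raise (hL : IsPrimary L L (-1)) (hw : w ∈ (L 0).eigenspace a) :
    casimir L (L 1 w) = L 1 (casimir L w) := by
  rw [casimir_apply (hL.mem_add 1 hw rfl), casimir_apply hw, map_sub, map_smul,
    raise_lower hL (hL.mem_add 1 hw rfl), casimir_apply (hL.mem_add 1 hw rfl)]
  push_cast; module

lemma casimir_lower (hL : IsPrimary L L (-1)) (hw : w ∈ (L 0).eigenspace a) :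
    casimir L (L (-1) w) = L (-1) (casimir L w) := by
  rw [casimir_apply (hL.mem_add (-1) hw rfl), raise_lower hL hw, map_add, map_smul]
  push_cast; module

lemma cubic_apply (hL : IsPrimary L L (-1)) (hw : w ∈ (L 0).eigenspace a) :
    cubic L w = L (-2) (L 1 (L 1 w)) - (a * (a + 1) * (a + 2)) • w
      - (3 * a) • casimir L w := by
  have h1 := Module.End.mem_eigenspace_iff.1 (casimir_mem hL hw)
  rw [Module.End.mem_eigenspace_iff] at hw
  have h2 : (2 : End ℂ M) w = (2 : ℂ) • w := by
    rw [← one_add_one_eq_two, LinearMap.add_apply, Module.End.one_apply]; module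
  simp only [cubic, LinearMap.sub_apply, Module.End.mul_apply, LinearMap.add_apply, hw, h1, h2,
    map_smul, map_add, LinearMap.smul_apply, Module.End.one_apply]
  module

lemma lower_raise_two (hL : IsPrimary L L (-1)) (hw : w ∈ (L 0).eigenspace a) :
    L (-2) (L 1 (L 1 w)) = cubic L w + (a * (a + 1) * (a + 2)) • w
      + (3 * a) • casimir L w := by
  rw [cubic_apply hL hw]; module

lemma cubic_mem (hL : IsPrimary L L (-1)) (hw : w ∈ (L 0).eigenspace a) :
    cubic L w ∈ (L 0).eigenspace a := by
  rw [cubic_apply hL hw]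
  refine sub_mem (sub_mem ?_ (Submodule.smul_mem _ _ hw)) (Submodule.smul_mem _ _
    (casimir_mem hL hw))
  exact hL.mem_add _ (hL.mem_add 1 (hL.mem_add 1 hw rfl) rfl) (by push_cast; ring)

lemma cubic_raise (hL : IsPrimary L L (-1)) (hw : w ∈ (L 0).eigenspace a) :
    cubic L (L 1 w) = L 1 (cubic L w) := by
  have h1 := hL.mem_add 1 hw rfl
  rw [cubic_apply hL h1, cubic_apply hL hw, map_sub, map_sub, map_smul, map_smul,
    hL.apply_swap 1 (-2)]
  have e : (1 : ℤ) + -2 = -1 := rfl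
  rw [e, lower_raise h1, casimir_raise hL hw]
  push_cast; module

/-- An operator on a finite-dimensional space has finitely many eigenvalues. -/
lemma finite_eigen (W : Submodule ℂ M) [FiniteDimensional ℂ W] (C : End ℂ M)
    (hC : ∀ w ∈ W, C w ∈ W) {f : ℕ → ℂ} (hf : Function.Injective f) :
    {n | ∃ w ∈ W, w ≠ 0 ∧ C w = f n • w}.Finite := by
  have h := Module.End.finite_hasEigenvalue (C.restrict hC)
  refine (h.preimage hf.injOn).subset ?_
  rintro n ⟨w, hw, h0, hn⟩
  refine Module.End.hasEigenvalue_of_hasEigenvector (x := ⟨w, hw⟩) ⟨?_, ?_⟩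
  · rw [Module.End.mem_eigenspace_iff]; ext; exact hn
  · simpa using h0

lemma exists_forall_not_of_finite {p : ℕ → Prop} (h : {n | p n}.Finite) :
    ∃ K, ∀ n ≥ K, ¬ p n := by
  obtain ⟨K, hK⟩ := h.bddAbove
  exact ⟨K + 1, fun n hn hp => by have := hK hp; omega⟩

lemma injective_quadratic {a : ℂ} (ha : 0 < a.re) (ε : ℂ) (hε : ε = 1 ∨ ε = -1) :
    Function.Injective fun n : ℕ => -((a + n) ^ 2 + ε * (a + n)) := by
  intro n m h
  by_contra hnm
  have h1 : ((n : ℂ) - m) * (2 * a + n + m + ε) = 0 := by linear_combination -h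
  rcases mul_eq_zero.1 h1 with h2 | h2
  · exact hnm (by exact_mod_cast sub_eq_zero.1 h2)
  · have h3 := congrArg Complex.re h2
    have h4 : (1 : ℝ) ≤ n + m := by exact_mod_cast (by omega : 1 ≤ n + m)
    rcases hε with rfl | rfl <;> simp at h3 <;> linarith

lemma exists_injective_raise (hL : IsPrimary L L (-1))
    (hfin : ∀ μ, FiniteDimensional ℂ ((L 0).eigenspace μ)) (ha : 0 < a.re) :
    ∃ K : ℕ, ∀ n ≥ K, ∀ w ∈ (L 0).eigenspace (a + n), L 1 w = 0 → w = 0 := by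
  obtain ⟨K, hK⟩ := exists_forall_not_of_finite (finite_eigen ((L 0).eigenspace a) (casimir L)
    (fun w hw => casimir_mem hL hw) (injective_quadratic ha 1 (Or.inl rfl)))
  refine ⟨K, fun n hn w hw h1 => ?_⟩
  by_contra h0
  have hC : casimir L w = (-((a + n) ^ 2 + 1 * (a + n))) • w := by
    rw [casimir_apply hw, h1, map_zero]; module
  have key (m : ℕ) (hm : m ≤ n) : ∃ u ∈ (L 0).eigenspace (a + ((n - m : ℕ) : ℂ)), u ≠ 0 ∧
      casimir L u = (-((a + n) ^ 2 + 1 * (a + n))) • u := by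
    induction m with
    | zero => exact ⟨w, hw, h0, hC⟩
    | succ m ih =>
      obtain ⟨u, hu, hu0, huC⟩ := ih (by omega)
      obtain ⟨d, hd⟩ : ∃ d, n = m + 1 + d := ⟨n - (m + 1), by omega⟩
      have e1 : n - m = d + 1 := by omega
      have e2 : n - (m + 1) = d := by omega
      rw [e1] at hu
      refine ⟨L (-1) u, hL.mem_add _ hu (by rw [e2]; push_cast; ring), fun hz => hu0 ?_, ?_⟩
      · have := raise_lower hL hu
        rw [hz, map_zero, huC, ← add_smul] at this
        refine (smul_eq_zero.1 this.symm).resolve_left fun hc => ?_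
        have hc' : ((d : ℂ) - n) * (2 * a + d + n + 1) = 0 := by
          push_cast at hc; linear_combination hc
        rcases mul_eq_zero.1 hc' with h2 | h2
        · have : d = n := by exact_mod_cast sub_eq_zero.1 h2
          omega
        · have h3 := congrArg Complex.re h2
          simp at h3
          have : (0 : ℝ) ≤ (d : ℝ) + n := by positivity
          linarith
      · rw [casimir_lower hL hu, huC, map_smul]
  obtain ⟨u, hu, hu0, huC⟩ := key n le_rfl
  rw [Nat.sub_self, Nat.cast_zero, add_zero] at hu
  exact hK n hn ⟨u, hu, hu0, huC⟩

lemma exists_bijective_raise (hL : IsPrimary L L (-1))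
    (hfin : ∀ μ, FiniteDimensional ℂ ((L 0).eigenspace μ)) {N : ℕ}
    (hN : ∀ μ, finrank ℂ ((L 0).eigenspace μ) ≤ N) (ha : 0 < a.re) :
    ∃ K : ℕ, ∀ n ≥ K, (∀ w ∈ (L 0).eigenspace (a + n), L 1 w = 0 → w = 0) ∧
      ∀ w ∈ (L 0).eigenspace (a + n + 1), ∃ u ∈ (L 0).eigenspace (a + n), L 1 u = w := by
  obtain ⟨K, hK⟩ := exists_injective_raise hL hfin ha
  let R (n : ℕ) : (L 0).eigenspace (a + n) →ₗ[ℂ] (L 0).eigenspace (a + n + 1) :=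
    (L 1).restrict fun w hw => hL.mem_add 1 hw (by push_cast; ring)
  have hR (n : ℕ) (hn : K ≤ n) : Function.Injective (R n) := by
    rw [← LinearMap.ker_eq_bot, LinearMap.ker_eq_bot']
    rintro ⟨w, hw⟩ h
    exact Subtype.ext (hK n hn w hw (congrArg Subtype.val h))
  let d (n : ℕ) : ℕ := finrank ℂ ((L 0).eigenspace (a + n))
  have hd1 (n : ℕ) : finrank ℂ ((L 0).eigenspace (a + n + 1)) = d (n + 1) := by
    simp only [d]; rw [Nat.cast_succ, add_assoc]
  have hd (n : ℕ) (hn : K ≤ n) : d n ≤ d (n + 1) := by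
    rw [← hd1]
    exact LinearMap.finrank_le_finrank_of_injective (hR n hn)
  have hmono (n m : ℕ) (hn : K ≤ n) (hm : n ≤ m) : d n ≤ d m :=
    Nat.le_induction le_rfl (fun m hm ih => ih.trans (hd m (hn.trans hm))) m hm
  have hS : BddAbove (d '' Set.Ici K) := ⟨N, by rintro _ ⟨n, -, rfl⟩; exact hN _⟩
  obtain ⟨K', hK', hmax⟩ := Nat.sSup_mem ((Set.nonempty_Ici (a := K)).image d) hS
  refine ⟨K', fun n hn => ⟨hK n (le_trans hK' hn), fun w hw => ?_⟩⟩
  have hKn : K ≤ n := le_trans hK' hn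
  have e : d n = d (n + 1) := by
    have h1 := hmono K' n hK' hn
    have h2 := le_csSup hS ⟨n + 1, by simp; omega, rfl⟩
    have h3 := hd n hKn
    omega
  have hsurj := (LinearMap.injective_iff_surjective_of_finrank_eq_finrank
    (e.trans (hd1 n).symm)).1 (hR n hKn)
  obtain ⟨⟨u, hu⟩, h⟩ := hsurj ⟨w, hw⟩
  exact ⟨u, hu, congrArg Subtype.val h⟩

lemma exists_injective_lower (hL : IsPrimary L L (-1))
    (hfin : ∀ μ, FiniteDimensional ℂ ((L 0).eigenspace μ)) {N : ℕ}
    (hN : ∀ μ, finrank ℂ ((L 0).eigenspace μ) ≤ N) (ha : 0 < a.re) :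
    ∃ K : ℕ, ∀ n ≥ K, ∀ w ∈ (L 0).eigenspace (a + n), L (-1) w = 0 → w = 0 := by
  obtain ⟨K', hb⟩ := exists_bijective_raise hL hfin hN ha
  obtain ⟨K, hK⟩ := exists_forall_not_of_finite (finite_eigen ((L 0).eigenspace (a + K'))
    (casimir L) (fun w hw => casimir_mem hL hw) (injective_quadratic ha (-1) (Or.inr rfl)))
  refine ⟨K + K', fun n hn w hw h1 => ?_⟩
  by_contra h0
  have hC : casimir L w = (-((a + n) ^ 2 + -1 * (a + n))) • w := by
    have := raise_lower hL hw
    rw [h1, map_zero, eq_comm, add_eq_zero_iff_eq_neg] at this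
    rw [this]; module
  have key (m : ℕ) (hm : m + K' ≤ n) : ∃ u ∈ (L 0).eigenspace (a + ((n - m : ℕ) : ℂ)), u ≠ 0 ∧
      casimir L u = (-((a + n) ^ 2 + -1 * (a + n))) • u := by
    induction m with
    | zero => exact ⟨w, hw, h0, hC⟩
    | succ m ih =>
      obtain ⟨u, hu, hu0, huC⟩ := ih (by omega)
      obtain ⟨d, hd⟩ : ∃ d, n = m + 1 + d := ⟨n - (m + 1), by omega⟩
      have e1 : n - m = d + 1 := by omega
      have e2 : n - (m + 1) = d := by omega
      rw [e1, Nat.cast_succ, ← add_assoc] at hu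
      obtain ⟨hi, hs⟩ := hb d (by omega)
      obtain ⟨v, hv, rfl⟩ := hs u hu
      rw [e2]
      refine ⟨v, hv, fun h => hu0 (by rw [h, map_zero]), ?_⟩
      rw [← sub_eq_zero]
      refine hi _ (sub_mem (casimir_mem hL hv) (Submodule.smul_mem _ _ hv)) ?_
      rw [map_sub, ← casimir_raise hL hv, huC, map_smul, sub_self]
  obtain ⟨u, hu, hu0, huC⟩ := key (n - K') (by omega)
  have e : n - (n - K') = K' := by omega
  rw [e] at hu
  exact hK n (by omega) ⟨u, hu, hu0, huC⟩

/-- The weights `lam + k` with `0 ≤ k`, and those with `k ≤ -K`, are in the stable range. -/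
structure IsStable (L : ℤ → End ℂ M) (lam : ℂ) (K : ℤ) : Prop where
  raise_inj : ∀ k : ℤ, 0 ≤ k → ∀ w ∈ (L 0).eigenspace (lam + k), L 1 w = 0 → w = 0
  raise_surj : ∀ k : ℤ, 0 ≤ k → ∀ w ∈ (L 0).eigenspace (lam + (k + 1 : ℤ)),
    ∃ u ∈ (L 0).eigenspace (lam + k), L 1 u = w
  lower_inj : ∀ k : ℤ, 0 ≤ k → ∀ w ∈ (L 0).eigenspace (lam + k), L (-1) w = 0 → w = 0
  raise_inj_neg : ∀ k : ℤ, k ≤ -K → ∀ w ∈ (L 0).eigenspace (lam + k), L 1 w = 0 → w = 0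

theorem exists_isStable (hL : IsPrimary L L (-1))
    (hfin : ∀ μ, FiniteDimensional ℂ ((L 0).eigenspace μ)) {N : ℕ}
    (hN : ∀ μ, finrank ℂ ((L 0).eigenspace μ) ≤ N) (lam : ℂ) :
    ∃ (t : ℕ) (K : ℕ), IsStable L (lam + t) K := by
  obtain ⟨t₀, ht₀⟩ := exists_nat_gt (-lam.re)
  have ha : 0 < (lam + t₀).re := by simp; linarith
  obtain ⟨K₁, h₁⟩ := exists_bijective_raise hL hfin hN ha
  obtain ⟨K₂, h₂⟩ := exists_injective_lower hL hfin hN ha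
  obtain ⟨s₀, hs₀⟩ := exists_nat_gt (lam.re)
  have hb : 0 < (-lam + s₀).re := by simp; linarith
  obtain ⟨K₃, h₃⟩ := exists_injective_lower hL.mirror (fun μ => by
    rw [eigenspace_mirror]; exact hfin _) (fun μ => by rw [eigenspace_mirror]; exact hN _) hb
  have up (k : ℤ) (hk : 0 ≤ k) : ∃ n : ℕ, K₁ ≤ n ∧ K₂ ≤ n ∧
      (lam + (t₀ + K₁ + K₂ : ℕ) + k : ℂ) = lam + t₀ + n := by
    lift k to ℕ using hk
    exact ⟨K₁ + K₂ + k, by omega, by omega, by push_cast; ring⟩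
  refine ⟨t₀ + K₁ + K₂, t₀ + K₁ + K₂ + s₀ + K₃, ?_, ?_, ?_, ?_⟩
  · intro k hk
    obtain ⟨n, hn, -, e⟩ := up k hk
    rw [e]; exact (h₁ n hn).1
  · intro k hk
    obtain ⟨n, hn, -, e⟩ := up k hk
    rw [Int.cast_add, ← add_assoc, e, Int.cast_one]; exact (h₁ n hn).2
  · intro k hk
    obtain ⟨n, -, hn, e⟩ := up k hk
    rw [e]; exact h₂ n hn
  · intro k hk w hw h1
    obtain ⟨n, hn, e⟩ : ∃ n : ℕ, K₃ ≤ n ∧ k = -(t₀ + K₁ + K₂ + s₀ + n : ℕ) :=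
      ⟨(-k - (t₀ + K₁ + K₂ + s₀ : ℕ)).toNat, by omega, by omega⟩
    refine h₃ n hn w ?_ ?_
    · rw [eigenspace_mirror]
      convert hw using 2
      rw [e]; push_cast; ring
    · simp [h1]

end Casimir

section Words
open Filter Topology
variable {M : Type} [AddCommGroup M] [Module ℂ M] {L : ℤ → End ℂ M} {lam : ℂ} {m : M}

lemma IsCoeff.ratio (p q u : ℂ) : IsCoeff (fun n => (p * n + q) * ((n : ℂ) + u)⁻¹) p := by
  refine (show IsCoeff _ _ by
    simpa using (const p).add ((inv_add u).smul (q - p * u))).congr ?_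
  filter_upwards [eventually_add_ne_zero u] with n hn
  simp; field_simp; ring

lemma IsCoeff.ratio_two (p q s u v : ℂ) : IsCoeff
    (fun n => (p * n ^ 2 + q * n + s) * (((n : ℂ) + u)⁻¹ * ((n : ℂ) + v)⁻¹)) p := by
  refine (show IsCoeff _ _ by
    simpa using (((ratio 1 0 u).mul (ratio 1 0 v)).smul p).add
      (((ratio 1 0 u).mul (ratio 0 q v)).add ((ratio 0 s u).mul (inv_add v)))).congr ?_
  filter_upwards with n
  simp; ring

lemma pow_raise_succ (r : ℕ) (m : M) : (L 1 ^ (r + 1)) m = L 1 ((L 1 ^ r) m) := by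
  rw [pow_succ', Module.End.mul_apply]

lemma pow_raise_mem (hL : IsPrimary L L (-1)) (hm : m ∈ (L 0).eigenspace lam) (r : ℕ) :
    (L 1 ^ r) m ∈ (L 0).eigenspace (lam + r) := by
  induction r with
  | zero => simpa using hm
  | succ r ih => rw [pow_raise_succ]; exact hL.mem_add 1 ih (by push_cast; ring)

lemma casimir_pow (hL : IsPrimary L L (-1)) (hm : m ∈ (L 0).eigenspace lam) (r : ℕ) :
    casimir L ((L 1 ^ r) m) = (L 1 ^ r) (casimir L m) := by
  induction r with
  | zero => simp
  | succ r ih => rw [pow_raise_succ, casimir_raise hL (pow_raise_mem hL hm r), ih, pow_raise_succ]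

lemma cubic_pow (hL : IsPrimary L L (-1)) (hm : m ∈ (L 0).eigenspace lam) (r : ℕ) :
    cubic L ((L 1 ^ r) m) = (L 1 ^ r) (cubic L m) := by
  induction r with
  | zero => simp
  | succ r ih => rw [pow_raise_succ, cubic_raise hL (pow_raise_mem hL hm r), ih, pow_raise_succ]

/-- The vector `L (-n) (L 1) ^ r m / r!`. -/
def word (L : ℤ → End ℂ M) (n : ℤ) (r : ℕ) (m : M) : M :=
  ((r.factorial : ℂ))⁻¹ • L (-n) ((L 1 ^ r) m)

lemma word_mem (hL : IsPrimary L L (-1)) (hm : m ∈ (L 0).eigenspace lam) (n : ℤ) (r : ℕ) :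
    word L n r m ∈ (L 0).eigenspace (lam + (r - n : ℤ)) :=
  Submodule.smul_mem _ _ (hL.mem_add _ (pow_raise_mem hL hm r) (by push_cast; ring))

lemma inv_factorial_succ (r : ℕ) :
    (((r + 1).factorial : ℕ) : ℂ)⁻¹ = ((r : ℂ) + 1)⁻¹ * (r.factorial : ℂ)⁻¹ := by
  rw [Nat.factorial_succ]; push_cast; rw [mul_inv]

lemma lower_word (hL : IsPrimary L L (-1)) (hm : m ∈ (L 0).eigenspace lam) (n : ℤ) (r : ℕ) :
    L (-1) (word L n (r + 1) m) = ((r : ℂ) + 1)⁻¹ • (word L n r (casimir L m)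
      + ((lam + r) ^ 2 + (lam + r)) • word L n r m)
      - ((n : ℂ) - 1) • word L (n + 1) (r + 1) m := by
  have e : (-1 : ℤ) + -n = -(n + 1) := by ring
  simp only [word, pow_raise_succ, map_smul, inv_factorial_succ]
  rw [hL.apply_swap (-1) (-n), lower_raise (pow_raise_mem hL hm r), casimir_pow hL hm, map_add,
    map_smul, e]
  push_cast; module

lemma raise_word (hL : IsPrimary L L (-1)) (n : ℤ) (r : ℕ) :
    L 1 (word L (n + 1) r m) = ((r : ℂ) + 1) • word L (n + 1) (r + 1) m
      - ((n : ℂ) + 2) • word L n r m := by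
  have e : (1 : ℤ) + -(n + 1) = -n := by ring
  have hr : (r : ℂ) + 1 ≠ 0 := by exact_mod_cast r.succ_ne_zero
  simp only [word, pow_raise_succ, map_smul, inv_factorial_succ]
  rw [hL.apply_swap 1 (-(n + 1)), e, smul_smul, mul_inv_cancel_left₀ hr]
  push_cast; module

lemma lower_two_word (hL : IsPrimary L L (-1)) (hm : m ∈ (L 0).eigenspace lam) (n : ℤ) (r : ℕ) :
    L (-2) (word L n (r + 2) m) = (((r : ℂ) + 1)⁻¹ * ((r : ℂ) + 2)⁻¹) • (word L n r (cubic L m)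
      + ((lam + r) * (lam + r + 1) * (lam + r + 2)) • word L n r m
      + (3 * (lam + r)) • word L n r (casimir L m))
      - ((n : ℂ) - 2) • word L (n + 2) (r + 2) m := by
  have e : (-2 : ℤ) + -n = -(n + 2) := by ring
  have e2 : ((r + 1 : ℕ) : ℂ) + 1 = (r : ℂ) + 2 := by push_cast; ring
  simp only [word, pow_raise_succ, map_smul, inv_factorial_succ, e2]
  rw [hL.apply_swap (-2) (-n), lower_raise_two hL (pow_raise_mem hL hm r), casimir_pow hL hm,
    cubic_pow hL hm, map_add, map_add, map_smul, map_smul, e]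
  push_cast; module

/-- Matrix coefficients of the vectors `word L n r m` of weight `lam + k`. -/
def coeffSeq (L : ℤ → End ℂ M) (y : Dual ℂ M) (m : M) (k n : ℤ) : ℂ :=
  y (word L n (k + n).toNat m)

lemma eventually_toNat (k : ℤ) : ∀ᶠ n : ℤ in atTop, ∃ r : ℕ, k + n = r := by
  filter_upwards [eventually_ge_atTop (-k)] with n hn
  exact ⟨(k + n).toNat, by omega⟩

lemma coeffSeq_eq {y : Dual ℂ M} {k n : ℤ} {r : ℕ} (h : k + n = r) :
    coeffSeq L y m k n = y (word L n r m) := by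
  rw [coeffSeq, h, Int.toNat_natCast]

lemma coeffSeq_raise (hL : IsPrimary L L (-1)) (y : Dual ℂ M) (m : M) (k : ℤ) :
    shiftEnd (coeffSeq L (y ∘ₗ L 1) m (k - 1)) =ᶠ[atTop]
      ((k : ℂ) - 1) • coeffSeq L y m k
        + (fun n : ℤ => ((n : ℂ) + (k + 1)) * (n : ℂ)⁻¹) * nabla (coeffSeq L y m k) := by
  filter_upwards [eventually_toNat k, eventually_add_ne_zero 0] with n ⟨r, hr⟩ hn
  rw [add_zero] at hn
  have hc : (r : ℂ) = k + n := by exact_mod_cast hr.symm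
  have e1 : k - 1 + (n + 1) = r := by omega
  have e2 : k + (n + 1) = (r + 1 : ℕ) := by push_cast; omega
  simp only [shiftEnd_apply, Pi.add_apply, Pi.mul_apply, Pi.smul_apply, nabla_apply,
    coeffSeq_eq hr, coeffSeq_eq e1, coeffSeq_eq e2, LinearMap.comp_apply, raise_word hL,
    map_sub, map_smul, smul_eq_mul]
  rw [hc]
  field_simp; ring

lemma coeffSeq_lower (hL : IsPrimary L L (-1)) (hm : m ∈ (L 0).eigenspace lam)
    (y : Dual ℂ M) (k : ℤ) :
    coeffSeq L (y ∘ₗ L (-1)) m (k + 1) =ᶠ[atTop]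
      (fun n : ℤ => ((n : ℂ) + (k + 1))⁻¹) * coeffSeq L y (casimir L m) k
      + (fun n : ℤ => ((2 * (lam + k) + 1 - k) * n + ((lam + k) * (lam + k + 1) + k + 1))
          * ((n : ℂ) + (k + 1))⁻¹) * coeffSeq L y m k
      - (fun n : ℤ => ((n : ℂ) + (-1)) * (n : ℂ)⁻¹) * nabla (coeffSeq L y m k) := by
  filter_upwards [eventually_toNat k, eventually_add_ne_zero 0, eventually_add_ne_zero (k + 1)]
    with n ⟨r, hr⟩ hn hn'
  rw [add_zero] at hn
  have hc : (r : ℂ) = k + n := by exact_mod_cast hr.symm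
  have e1 : k + 1 + n = (r + 1 : ℕ) := by push_cast; omega
  have e2 : k + (n + 1) = (r + 1 : ℕ) := by push_cast; omega
  simp only [Pi.add_apply, Pi.sub_apply, Pi.mul_apply, nabla_apply,
    coeffSeq_eq hr, coeffSeq_eq e1, coeffSeq_eq e2, LinearMap.comp_apply, lower_word hL hm,
    map_sub, map_add, map_smul, smul_eq_mul]
  rw [hc, show (k : ℂ) + n + 1 = n + (k + 1) by ring]
  field_simp; ring

lemma coeffSeq_lower_two (hL : IsPrimary L L (-1)) (hm : m ∈ (L 0).eigenspace lam)
    (y : Dual ℂ M) (k : ℤ) :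
    ∃ q s : ℂ, coeffSeq L (y ∘ₗ L (-2)) m (k + 2) =ᶠ[atTop]
      (fun n : ℤ => (0 * (n : ℂ) ^ 2 + 0 * n + 1) * (((n : ℂ) + (k + 1))⁻¹ * ((n : ℂ) + (k + 2))⁻¹))
        * coeffSeq L y (cubic L m) k
      + (fun n : ℤ => (0 * (n : ℂ) ^ 2 + 3 * n + 3 * (lam + k))
        * (((n : ℂ) + (k + 1))⁻¹ * ((n : ℂ) + (k + 2))⁻¹)) * coeffSeq L y (casimir L m) k
      + (fun n : ℤ => ((3 * (lam + k) - 2 * k + 2) * (n : ℂ) ^ 2 + q * n + s)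
          * (((n : ℂ) + (k + 1))⁻¹ * ((n : ℂ) + (k + 2))⁻¹)) * coeffSeq L y m k
      - (fun n : ℤ => ((n : ℂ) + (-2)) * (n : ℂ)⁻¹) * nabla (coeffSeq L y m k)
      - (fun n : ℤ => (1 * (n : ℂ) + (-2)) * ((n : ℂ) + 1)⁻¹)
        * shiftEnd (nabla (coeffSeq L y m k)) := by
  refine ⟨3 * (lam + k) ^ 2 + 6 * (lam + k) + 2 - ((k + 1) * (k + 2) - 2 * (2 * k + 3)),
    (lam + k) * (lam + k + 1) * (lam + k + 2) + 2 * (k + 1) * (k + 2), ?_⟩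
  filter_upwards [eventually_toNat k, eventually_add_ne_zero 0, eventually_add_ne_zero (k + 1),
    eventually_add_ne_zero (k + 2), eventually_add_ne_zero 1] with n ⟨r, hr⟩ hn hn1 hn2 hn3
  rw [add_zero] at hn
  have hc : (r : ℂ) = k + n := by exact_mod_cast hr.symm
  have e1 : k + 2 + n = (r + 2 : ℕ) := by push_cast; omega
  have e2 : k + (n + 1) = (r + 1 : ℕ) := by push_cast; omega
  have e3 : k + (n + 2) = (r + 2 : ℕ) := by push_cast; omega
  have e4 : n + 1 + 1 = n + 2 := by ring
  simp only [Pi.add_apply, Pi.sub_apply, Pi.mul_apply, nabla_apply, shiftEnd_apply,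
    coeffSeq_eq hr, coeffSeq_eq e1, coeffSeq_eq e2, coeffSeq_eq e3, LinearMap.comp_apply,
    lower_two_word hL hm, map_sub, map_add, map_smul, smul_eq_mul, e4]
  rw [hc, show (k : ℂ) + n + 1 = n + (k + 1) by ring, show (k : ℂ) + n + 2 = n + (k + 2) by ring]
  push_cast
  field_simp; ring

end Words

section Limit
open Filter Topology
variable {M : Type} [AddCommGroup M] [Module ℂ M] {L : ℤ → End ℂ M} {lam : ℂ} {m : M}

lemma exists_coords (W : Submodule ℂ M) [FiniteDimensional ℂ W] :
    ∃ (b : Fin (finrank ℂ W) → M) (Y : Fin (finrank ℂ W) → Dual ℂ M), (∀ i, b i ∈ W) ∧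
      ∀ u ∈ W, ∑ i, Y i u • b i = u := by
  let b := finBasis ℂ W
  have h (i) := LinearMap.exists_extend (b.coord i)
  choose Y hY using h
  refine ⟨fun i => b i, Y, fun i => (b i).2, fun u hu => ?_⟩
  have h1 := congrArg Subtype.val (b.sum_repr ⟨u, hu⟩)
  simp only [Submodule.coe_sum, Submodule.coe_smul] at h1
  rw [← h1]
  refine Finset.sum_congr rfl fun i _ => ?_
  rw [h1]
  exact congrArg (· • (b i : M)) (LinearMap.congr_fun (hY i) ⟨u, hu⟩)

/-- A functional on a subspace on which `f` is injective factors through `f`. -/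
lemma exists_dual_comp (W : Submodule ℂ M) (f : End ℂ M) (hf : ∀ w ∈ W, f w = 0 → w = 0)
    (y : Dual ℂ M) : ∃ y' : Dual ℂ M, ∀ w ∈ W, y' (f w) = y w := by
  obtain ⟨g, hg⟩ := (f ∘ₗ W.subtype).exists_leftInverse_of_injective
    (LinearMap.ker_eq_bot'.2 fun w hw => Subtype.ext (hf w w.2 hw))
  exact ⟨y ∘ₗ W.subtype ∘ₗ g, fun w hw =>
    congrArg (fun z : W => y z) (LinearMap.congr_fun hg ⟨w, hw⟩)⟩

lemma word_sum {ι : Type*} (s : Finset ι) (a : ι → ℂ) (e : ι → M) (n : ℤ) (r : ℕ) :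
    word L n r (∑ j ∈ s, a j • e j) = ∑ j ∈ s, a j • word L n r (e j) := by
  simp only [word, map_sum, map_smul, Finset.smul_sum]
  exact Finset.sum_congr rfl fun j _ => smul_comm _ _ _

lemma word_mem_of_eq (hL : IsPrimary L L (-1)) (hm : m ∈ (L 0).eigenspace lam) {k n : ℤ} {r : ℕ}
    (h : k + n = r) : word L n r m ∈ (L 0).eigenspace (lam + k) := by
  have := word_mem hL hm n r
  rwa [← h, add_sub_cancel_right] at this

/-- The coefficient sequences depend only on the restriction of the functional to a weight
space. -/
lemma coeffSeq_congr (hL : IsPrimary L L (-1)) (hm : m ∈ (L 0).eigenspace lam) {k : ℤ}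
    {y y' : Dual ℂ M} (h : ∀ w ∈ (L 0).eigenspace (lam + k), y w = y' w) :
    coeffSeq L y m k =ᶠ[atTop] coeffSeq L y' m k := by
  filter_upwards [eventually_toNat k] with n ⟨r, hr⟩
  rw [coeffSeq_eq hr, coeffSeq_eq hr, h _ (word_mem_of_eq hL hm hr)]

lemma coeffSeq_expand (hL : IsPrimary L L (-1)) {k : ℤ} {ι κ : Type} [Fintype ι] [Fintype κ]
    {b : ι → M} {Y : ι → Dual ℂ M} (hY : ∀ u ∈ (L 0).eigenspace (lam + k), ∑ i, Y i u • b i = u)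
    {e : κ → M} {Z : κ → Dual ℂ M} (he : ∀ j, e j ∈ (L 0).eigenspace lam)
    (hZ : ∀ u ∈ (L 0).eigenspace lam, ∑ j, Z j u • e j = u) (hm : m ∈ (L 0).eigenspace lam)
    (y : Dual ℂ M) :
    coeffSeq L y m k =ᶠ[atTop]
      ∑ i, ∑ j, (y (b i) * Z j m) • coeffSeq L (Y i) (e j) k := by
  filter_upwards [eventually_toNat k] with n ⟨r, hr⟩
  simp only [Finset.sum_apply, Pi.smul_apply, coeffSeq_eq hr, smul_eq_mul]
  conv_lhs => rw [← hZ m hm, word_sum, map_sum]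
  rw [Finset.sum_comm]
  refine Finset.sum_congr rfl fun j _ => ?_
  conv_lhs => rw [← hY _ (word_mem_of_eq hL (he j) hr), map_smul, map_sum, smul_eq_mul,
    Finset.mul_sum]
  refine Finset.sum_congr rfl fun i _ => ?_
  rw [map_smul, smul_eq_mul]; ring

variable {ι : Type} [Fintype ι] {g : ι → ℤ → ℂ}

/-- A weight all of whose coefficient sequences lie in the lattice. -/
def InLat (L : ℤ → End ℂ M) (lam : ℂ) (g : ι → ℤ → ℂ) (k : ℤ) : Prop :=
  ∀ y, ∀ m ∈ (L 0).eigenspace lam, coeffSeq L y m k ∈ lat g ∧ nabla (coeffSeq L y m k) ∈ lat g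

lemma InLat.shift_mem {k : ℤ} (h : InLat L lam g k) (y : Dual ℂ M)
    (hm : m ∈ (L 0).eigenspace lam) : shiftEnd (coeffSeq L y m k) ∈ lat g :=
  shiftEnd_mem_lat (h y m hm).1 (h y m hm).2

lemma InLat.shift_raise_mem (hL : IsPrimary L L (-1)) {k : ℤ} (h : InLat L lam g k)
    (y : Dual ℂ M) (hm : m ∈ (L 0).eigenspace lam) :
    shiftEnd (coeffSeq L (y ∘ₗ L 1) m (k - 1)) ∈ lat g :=
  mem_lat_of_eventuallyEq (coeffSeq_raise hL y m k) <|
    add_mem (Submodule.smul_mem _ _ (h y m hm).1)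
      (coeff_mul_mem_lat (IsCoeff.add_div _) (h y m hm).2)

lemma InLat.lower_mem (hL : IsPrimary L L (-1)) {k : ℤ} (h : InLat L lam g k)
    (y : Dual ℂ M) (hm : m ∈ (L 0).eigenspace lam) :
    coeffSeq L (y ∘ₗ L (-1)) m (k + 1) ∈ lat g :=
  mem_lat_of_eventuallyEq (coeffSeq_lower hL hm y k) <|
    sub_mem (add_mem (coeff_mul_mem_lat (IsCoeff.inv_add _) (h y _ (casimir_mem hL hm)).1)
      (coeff_mul_mem_lat (IsCoeff.ratio _ _ _) (h y m hm).1))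
      (coeff_mul_mem_lat (IsCoeff.add_div _) (h y m hm).2)

lemma shiftEnd_congr {u v : ℤ → ℂ} (h : u =ᶠ[atTop] v) : shiftEnd u =ᶠ[atTop] shiftEnd v :=
  (tendsto_atTop_add_const_right atTop (1 : ℤ) tendsto_id).eventually h

lemma shiftEnd_mul (c u : ℤ → ℂ) : shiftEnd (c * u) = (fun n => c (n + 1)) * shiftEnd u := rfl

lemma nabla_shiftEnd (u : ℤ → ℂ) :
    nabla (shiftEnd u) =ᶠ[atTop] (fun n : ℤ => (1 * (n : ℂ) + 0) * ((n : ℂ) + 1)⁻¹) *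
      shiftEnd (nabla u) := by
  filter_upwards [eventually_add_ne_zero 1] with n hn
  simp only [nabla_apply, shiftEnd_apply, Pi.mul_apply]
  push_cast
  field_simp; ring

/-- Second differences of coefficient sequences stay in the lattice. -/
lemma InLat.nabla_nabla_mem (hL : IsPrimary L L (-1)) {k : ℤ} (h : InLat L lam g k)
    (y : Dual ℂ M) (hm : m ∈ (L 0).eigenspace lam) :
    nabla (nabla (coeffSeq L y m k)) ∈ lat g := by
  set e := coeffSeq L y m k
  set f := coeffSeq L (y ∘ₗ L 1) m (k - 1) with hf
  have h1 := h.shift_raise_mem hL y hm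
  rw [← hf] at h1
  have hSf := coeffSeq_raise hL y m k
  have hlow := shiftEnd_congr (coeffSeq_lower hL hm (y ∘ₗ L 1) (k - 1))
  rw [sub_add_cancel, map_sub, map_add, shiftEnd_mul, shiftEnd_mul, shiftEnd_mul, ← hf] at hlow
  have h2 : (fun n : ℤ => (((n + 1 : ℤ) : ℂ) + (-1)) * ((n + 1 : ℤ) : ℂ)⁻¹) *
      shiftEnd (nabla f) ∈ lat g := by
    have h3 := add_mem (coeff_mul_mem_lat ((IsCoeff.inv_add (((k - 1 : ℤ) : ℂ) + 1)).shift 1)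
        (h.shift_raise_mem hL y (casimir_mem hL hm)))
      (coeff_mul_mem_lat ((IsCoeff.ratio
        (2 * (lam + (k - 1 : ℤ)) + 1 - (k - 1 : ℤ))
        ((lam + (k - 1 : ℤ)) * (lam + (k - 1 : ℤ) + 1) + (k - 1 : ℤ) + 1)
        (((k - 1 : ℤ) : ℂ) + 1)).shift 1) h1)
    refine mem_lat_of_eventuallyEq ?_
      (sub_mem h3 (h.shift_mem ((y ∘ₗ L 1) ∘ₗ L (-1)) hm))
    filter_upwards [hlow] with n hn
    rw [Pi.sub_apply, hn]
    simp only [Pi.add_apply, Pi.sub_apply]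
    ring
  have h4 : nabla (shiftEnd f) ∈ lat g := by
    refine mem_lat_of_eventuallyEq ?_ h2
    filter_upwards [nabla_shiftEnd f] with n hn
    rw [hn]
    simp
  have h5 : nabla (shiftEnd f) =ᶠ[atTop] _ := nabla_congr hSf
  rw [map_add, map_smul, nabla_mul] at h5
  have hc : IsCoeff (fun n : ℤ => ((n : ℂ) + (k + 1)) * (n : ℂ)⁻¹) 1 := IsCoeff.add_div _
  obtain ⟨d, hd1, hd2⟩ : ∃ d : ℤ → ℂ, IsCoeff d 1⁻¹ ∧
      d * (fun n : ℤ => (((n + 1 : ℤ) : ℂ) + (k + 1)) * ((n + 1 : ℤ) : ℂ)⁻¹) =ᶠ[atTop] 1 := by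
    refine ⟨_, (hc.shift 1).inv one_ne_zero, ?_⟩
    filter_upwards [eventually_add_ne_zero (k + 2), eventually_add_ne_zero 1] with n hn hn'
    have : ((n + 1 : ℤ) : ℂ) + (k + 1) ≠ 0 := by push_cast; rwa [add_assoc,
      show (1 : ℂ) + (k + 1) = k + 2 by ring]
    have h' : ((n + 1 : ℤ) : ℂ) ≠ 0 := by push_cast; exact hn'
    exact inv_mul_cancel₀ (mul_ne_zero this (inv_ne_zero h'))
  refine mem_lat_of_eventuallyEq ?_ (coeff_mul_mem_lat hd1
    (sub_mem (sub_mem h4 (Submodule.smul_mem _ ((k : ℂ) - 1) (h y m hm).2))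
      (coeff_mul_mem_lat hc.nabla (h y m hm).2)))
  filter_upwards [h5, hd2] with n hn hdn
  simp only [Pi.mul_apply, Pi.add_apply, Pi.sub_apply, Pi.smul_apply, smul_eq_mul,
    Pi.one_apply] at hn hdn ⊢
  rw [hn]
  linear_combination (-nabla (nabla e) n) * hdn

lemma inLat_succ (hL : IsPrimary L L (-1)) (hg : ∀ i, nabla (g i) ∈ lat g) {k : ℤ}
    (h : InLat L lam g k)
    (hi : ∀ w ∈ (L 0).eigenspace (lam + (k + 1 : ℤ)), L (-1) w = 0 → w = 0) :
    InLat L lam g (k + 1) := by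
  intro y m hm
  obtain ⟨y', hy'⟩ := exists_dual_comp _ _ hi y
  have : coeffSeq L y m (k + 1) ∈ lat g :=
    mem_lat_of_eventuallyEq (coeffSeq_congr hL hm fun w hw => (hy' w hw).symm)
      (h.lower_mem hL y' hm)
  exact ⟨this, nabla_mem_lat hg this⟩

lemma inLat_pred (hL : IsPrimary L L (-1)) (hg : ∀ i, nabla (g i) ∈ lat g) {k : ℤ}
    (h : InLat L lam g k)
    (hi : ∀ w ∈ (L 0).eigenspace (lam + (k - 1 : ℤ)), L 1 w = 0 → w = 0) :
    InLat L lam g (k - 1) := by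
  intro y m hm
  obtain ⟨y', hy'⟩ := exists_dual_comp _ _ hi y
  have : coeffSeq L y m (k - 1) ∈ lat g :=
    mem_lat_of_eventuallyEq (coeffSeq_congr hL hm fun w hw => (hy' w hw).symm)
      (mem_lat_of_shiftEnd_mem_lat hg (h.shift_raise_mem hL y' hm))
  exact ⟨this, nabla_mem_lat hg this⟩

/-- All coefficient sequences lie in one lattice. -/
lemma exists_lattice (hL : IsPrimary L L (-1))
    (hfin : ∀ μ, FiniteDimensional ℂ ((L 0).eigenspace μ)) {K : ℕ} (hs : IsStable L lam K) :
    ∃ (ι : Type) (_ : Fintype ι) (g : ι → ℤ → ℂ), (∀ i, nabla (g i) ∈ lat g) ∧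
      (∀ i, ∃ y, ∃ m ∈ (L 0).eigenspace lam, ∃ k,
        g i = coeffSeq L y m k ∨ g i = nabla (coeffSeq L y m k)) ∧
      ∀ k, InLat L lam g k := by
  choose b Y hb hY using fun k : ℤ => exists_coords ((L 0).eigenspace (lam + k))
  obtain ⟨e, Z, he, hZ⟩ := exists_coords ((L 0).eigenspace lam)
  let ι := Bool × (Σ k : Finset.Icc (-K : ℤ) K,
    Fin (finrank ℂ ((L 0).eigenspace (lam + (k : ℤ))))) × Fin (finrank ℂ ((L 0).eigenspace lam))
  let g : ι → ℤ → ℂ := fun p =>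
    if p.1 then nabla (coeffSeq L (Y p.2.1.1 p.2.1.2) (e p.2.2) p.2.1.1)
    else coeffSeq L (Y p.2.1.1 p.2.1.2) (e p.2.2) p.2.1.1
  have hbase (k : ℤ) (hk : k ∈ Finset.Icc (-K : ℤ) K) : InLat L lam g k := by
    intro y m hm
    have hexp := coeffSeq_expand hL (hY k) he hZ hm y
    constructor
    · refine mem_lat_of_eventuallyEq hexp (Submodule.sum_mem _ fun i _ => Submodule.sum_mem _
        fun j _ => Submodule.smul_mem _ _ ?_)
      exact self_mem_lat (g := g) (false, ⟨⟨k, hk⟩, i⟩, j)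
    · refine mem_lat_of_eventuallyEq (nabla_congr hexp) ?_
      rw [map_sum]
      refine Submodule.sum_mem _ fun i _ => ?_
      rw [map_sum]
      refine Submodule.sum_mem _ fun j _ => ?_
      rw [map_smul]
      exact Submodule.smul_mem _ _ (self_mem_lat (g := g) (true, ⟨⟨k, hk⟩, i⟩, j))
  have hg (i : ι) : nabla (g i) ∈ lat g := by
    obtain ⟨_ | _, ⟨⟨k, hk⟩, i⟩, j⟩ := i
    · exact (hbase k hk _ _ (he j)).2
    · exact (hbase k hk).nabla_nabla_mem hL _ (he j)
  refine ⟨ι, inferInstance, g, hg, fun i => ?_, fun k => ?_⟩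
  · obtain ⟨_ | _, ⟨k, i⟩, j⟩ := i
    · exact ⟨_, _, he j, _, Or.inl rfl⟩
    · exact ⟨_, _, he j, _, Or.inr rfl⟩
  · have h0 : InLat L lam g 0 := hbase 0 (by simp)
    have hK : InLat L lam g (-K) := hbase (-K) (by simp)
    rcases le_or_gt (-K : ℤ) k with hk | hk
    · rcases le_or_gt k K with hk' | hk'
      · exact hbase k (by simp [hk, hk'])
      · refine Int.leInduction (m := 0) (motive := fun k _ => InLat L lam g k) h0
          (fun n hn ih => ?_) k (by omega)
        exact inLat_succ hL hg ih (hs.lower_inj _ (by omega))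
    · refine Int.leInductionDown (m := -K) (motive := fun k _ => InLat L lam g k) hK
        (fun n hn ih => ?_) k hk.le
      exact inLat_pred hL hg ih (hs.raise_inj_neg _ (by omega))

end Limit

section LowDensity
open Filter Topology
variable {M : Type} [AddCommGroup M] [Module ℂ M] {L : ℤ → End ℂ M} {lam : ℂ} {m : M}

/-- The density relations for the single operator `L i`. -/
def DensityAt (L : ℤ → End ℂ M) (lam b : ℂ) (φ : ℤ → M) (i : ℤ) : Prop :=
  ∀ k : ℤ, L i (φ k) = (lam + k + i * b) • φ (k + i)

lemma DensityAt.add (hL : IsPrimary L L (-1)) {b : ℂ} {φ : ℤ → M} {i j : ℤ}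
    (hi : DensityAt L lam b φ i) (hj : DensityAt L lam b φ j) (hij : i ≠ j) :
    DensityAt L lam b φ (i + j) := by
  intro k
  have hne : (j : ℂ) - i ≠ 0 := sub_ne_zero.2 (by exact_mod_cast hij.symm)
  refine smul_right_injective M hne ?_
  have h := hL.apply_swap i j (φ k)
  rw [← sub_eq_iff_eq_add', hj k, hi k, map_smul, map_smul, hi, hj] at h
  have e1 : k + j + i = k + (i + j) := by ring
  have e2 : k + i + j = k + (i + j) := by ring
  rw [e1, e2] at h
  change ((j : ℂ) - i) • L (i + j) (φ k) = ((j : ℂ) - i) • _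
  rw [← h]
  push_cast
  module

/-- The density relations for all operators of degree at most one. -/
def IsLowDensity (L : ℤ → End ℂ M) (lam b : ℂ) (φ : ℤ → M) : Prop :=
  ∀ i ≤ 1, DensityAt L lam b φ i

lemma IsLowDensity.mem {b : ℂ} {φ : ℤ → M} (h : IsLowDensity L lam b φ) (k : ℤ) :
    φ k ∈ (L 0).eigenspace (lam + k) := by
  rw [Module.End.mem_eigenspace_iff, h 0 (by norm_num) k]; simp

lemma isLowDensity_of_generators (hL : IsPrimary L L (-1)) {b : ℂ} {φ : ℤ → M}
    (h1 : DensityAt L lam b φ 1) (h2 : DensityAt L lam b φ (-1))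
    (h3 : DensityAt L lam b φ (-2)) : IsLowDensity L lam b φ := by
  have h0 : DensityAt L lam b φ 0 := h1.add hL h2 (by norm_num)
  intro i hi
  rcases le_or_gt i (-2) with hi' | hi'
  · refine Int.leInductionDown (m := -2) (motive := fun i _ => DensityAt L lam b φ i) h3
      (fun n hn ih => ?_) i hi'
    rw [sub_eq_add_neg]
    exact ih.add hL h2 (by omega)
  · obtain rfl | rfl | rfl : i = -1 ∨ i = 0 ∨ i = 1 := by omega
    exacts [h2, h0, h1]

lemma IsStable.pow_raise_surj {K : ℤ} (hs : IsStable L lam K) (r : ℕ) {v : M}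
    (hv : v ∈ (L 0).eigenspace (lam + r)) :
    ∃ m ∈ (L 0).eigenspace lam, (L 1 ^ r) m = v := by
  induction r generalizing v with
  | zero => exact ⟨v, by simpa using hv, by simp⟩
  | succ r ih =>
    obtain ⟨u, hu, rfl⟩ := hs.raise_surj r (by omega) v (by push_cast at hv ⊢; exact hv)
    obtain ⟨m, hm, rfl⟩ := ih (v := u) (by simpa using hu)
    exact ⟨m, hm, pow_raise_succ r m⟩

/-- If the coefficient sequences of weight `lam + k` vanish, so do the lowering operators. -/
lemma eventually_lowering_eq_zero (hL : IsPrimary L L (-1))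
    (hfin : ∀ μ, FiniteDimensional ℂ ((L 0).eigenspace μ)) {K : ℤ} (hs : IsStable L lam K)
    {k : ℤ} (h : ∀ y, ∀ m ∈ (L 0).eigenspace lam, coeffSeq L y m k =ᶠ[atTop] 0) :
    ∀ᶠ n : ℤ in atTop, ∀ v ∈ (L 0).eigenspace (lam + (k + n : ℤ)), L (-n) v = 0 := by
  obtain ⟨b, Y, -, hY⟩ := exists_coords ((L 0).eigenspace (lam + k))
  obtain ⟨e, Z, he, hZ⟩ := exists_coords ((L 0).eigenspace lam)
  have h' : ∀ᶠ n in atTop, ∀ i j, coeffSeq L (Y i) (e j) k n = 0 :=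
    eventually_all.2 fun i => eventually_all.2 fun j => h (Y i) (e j) (he j)
  filter_upwards [h', eventually_toNat k] with n hn ⟨r, hr⟩ v hv
  rw [hr, Int.cast_natCast] at hv
  obtain ⟨m, hm, rfl⟩ := hs.pow_raise_surj r hv
  have hw (j) : word L n r (e j) = 0 := by
    rw [← hY _ (word_mem_of_eq hL (he j) hr)]
    refine Finset.sum_eq_zero fun i _ => ?_
    rw [← coeffSeq_eq hr, hn, zero_smul]
  have hm0 : word L n r m = 0 := by
    rw [← hZ m hm, word_sum]
    exact Finset.sum_eq_zero fun j _ => by rw [hw, smul_zero]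
  refine (smul_eq_zero.1 hm0).resolve_left (inv_ne_zero ?_)
  exact_mod_cast r.factorial_ne_zero

section Functional
variable {ι : Type} [Fintype ι] {g : ι → ℤ → ℂ} {Λ : (ℤ → ℂ) →ₗ[ℂ] ℂ}

lemma functional_congr (hΛ : ∀ u ∈ latZero g, Λ u = 0) {u v : ℤ → ℂ} (h : u =ᶠ[atTop] v) :
    Λ u = Λ v := by
  rw [← sub_eq_zero, ← map_sub]
  refine hΛ _ (mem_latZero_of_eventuallyEq (v := 0) ?_ (zero_mem _))
  filter_upwards [h] with n hn
  simp [hn]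

lemma functional_coeff_mul (hΛ : ∀ u ∈ latZero g, Λ u = 0) {c : ℤ → ℂ} {c₀ : ℂ}
    (hc : IsCoeff c c₀) {u : ℤ → ℂ} (hu : u ∈ lat g) : Λ (c * u) = c₀ * Λ u := by
  rw [← smul_eq_mul c₀, ← map_smul, ← sub_eq_zero, ← map_sub]
  have e : c * u - c₀ • u = (c - fun _ => c₀) * u := by
    funext n; simp; ring
  rw [e]
  exact hΛ _ (coeff_mul_mem_latZero (by simpa using hc.sub (IsCoeff.const c₀)) hu)

lemma functional_shiftEnd (hΛ : ∀ u ∈ latZero g, Λ u = 0) {u : ℤ → ℂ} (hu : nabla u ∈ lat g) :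
    Λ (shiftEnd u) = Λ u := by
  rw [← sub_eq_zero, ← map_sub]
  exact hΛ _ (shiftEnd_sub_mem_latZero hu)

end Functional

theorem exists_isLowDensity (hL : IsPrimary L L (-1))
    (hfin : ∀ μ, FiniteDimensional ℂ ((L 0).eigenspace μ)) {K : ℕ} (hs : IsStable L lam K) {k : ℤ}
    (hk : ¬ ∀ᶠ n : ℤ in atTop, ∀ v ∈ (L 0).eigenspace (lam + (k + n : ℤ)), L (-n) v = 0) :
    ∃ b φ, φ ≠ 0 ∧ IsLowDensity L lam b φ := by
  obtain ⟨ι, _, g, hg, hform, hlat⟩ := exists_lattice hL hfin hs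
  have h0 : ∃ i, ¬ g i =ᶠ[atTop] 0 := by
    by_contra! h0
    refine hk (eventually_lowering_eq_zero hL hfin hs fun y m hm => ?_)
    obtain ⟨c, -, -, hu⟩ := (hlat k y m hm).1
    filter_upwards [hu, eventually_all.2 h0] with n hn h0n
    rw [hn, Finset.sum_apply, Pi.zero_apply]
    exact Finset.sum_eq_zero fun i _ => by rw [Pi.mul_apply, h0n i, Pi.zero_apply, mul_zero]
  obtain ⟨Λ, β, ⟨i, hi⟩, hΛ, hβ⟩ := exists_lattice_functional hg h0
  obtain ⟨y₀, m, hm, k₀, hne⟩ : ∃ y, ∃ m ∈ (L 0).eigenspace lam, ∃ k,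
      Λ (coeffSeq L y m k) ≠ 0 := by
    obtain ⟨y, m, hm, k, h | h⟩ := hform i
    · exact ⟨y, m, hm, k, by rwa [← h]⟩
    · refine ⟨y, m, hm, k, fun hz => hi ?_⟩
      rw [h, hβ _ (hlat k y m hm).1, hz, mul_zero]
  choose b Y hb hY using fun k : ℤ => exists_coords ((L 0).eigenspace (lam + k))
  let φ (k : ℤ) : M := ∑ i, Λ (coeffSeq L (Y k i) m k) • b k i
  have hφ (y : Dual ℂ M) (k : ℤ) : y (φ k) = Λ (coeffSeq L y m k) := by
    have : coeffSeq L y m k =ᶠ[atTop] ∑ i, y (b k i) • coeffSeq L (Y k i) m k := by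
      filter_upwards [eventually_toNat k] with n ⟨r, hr⟩
      simp only [Finset.sum_apply, Pi.smul_apply, coeffSeq_eq hr, smul_eq_mul]
      conv_lhs => rw [← hY k _ (word_mem_of_eq hL hm hr), map_sum]
      refine Finset.sum_congr rfl fun i _ => ?_
      rw [map_smul, smul_eq_mul, mul_comm]
    rw [functional_congr hΛ this, map_sum, map_sum]
    refine Finset.sum_congr rfl fun i _ => ?_
    rw [map_smul, map_smul, smul_eq_mul, smul_eq_mul, mul_comm]
  have heq {u v : M} (h : ∀ y : Dual ℂ M, y u = y v) : u = v := by
    rw [← sub_eq_zero, ← Module.forall_dual_apply_eq_zero_iff ℂ]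
    exact fun y => by rw [map_sub, h, sub_self]
  refine ⟨β - lam, φ, fun hz => hne ?_, isLowDensity_of_generators hL ?_ ?_ ?_⟩
  · rw [← hφ, hz, Pi.zero_apply, map_zero]
  · intro k
    refine heq fun y => ?_
    obtain ⟨j, rfl⟩ : ∃ j, k = j - 1 := ⟨k + 1, by ring⟩
    have hj := hlat j y m hm
    rw [← LinearMap.comp_apply, hφ, ← functional_shiftEnd hΛ (hlat _ _ m hm).2,
      functional_congr hΛ (coeffSeq_raise hL y m j), map_add, map_smul,
      functional_coeff_mul hΛ (IsCoeff.add_div _) hj.2, hβ _ hj.1, map_smul, sub_add_cancel, hφ]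
    simp only [smul_eq_mul]; push_cast; ring
  · intro k
    refine heq fun y => ?_
    obtain ⟨j, rfl⟩ : ∃ j, k = j + 1 := ⟨k - 1, by ring⟩
    have hj := hlat j y m hm
    rw [← LinearMap.comp_apply, hφ, functional_congr hΛ (coeffSeq_lower hL hm y j), map_sub,
      map_add, functional_coeff_mul hΛ (IsCoeff.inv_add _) (hlat _ _ _ (casimir_mem hL hm)).1,
      functional_coeff_mul hΛ (IsCoeff.ratio _ _ _) hj.1,
      functional_coeff_mul hΛ (IsCoeff.add_div _) hj.2, hβ _ hj.1, map_smul,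
      add_neg_cancel_right, hφ]
    simp only [smul_eq_mul]; push_cast; ring
  · intro k
    refine heq fun y => ?_
    obtain ⟨j, rfl⟩ : ∃ j, k = j + 2 := ⟨k - 2, by ring⟩
    have hj := hlat j y m hm
    obtain ⟨q, s, hqs⟩ := coeffSeq_lower_two hL hm y j
    have hn : nabla (nabla (coeffSeq L y m j)) ∈ lat g := nabla_mem_lat hg hj.2
    rw [← LinearMap.comp_apply, hφ, functional_congr hΛ hqs, map_sub, map_sub, map_add, map_add,
      functional_coeff_mul hΛ (IsCoeff.ratio_two _ _ _ _ _) (hlat _ _ _ (cubic_mem hL hm)).1,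
      functional_coeff_mul hΛ (IsCoeff.ratio_two _ _ _ _ _) (hlat _ _ _ (casimir_mem hL hm)).1,
      functional_coeff_mul hΛ (IsCoeff.ratio_two _ _ _ _ _) hj.1,
      functional_coeff_mul hΛ (IsCoeff.add_div _) hj.2,
      functional_coeff_mul hΛ (IsCoeff.ratio _ _ _) (shiftEnd_mem_lat hj.2 hn),
      functional_shiftEnd hΛ hn, hβ _ hj.1, map_smul, add_neg_cancel_right, hφ]
    simp only [smul_eq_mul]; push_cast; ring

end LowDensity

section Extension
open Filter Topology
variable {M : Type} [AddCommGroup M] [Module ℂ M] {L : ℤ → End ℂ M} {lam b : ℂ} {φ : ℤ → M}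

/-- A small perturbation of the identity is injective on a finite-dimensional subspace. -/
lemma eventually_injective (W : Submodule ℂ M) [FiniteDimensional ℂ W] {κ : Type} [Fintype κ]
    (A : κ → End ℂ M) {c₀ : ℤ → ℂ} (hc₀ : IsCoeff c₀ 1) {c : κ → ℤ → ℂ}
    (hc : ∀ i, IsCoeff (c i) 0) :
    ∀ᶠ n in atTop, ∀ v ∈ W, c₀ n • v + ∑ s, c s n • A s v = 0 → v = 0 := by
  classical
  obtain ⟨e, Y, he, hY⟩ := exists_coords W
  have hsum (i j) (T : Finset κ) :
      IsCoeff (fun n => ∑ s ∈ T, c s n * Y i (A s (e j))) 0 := by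
    induction T using Finset.induction_on with
    | empty => simpa using IsCoeff.const 0
    | insert s T hs ih =>
      simp only [Finset.sum_insert hs]
      have := ((hc s).mul (IsCoeff.const (Y i (A s (e j))))).add ih
      rw [zero_mul, zero_add] at this
      exact this
  have hdiag (i j : Fin (finrank ℂ W)) :
      IsCoeff (fun n => if i = j then c₀ n else 0) (if i = j then 1 else 0) := by
    split_ifs
    · exact hc₀
    · exact IsCoeff.const 0
  obtain ⟨C, -, hC⟩ := exists_coeff_inverse
    (B := fun i j => (fun n => if i = j then c₀ n else 0) +
      fun n => ∑ s, c s n * Y i (A s (e j)))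
    fun i j => by simpa using (hdiag i j).add (hsum i j Finset.univ)
  filter_upwards [hC] with n hn v hv h
  have hB (i) : ∑ j, ((if i = j then c₀ n else 0) + ∑ s, c s n * Y i (A s (e j))) * Y j v = 0 := by
    have h1 := congrArg (Y i) h
    simp only [map_add, map_smul, map_sum, map_zero, smul_eq_mul] at h1
    refine Eq.trans ?_ h1
    have h2 : ∑ j, (if i = j then c₀ n else 0) * Y j v = c₀ n * Y i v := by simp
    rw [Finset.sum_congr rfl fun j _ => add_mul _ _ (Y j v), Finset.sum_add_distrib, h2]
    congr 1
    simp only [Finset.sum_mul]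
    rw [Finset.sum_comm]
    refine Finset.sum_congr rfl fun s _ => ?_
    conv_rhs => rw [← hY v hv, map_sum, map_sum, Finset.mul_sum]
    refine Finset.sum_congr rfl fun j _ => ?_
    rw [map_smul, map_smul, smul_eq_mul]; ring
  have hz (i) : Y i v = 0 := by
    have h2 : ∑ l, C i l n * ∑ j, ((if l = j then c₀ n else 0)
        + ∑ s, c s n * Y l (A s (e j))) * Y j v = 0 :=
      Finset.sum_eq_zero fun l _ => by rw [hB, mul_zero]
    simp only [Finset.mul_sum, ← mul_assoc] at h2
    rw [Finset.sum_comm] at h2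
    simp only [← Finset.sum_mul] at h2
    have h3 (j) := hn i j
    simp only [Pi.add_apply] at h3
    simpa [h3] using h2
  rw [← hY v hv]
  exact Finset.sum_eq_zero fun i _ => by rw [hz, zero_smul]

lemma IsStable.pow_raise_inj {K : ℤ} (hL : IsPrimary L L (-1)) (hs : IsStable L lam K) (r : ℕ)
    {m : M} (hm : m ∈ (L 0).eigenspace lam) (h : (L 1 ^ r) m = 0) : m = 0 := by
  induction r with
  | zero => simpa using h
  | succ r ih =>
    rw [pow_raise_succ] at h
    exact ih (hs.raise_inj r (by omega) _ (by simpa using pow_raise_mem hL hm r) h)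

/-- The failure of the density relations for `L 2`. -/
def defect (L : ℤ → End ℂ M) (lam b : ℂ) (φ : ℤ → M) (k : ℤ) : M :=
  L 2 (φ k) - (lam + k + 2 * b) • φ (k + 2)

lemma defect_mem (hL : IsPrimary L L (-1)) (h : IsLowDensity L lam b φ) (k : ℤ) :
    defect L lam b φ k ∈ (L 0).eigenspace (lam + k + 2) := by
  refine sub_mem (hL.mem_add 2 (h.mem k) (by push_cast; ring)) (Submodule.smul_mem _ _ ?_)
  convert h.mem (k + 2) using 2
  push_cast; ring

lemma apply_defect (hL : IsPrimary L L (-1)) (h : IsLowDensity L lam b φ) {i : ℤ} (hi : i ≤ -1)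
    (k : ℤ) : L i (defect L lam b φ k) = (lam + k + i * b) • defect L lam b φ (k + i) := by
  have e1 : k + (i + 2) = k + i + 2 := by ring
  have e2 : k + 2 + i = k + i + 2 := by ring
  rw [defect, defect, map_sub, map_smul, hL.apply_swap i 2, h i (by omega) k,
    h (i + 2) (by omega) k, h i (by omega) (k + 2), map_smul, e1, e2]
  push_cast
  module

/-- The cubic relation satisfied by the defects, pulled back to the base weight. -/
lemma defect_relation (hL : IsPrimary L L (-1)) (h : IsLowDensity L lam b φ) {K : ℤ}
    (hs : IsStable L lam K) {r : ℕ} {v : M} (hv : v ∈ (L 0).eigenspace lam)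
    (hr : (L 1 ^ (r + 2)) v = defect L lam b φ r) {x : ℂ} (hx : x = lam + r) :
    (x * (x + 1) * (x + 2) * (2 * x - b * (b + 3))) • v
      + ((x - 2 * b) * (2 * (x + 1) ^ 2) - 3 * x * (x - b) * (x - 1 - b)) • casimir L v
      + (x - 2 * b) • casimir L (casimir L v)
      - ((x - b) * (x - 1 - b)) • cubic L v = 0 := by
  have hC := casimir_mem hL hv
  have hCC := casimir_mem hL hC
  have hQ := cubic_mem hL hv
  refine hs.pow_raise_inj hL r ?_ ?_
  · exact sub_mem (add_mem (add_mem (Submodule.smul_mem _ _ hv) (Submodule.smul_mem _ _ hC))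
      (Submodule.smul_mem _ _ hCC)) (Submodule.smul_mem _ _ hQ)
  · have hw := pow_raise_mem hL hv r
    have hw1 := hL.mem_add 1 hw rfl
    have h1 : L (-1) (L (-1) (defect L lam b φ r))
        = ((x - b) * (x - 1 - b)) • defect L lam b φ (r - 2) := by
      have e : (r : ℤ) + -1 + -1 = r - 2 := by ring
      rw [apply_defect hL h le_rfl, map_smul, apply_defect hL h le_rfl, e, hx]
      push_cast; module
    have h2 : L (-2) (defect L lam b φ r) = (x - 2 * b) • defect L lam b φ (r - 2) := by
      rw [apply_defect hL h (by norm_num), hx, sub_eq_add_neg (r : ℤ)]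
      push_cast; module
    have h3 : L (-1) (L (-1) (defect L lam b φ r)) = (L 1 ^ r) (casimir L (casimir L v))
        + (2 * (x + 1) ^ 2) • (L 1 ^ r) (casimir L v)
        + ((x + 1) * (x + 2) * (x * (x + 1))) • (L 1 ^ r) v := by
      rw [← hr, pow_raise_succ, pow_raise_succ, lower_raise hw1, map_add, map_smul,
        casimir_raise hL hw, lower_raise (casimir_mem hL hw), lower_raise hw,
        casimir_pow hL hv, casimir_pow hL hC, hx]
      push_cast; module
    have h4 : L (-2) (defect L lam b φ r) = (L 1 ^ r) (cubic L v)
        + (x * (x + 1) * (x + 2)) • (L 1 ^ r) v + (3 * x) • (L 1 ^ r) (casimir L v) := by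
      rw [← hr, pow_raise_succ, pow_raise_succ, lower_raise_two hL hw, casimir_pow hL hv,
        cubic_pow hL hv, hx]
    have h5 : (x - 2 * b) • L (-1) (L (-1) (defect L lam b φ r))
        - ((x - b) * (x - 1 - b)) • L (-2) (defect L lam b φ r) = 0 := by
      rw [h1, h2]; module
    rw [h3, h4] at h5
    rw [← h5]
    simp only [map_add, map_sub, map_smul]
    module

lemma eventually_defect_eq_zero (hL : IsPrimary L L (-1))
    (hfin : ∀ μ, FiniteDimensional ℂ ((L 0).eigenspace μ)) {K : ℤ} (hs : IsStable L lam K)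
    (h : IsLowDensity L lam b φ) : ∀ᶠ n in atTop, defect L lam b φ n = 0 := by
  have lin (a : ℂ) : IsCoeff (fun n : ℤ => ((n : ℂ) + a) * (n : ℂ)⁻¹) 1 := IsCoeff.add_div a
  have inv : IsCoeff (fun n : ℤ => (n : ℂ)⁻¹) 0 := IsCoeff.index_inv
  let A : Fin 3 → End ℂ M := ![casimir L, casimir L * casimir L, cubic L]
  let x (n : ℤ) : ℂ := lam + n
  let c₀ (n : ℤ) : ℂ := (x n * (x n + 1) * (x n + 2) * (2 * x n - b * (b + 3)))
    * ((n : ℂ)⁻¹ ^ 4 * 2⁻¹)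
  let c : Fin 3 → ℤ → ℂ := ![
    fun n => ((x n - 2 * b) * (2 * (x n + 1) ^ 2) - 3 * x n * (x n - b) * (x n - 1 - b))
      * ((n : ℂ)⁻¹ ^ 4 * 2⁻¹),
    fun n => (x n - 2 * b) * ((n : ℂ)⁻¹ ^ 4 * 2⁻¹),
    fun n => -((x n - b) * (x n - 1 - b)) * ((n : ℂ)⁻¹ ^ 4 * 2⁻¹)]
  have hc₀ : IsCoeff c₀ 1 := by
    refine (show IsCoeff _ _ by
      simpa using (((lin lam).mul (lin (lam + 1))).mul (lin (lam + 2))).mul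
        (lin (lam - b * (b + 3) / 2))).congr (Eventually.of_forall fun n => ?_)
    simp [c₀, x]; ring
  have hc (i) : IsCoeff (c i) 0 := by
    fin_cases i
    · refine (show IsCoeff _ _ by
        simpa using inv.mul ((((lin (lam - 2 * b)).mul ((lin (lam + 1)).mul (lin (lam + 1))))).sub
          ((((lin lam).mul (lin (lam - b))).mul (lin (lam - 1 - b))).smul (3 / 2)))).congr
        (Eventually.of_forall fun n => ?_)
      simp [c, x]; ring
    · refine (show IsCoeff _ _ by
        simpa using (inv.mul (inv.mul inv)).mul ((lin (lam - 2 * b)).smul (1 / 2))).congr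
        (Eventually.of_forall fun n => ?_)
      simp [c, x]; ring
    · refine (show IsCoeff _ _ by
        simpa using (inv.mul inv).mul
          (((lin (lam - b)).mul (lin (lam - 1 - b))).smul (-1 / 2))).congr
        (Eventually.of_forall fun n => ?_)
      simp [c, x]; ring
  filter_upwards [eventually_injective ((L 0).eigenspace lam) A hc₀ hc, eventually_ge_atTop 0]
    with n hn hn0
  lift n to ℕ using hn0
  have hmem := defect_mem hL h n
  obtain ⟨v, hv, hr⟩ := hs.pow_raise_surj (n + 2) (v := defect L lam b φ n) (by
    convert hmem using 2; push_cast; ring)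
  have hrel := defect_relation hL h hs hv hr (x := x n) (by simp [x])
  rw [← hr, hn v hv ?_, map_zero]
  rw [← smul_zero (((n : ℤ) : ℂ)⁻¹ ^ 4 * 2⁻¹), ← hrel]
  rw [Fin.sum_univ_three]
  change c₀ n • v + ((((x n - 2 * b) * (2 * (x n + 1) ^ 2) - 3 * x n * (x n - b) * (x n - 1 - b))
      * (((n : ℤ) : ℂ)⁻¹ ^ 4 * 2⁻¹)) • casimir L v
    + ((x n - 2 * b) * (((n : ℤ) : ℂ)⁻¹ ^ 4 * 2⁻¹)) • casimir L (casimir L v)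
    + (-((x n - b) * (x n - 1 - b)) * (((n : ℤ) : ℂ)⁻¹ ^ 4 * 2⁻¹)) • cubic L v) = _
  simp only [c₀]
  module

lemma IsLowDensity.isDensity (hL : IsPrimary L L (-1))
    (hfin : ∀ μ, FiniteDimensional ℂ ((L 0).eigenspace μ)) {K : ℤ} (hs : IsStable L lam K)
    (h : IsLowDensity L lam b φ) (hb : b ≠ 1) : IsDensity L lam b φ := by
  have hb' : 1 - b ≠ 0 := sub_ne_zero.2 hb.symm
  have hz (k : ℤ) : defect L lam b φ k = 0 := by
    have h1 := (tendsto_atTop_add_const_left atTop k tendsto_id).eventually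
      (eventually_defect_eq_zero hL hfin hs h)
    obtain ⟨n, hn, hn1, hn2⟩ := (h1.and ((eventually_ge_atTop 1).and
      (eventually_add_ne_zero ((lam + k) / (1 - b))))).exists
    have h2 := apply_defect hL h (i := -n) (by omega) (k + n)
    rw [add_neg_cancel_right] at h2
    simp only [id] at hn
    rw [hn, map_zero] at h2
    refine (smul_eq_zero.1 h2.symm).resolve_left fun hc => hn2 ?_
    field_simp
    push_cast at hc
    linear_combination hc
  have h2 : DensityAt L lam b φ 2 := fun k => by
    have := hz k
    rw [defect, sub_eq_zero] at this
    rw [this]; push_cast; rfl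
  intro i
  rcases le_or_gt i 1 with hi | hi
  · exact h i hi
  · refine Int.leInduction (m := 2) (motive := fun i _ => DensityAt L lam b φ i) h2
      (fun n hn ih => ?_) i hi
    exact ih.add hL (h 1 le_rfl) (by omega)

lemma exists_isDensity_of_isLowDensity (hL : IsPrimary L L (-1))
    (hfin : ∀ μ, FiniteDimensional ℂ ((L 0).eigenspace μ)) {K : ℤ} (hs : IsStable L lam K)
    (h : IsLowDensity L lam b φ) (h0 : φ ≠ 0) : ∃ lam b φ, φ ≠ 0 ∧ IsDensity L lam b φ := by
  by_cases hb : b = 1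
  swap
  · exact ⟨lam, b, φ, h0, h.isDensity hL hfin hs hb⟩
  subst hb
  by_cases hk : ∃ k : ℤ, lam + k ≠ 0 ∧ φ k ≠ 0
  · obtain ⟨k, hk, hφ⟩ := hk
    have hψ : IsLowDensity L lam 0 fun k => (lam + k) • φ k := fun i hi k => by
      change L i ((lam + k) • φ k) = _ • (lam + (k + i : ℤ)) • φ (k + i)
      rw [map_smul, h i hi k]; push_cast; module
    exact ⟨lam, 0, _, fun hz => smul_ne_zero hk hφ (congrFun hz k),
      hψ.isDensity hL hfin hs zero_ne_one⟩
  · push Not at hk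
    obtain ⟨k₀, hk₀⟩ := Function.ne_iff.1 h0
    have hlam : lam + k₀ = 0 := by
      by_contra hc
      exact hk₀ (hk k₀ hc)
    have hv (i : ℤ) (hi : i ≤ 1) : L i (φ k₀) = 0 := by
      rw [h i hi k₀]
      rcases eq_or_ne i 0 with rfl | hi0
      · rw [Int.cast_zero, zero_mul, add_zero, hlam, zero_smul]
      · rw [hk (k₀ + i), smul_zero]
        push_cast
        rw [← add_assoc, hlam, zero_add]
        exact_mod_cast hi0
    have hψ : IsLowDensity L lam (-1) fun k => L (k - k₀) (φ k₀) := fun i hi k => by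
      change L i (L (k - k₀) (φ k₀)) = _ • L (k + i - k₀) (φ k₀)
      have e : i + (k - k₀) = k + i - k₀ := by ring
      rw [hL.apply_swap, hv i hi, map_zero, zero_add, e]
      congr 1
      push_cast
      linear_combination -hlam
    by_cases hψ0 : (fun k => L (k - k₀) (φ k₀)) = 0
    · refine ⟨0, 1, _, fun hz => hk₀ ?_, isDensity_single (v := φ k₀) fun i => ?_⟩
      · simpa using congrFun hz 0
      · simpa using congrFun hψ0 (i + k₀)
    · exact ⟨lam, -1, _, hψ0, hψ.isDensity hL hfin hs (by norm_num)⟩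

lemma exists_isDensity_of_lowering (hL : IsPrimary L L (-1))
    (hfin : ∀ μ, FiniteDimensional ℂ ((L 0).eigenspace μ)) {N : ℕ}
    (hN : ∀ μ, finrank ℂ ((L 0).eigenspace μ) ≤ N) {k : ℤ}
    (hk : ¬ ∀ᶠ n : ℤ in atTop, ∀ v ∈ (L 0).eigenspace (lam + (k + n : ℤ)), L (-n) v = 0) :
    ∃ lam b φ, φ ≠ 0 ∧ IsDensity L lam b φ := by
  obtain ⟨t, K, hs⟩ := exists_isStable hL hfin hN lam
  obtain ⟨b, φ, h0, hφ⟩ := exists_isLowDensity hL hfin hs (k := k - t) (by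
    convert hk using 7
    push_cast; ring)
  exact exists_isDensity_of_isLowDensity hL hfin hs hφ h0

/-- A nonzero bounded weight module over the Witt algebra contains a nonzero quotient of a
density module. -/
theorem exists_isDensity (hL : IsPrimary L L (-1))
    (hfin : ∀ μ, FiniteDimensional ℂ ((L 0).eigenspace μ)) {N : ℕ}
    (hN : ∀ μ, finrank ℂ ((L 0).eigenspace μ) ≤ N) (hw : ⨆ μ : ℂ, (L 0).eigenspace μ = ⊤)
    (hM : ∃ v : M, v ≠ 0) : ∃ lam b φ, φ ≠ 0 ∧ IsDensity L lam b φ := by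
  by_cases hp : ∀ (lam : ℂ) (k : ℤ), ∀ᶠ n : ℤ in atTop,
      ∀ v ∈ (L 0).eigenspace (lam + (k + n : ℤ)), L (-n) v = 0
  swap
  · push Not at hp
    obtain ⟨lam, k, hk⟩ := hp
    exact exists_isDensity_of_lowering hL hfin hN (lam := lam) (k := k) (by
      rw [not_eventually]; push Not; exact hk)
  by_cases hm : ∀ (lam : ℂ) (k : ℤ), ∀ᶠ n : ℤ in atTop,
      ∀ v ∈ (L 0).eigenspace (-(lam + (k + n : ℤ))), L n v = 0
  swap
  · push Not at hm
    obtain ⟨lam, k, hk⟩ := hm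
    obtain ⟨lam, b, φ, h0, hφ⟩ := exists_isDensity_of_lowering hL.mirror
      (fun μ => by rw [eigenspace_mirror]; exact hfin _)
      (fun μ => by rw [eigenspace_mirror]; exact hN _) (lam := lam) (k := k) (by
        rw [not_eventually]; push Not
        simpa only [eigenspace_mirror, neg_neg, LinearMap.neg_apply, ne_eq, neg_eq_zero] using hk)
    refine ⟨-lam, b, fun k => φ (-k), fun hz => h0 ?_, fun i k => ?_⟩
    · funext k
      simpa using congrFun hz (-k)
    · have := hφ (-i) (-k)
      rw [LinearMap.neg_apply, neg_neg, neg_eq_iff_eq_neg] at this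
      rw [this, ← neg_smul, ← neg_add]
      push_cast
      congr 1; ring
  have hz (j : ℤ) : L j = 0 := by
    refine LinearMap.ext fun v => ?_
    have hv : v ∈ ⨆ μ : ℂ, (L 0).eigenspace μ := hw ▸ Submodule.mem_top
    induction hv using Submodule.iSup_induction' with
    | zero => simp
    | add u v _ _ hu hv => rw [map_add, hu, hv]; simp
    | mem μ v hv =>
      have h2 := (tendsto_atTop_add_const_left atTop j tendsto_id).eventually (hm (-μ) (-j))
      obtain ⟨n, h1, h2, h3⟩ := ((hp μ j).and (h2.and (eventually_add_ne_zero (j / 2)))).exists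
      simp only [id] at h2
      have h4 := hL.apply_swap (-n) (j + n) v
      have e : -n + (j + n) = j := by ring
      rw [h1 _ (hL.mem_add _ hv (by push_cast; ring)),
        h2 _ (hL.mem_add _ hv (by push_cast; ring)), zero_add, e] at h4
      refine (smul_eq_zero.1 h4.symm).resolve_left fun hc => h3 ?_
      push_cast at hc
      linear_combination hc / 2
  obtain ⟨v, hv⟩ := hM
  refine ⟨0, 1, _, fun h => hv ?_, isDensity_single (v := v) fun i => by rw [hz]; rfl⟩
  simpa using congrFun h 0

end Extension

/-- Up to a parity change, any simple cuspidal `g`-module is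
isomorphic to a simple quotient of a tensor module `Γ(λ, V, b)` for some
finite-dimensional simple `ġ`-module `V` and some `λ, b ∈ ℂ`.  (Being a simple
quotient is expressed by a surjective equivariant linear map `π` from
`Γ(λ, V, b)`; "up to a parity change" means that `π` either preserves or
reverses parity.) -/
theorem simple_cuspidal_g_module_classification
    (𝕘 : Type) [LieRing 𝕘] [LieAlgebra ℂ 𝕘] [FiniteDimensional ℂ 𝕘]
    [LieAlgebra.IsSimple ℂ 𝕘]
    (M : Type) [AddCommGroup M] [Module ℂ M]
    (L G : ℤ → End ℂ M) (E F : ℤ → 𝕘 →ₗ[ℂ] End ℂ M)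
    (gr : Fin 2 → Submodule ℂ M)
    (hrep : IsGRep 𝕘 L G E F)
    (hsuper : IsGSuper 𝕘 gr L G E F)
    (hsimple : IsSimpleRep (gOps 𝕘 L G E F) gr)
    (hcusp : IsCuspidalMod (L 0)) :
    ∃ (D : SimpleFDModuleData 𝕘) (lam b : ℂ) (π : TMod D.V →ₗ[ℂ] M),
      Function.Surjective π ∧
      (∀ i : ℤ, π ∘ₗ tmL D.V lam b i = (L i : M →ₗ[ℂ] M) ∘ₗ π) ∧
      (∀ i : ℤ, π ∘ₗ tmG D.V lam b i = (G i : M →ₗ[ℂ] M) ∘ₗ π) ∧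
      (∀ (i : ℤ) (x : 𝕘), π ∘ₗ tmE D.V i x = (E i x : M →ₗ[ℂ] M) ∘ₗ π) ∧
      (∀ (i : ℤ) (x : 𝕘), π ∘ₗ tmF D.V i x = (F i x : M →ₗ[ℂ] M) ∘ₗ π) ∧
      ((∀ q, (tmGr D.V q).map π ≤ gr q) ∨ (∀ q, (tmGr D.V q).map π ≤ gr (q + 1))) := by
  obtain ⟨hw, N, hN⟩ := hcusp
  have hfin (μ : ℂ) : FiniteDimensional ℂ ((L 0).eigenspace μ) :=
    Module.rank_lt_aleph0_iff.1 ((hN μ).trans_lt Cardinal.natCast_lt_aleph0)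
  obtain ⟨lam, b, φ, h0, hφ⟩ := exists_isDensity hrep.primary_L hfin
    (fun μ => finrank_le_of_rank_le (hN μ)) hw hsimple.1
  obtain ⟨lam, b, φ, h0, hφ⟩ := exists_isNice hrep hfin hφ h0
  exact exists_tensorMap hrep hsuper hsimple hfin h0 hφ
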